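/- Under Assumptions 1, 2 and 3, √n·(U_n(U⁻¹(p)) − p) converges in distribution, as n → ∞, to the centered normal law with variance σ² = 4 Σ_{r∈ℤ} Cov(h₁(X_0,U⁻¹(p)), h₁(X_r,U⁻¹(p))) (the one-dimensional marginal at s = 1 of the invariance principle for the U-statistic process, Proposition A.1). -/

import Mathlib

open MeasureTheory Filter Set
open scoped ENNReal NNReal Topology BigOperators

noncomputable section

namespace UQuantile

variable {Ω : Type*} [MeasurableSpace Ω]

/-- Strict stationarity of the pair process `((X_i, Z_i))_{i ∈ ℤ}`. -/
def IsPairStationary (P : Measure Ω) (X Z : ℤ → Ω → ℝ) : Prop :=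
  ∀ (k : ℤ) (n : ℕ) (idx : Fin n → ℤ),
    P.map (fun ω i => (X (idx i) ω, Z (idx i) ω)) =
      P.map (fun ω i => (X (idx i + k) ω, Z (idx i + k) ω))

/-- Near epoch dependence in probability (PNED) of `X` on `Z` with approximation
constants `a` and gauge function `φ`. -/
def PNED (P : Measure Ω) (X Z : ℤ → Ω → ℝ) (a : ℕ → ℝ) (φ : ℝ → ℝ) : Prop :=
  ∃ f : (l : ℕ) → ((Fin (2 * l + 1) → ℝ) → ℝ),
    (∀ l, Measurable (f l)) ∧
      ∀ (l : ℕ), ∀ ε > (0 : ℝ),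
        (P {ω | ε < |X 0 ω - f l fun i => Z (((i : ℕ) : ℤ) - (l : ℤ)) ω|}).toReal ≤ a l * φ ε

/-- The σ-field generated by `..., Z_{-1}, Z_0`. -/
def pastSigma (Z : ℤ → Ω → ℝ) : MeasurableSpace Ω :=
  ⨆ i : {i : ℤ // i ≤ 0}, MeasurableSpace.comap (Z i) Real.measurableSpace

/-- The σ-field generated by `Z_k, Z_{k+1}, ...`. -/
def futureSigma (Z : ℤ → Ω → ℝ) (k : ℕ) : MeasurableSpace Ω :=
  ⨆ i : {i : ℤ // (k : ℤ) ≤ i}, MeasurableSpace.comap (Z i) Real.measurableSpace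

/-- The σ-field generated by `Z_{-l}, ..., Z_l`. -/
def rangeSigma (Z : ℤ → Ω → ℝ) (l : ℕ) : MeasurableSpace Ω :=
  ⨆ i : {i : ℤ // -(l : ℤ) ≤ i ∧ i ≤ l}, MeasurableSpace.comap (Z i) Real.measurableSpace

/-- `β` bounds the absolute regularity coefficients of `Z`: for every `k` and every pair of
finite measurable partitions of `Ω` into past, resp. future measurable sets,
`(1/2) Σ_{i,j} |P(A_i ∩ B_j) - P(A_i) P(B_j)| ≤ β k`. -/
def IsBetaBound (P : Measure Ω) (Z : ℤ → Ω → ℝ) (β : ℕ → ℝ) : Prop :=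
  ∀ (k m m' : ℕ) (A : Fin m → Set Ω) (B : Fin m' → Set Ω),
    (∀ i, MeasurableSet[pastSigma Z] (A i)) →
    (∀ j, MeasurableSet[futureSigma Z k] (B j)) →
    Pairwise (Function.onFun Disjoint A) → Pairwise (Function.onFun Disjoint B) →
    (⋃ i, A i) = univ → (⋃ j, B j) = univ →
    (1 / 2 : ℝ) * ∑ i, ∑ j,
        |(P (A i ∩ B j)).toReal - (P (A i)).toReal * (P (B j)).toReal| ≤ β k

/-- Assumption 1: `((X_i, Z_i))` is strictly stationary, `X` is PNED on `Z` with
`a_l φ(l^{-6}) = O(l^{-6})`, and `Z` is absolutely regular with `Σ k β_k < ∞`. -/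
structure Assumption1 (P : Measure Ω) (X Z : ℤ → Ω → ℝ) : Prop where
  stationary : IsPairStationary P X Z
  pned : ∃ (a : ℕ → ℝ) (φ : ℝ → ℝ),
    Tendsto a atTop (𝓝 0) ∧ AntitoneOn φ (Ioi 0) ∧ (∀ x > (0 : ℝ), 0 < φ x) ∧
      PNED P X Z a φ ∧
      (fun l : ℕ => a l * φ ((l : ℝ) ^ (-6 : ℤ))) =O[atTop] fun l : ℕ => (l : ℝ) ^ (-6 : ℤ)
  mixing : ∃ β : ℕ → ℝ, (∀ k, 0 ≤ β k) ∧ IsBetaBound P Z β ∧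
      Summable fun k : ℕ => (k : ℝ) * β k

/-- A U-quantile kernel function: nonnegative, bounded, measurable, symmetric in the first
two arguments and non-decreasing in the third. -/
structure IsUQKernel (h : ℝ → ℝ → ℝ → ℝ) : Prop where
  nonneg : ∀ x y t, 0 ≤ h x y t
  bounded : ∃ M, ∀ x y t, h x y t ≤ M
  measurable : Measurable fun q : ℝ × ℝ × ℝ => h q.1 q.2.1 q.2.2
  symm : ∀ x y t, h x y t = h y x t
  mono : ∀ x y, Monotone (h x y)

/-- The empirical U-distribution function `U_n(t)`. -/
def Ustat (X : ℤ → Ω → ℝ) (h : ℝ → ℝ → ℝ → ℝ) (n : ℕ) (t : ℝ) (ω : Ω) : ℝ :=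
  (2 / ((n : ℝ) * ((n : ℝ) - 1))) *
    ∑ i ∈ Finset.Icc (1 : ℤ) (n : ℤ), ∑ j ∈ Finset.Ioc i (n : ℤ), h (X i ω) (X j ω) t

/-- The population U-distribution function `U(t) = E h(X, Y, t)` for `X, Y` independent
with law `μ`. -/
def Udist (μ : Measure ℝ) (h : ℝ → ℝ → ℝ → ℝ) (t : ℝ) : ℝ := ∫ x, ∫ y, h x y t ∂μ ∂μ

/-- The linear part of the Hoeffding decomposition, `h₁(x, t) = E h(x, X₀, t) - U(t)`. -/
def h1 (μ : Measure ℝ) (h : ℝ → ℝ → ℝ → ℝ) (x t : ℝ) : ℝ := (∫ y, h x y t ∂μ) - Udist μ h t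

/-- The degenerate part of the Hoeffding decomposition. -/
def h2 (μ : Measure ℝ) (h : ℝ → ℝ → ℝ → ℝ) (x y t : ℝ) : ℝ :=
  h x y t - h1 μ h x t - h1 μ h y t - Udist μ h t

/-- The population `p`-U-quantile `U⁻¹(p)`. -/
def Uinv (μ : Measure ℝ) (h : ℝ → ℝ → ℝ → ℝ) (p : ℝ) : ℝ := sInf {t | p ≤ Udist μ h t}

/-- The empirical `p`-U-quantile `U_n⁻¹(p)`. -/
def UinvEmp (X : ℤ → Ω → ℝ) (h : ℝ → ℝ → ℝ → ℝ) (n : ℕ) (p : ℝ) (ω : Ω) : ℝ :=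
  sInf {t | p ≤ Ustat X h n t ω}

/-- The variation condition for `h(·,·,t)` with constant `L`, with respect to the law `μ`. -/
def VariationAt (μ : Measure ℝ) (h : ℝ → ℝ → ℝ → ℝ) (L t : ℝ) : Prop :=
  ∀ ε > (0 : ℝ),
    ∫⁻ q : ℝ × ℝ, ENNReal.ofReal
        ((⨆ r ∈ Metric.closedBall q ε, |h r.1 r.2 t - h q.1 q.2 t|) ^ 2) ∂(μ.prod μ)
      ≤ ENNReal.ofReal (L * ε)

/-- Assumption 2: the variation condition holds for all `t` in a neighborhood of `U⁻¹(p)`. -/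
def Assumption2 (μ : Measure ℝ) (h : ℝ → ℝ → ℝ → ℝ) (p : ℝ) : Prop :=
  ∃ L δ : ℝ, 0 < δ ∧ ∀ t, |t - Uinv μ h p| < δ → VariationAt μ h L t

/-- Assumption 3: `U` is differentiable near `U⁻¹(p)` with derivative `u`,
`u(U⁻¹(p)) > 0`, and a `3/2`-order Taylor-type expansion holds at `U⁻¹(p)`. -/
def Assumption3 (μ : Measure ℝ) (h : ℝ → ℝ → ℝ → ℝ) (p : ℝ) (u : ℝ → ℝ) : Prop :=
  (∀ᶠ t in 𝓝 (Uinv μ h p), HasDerivAt (Udist μ h) (u t) t) ∧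
    0 < u (Uinv μ h p) ∧
    (fun t => Udist μ h t - p - u (Uinv μ h p) * (t - Uinv μ h p)) =o[𝓝 (Uinv μ h p)]
      fun t => |t - Uinv μ h p| ^ ((3 : ℝ) / 2)

/-- The lag-`r` autocovariance `Cov(f(X_0), f(X_r))`. -/
def covShift (P : Measure Ω) (X : ℤ → Ω → ℝ) (f : ℝ → ℝ) (r : ℤ) : ℝ :=
  (∫ ω, f (X 0 ω) * f (X r ω) ∂P) - (∫ ω, f (X 0 ω) ∂P) * ∫ ω, f (X r ω) ∂P

/-- The long-run variance `σ_p²` of the `p`-U-quantile. -/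
def lrv (P : Measure Ω) (X : ℤ → Ω → ℝ) (h : ℝ → ℝ → ℝ → ℝ) (p : ℝ) (u : ℝ → ℝ) : ℝ :=
  (4 / u (Uinv (P.map (X 0)) h p) ^ 2) *
    ∑' r : ℤ, covShift P X (fun x => h1 (P.map (X 0)) h x (Uinv (P.map (X 0)) h p)) r

end UQuantile

namespace UQuantile

/-- The algebra of finite unions of measurable rectangles, coded by finite-valued maps. -/
def rectAlg (E E' : Type*) [MeasurableSpace E] [MeasurableSpace E'] : Set (Set (E × E')) :=
  {C | ∃ (m m' : ℕ) (a : E → Fin m) (b : E' → Fin m') (J : Set (Fin m × Fin m')),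
    Measurable a ∧ Measurable b ∧ C = {e | (a e.1, b e.2) ∈ J}}

lemma rectAlg_isSetAlgebra (E E' : Type*) [MeasurableSpace E] [MeasurableSpace E'] :
    IsSetAlgebra (rectAlg E E') where
  empty_mem := ⟨1, 1, fun _ => 0, fun _ => 0, ∅, measurable_const, measurable_const, by simp⟩
  compl_mem := by
    rintro s ⟨m, m', a, b, J, ha, hb, rfl⟩
    exact ⟨m, m', a, b, Jᶜ, ha, hb, rfl⟩
  union_mem := by
    rintro s t ⟨m, m', a, b, J, ha, hb, rfl⟩ ⟨k, k', c, d, K, hc, hd, rfl⟩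
    refine ⟨m * k, m' * k', fun e => finProdFinEquiv (a e, c e), fun e => finProdFinEquiv (b e, d e),
      {x | ((finProdFinEquiv.symm x.1).1, (finProdFinEquiv.symm x.2).1) ∈ J ∨
        ((finProdFinEquiv.symm x.1).2, (finProdFinEquiv.symm x.2).2) ∈ K}, ?_, ?_, ?_⟩
    · exact (measurable_of_countable _).comp (ha.prodMk hc)
    · exact (measurable_of_countable _).comp (hb.prodMk hd)
    · ext e; simp [-finProdFinEquiv_symm_apply]

lemma rectAlg_generateFrom (E E' : Type*) [MeasurableSpace E] [MeasurableSpace E'] :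
    (inferInstance : MeasurableSpace (E × E')) = MeasurableSpace.generateFrom (rectAlg E E') := by
  apply le_antisymm
  · rw [← generateFrom_prod]
    apply MeasurableSpace.generateFrom_mono
    rintro _ ⟨A, hA, B, hB, rfl⟩
    classical
    refine ⟨2, 2, fun e => if e ∈ A then 1 else 0, fun e => if e ∈ B then 1 else 0, {(1, 1)},
      Measurable.ite hA measurable_const measurable_const,
      Measurable.ite hB measurable_const measurable_const, ?_⟩
    ext e
    by_cases h1 : e.1 ∈ A <;> by_cases h2 : e.2 ∈ B <;> simp [h1, h2]
  · apply MeasurableSpace.generateFrom_le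
    rintro _ ⟨m, m', a, b, J, ha, hb, rfl⟩
    have : Measurable fun e : E × E' => (a e.1, b e.2) := by fun_prop
    exact this (Set.to_countable J).measurableSet

lemma beta_set {Ω : Type*} [MeasurableSpace Ω] (P : Measure Ω) [IsProbabilityMeasure P]
    (Z : ℤ → Ω → ℝ) (hZ : ∀ i, Measurable (Z i)) (β : ℕ → ℝ) (hβ : IsBetaBound P Z β) (k : ℕ)
    {E E' : Type*} [MeasurableSpace E] [MeasurableSpace E'] (U : Ω → E) (V : Ω → E')
    (hU : Measurable[pastSigma Z] U) (hV : Measurable[futureSigma Z k] V)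
    (C : Set (E × E')) (hC : MeasurableSet C) :
    |(P.map (fun ω => (U ω, V ω))).real C - ((P.map U).prod (P.map V)).real C| ≤ 2 * β k := by
  have hpast : pastSigma Z ≤ (inferInstance : MeasurableSpace Ω) :=
    iSup_le fun i => (hZ i).comap_le
  have hfut : futureSigma Z k ≤ (inferInstance : MeasurableSpace Ω) :=
    iSup_le fun i => (hZ i).comap_le
  have hU' : Measurable U := hU.mono hpast le_rfl
  have hV' : Measurable V := hV.mono hfut le_rfl
  have hUV : Measurable fun ω => (U ω, V ω) := hU'.prodMk hV'
  have : IsProbabilityMeasure (P.map U) := Measure.isProbabilityMeasure_map hU'.aemeasurable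
  have : IsProbabilityMeasure (P.map V) := Measure.isProbabilityMeasure_map hV'.aemeasurable
  have : IsProbabilityMeasure (P.map fun ω => (U ω, V ω)) :=
    Measure.isProbabilityMeasure_map hUV.aemeasurable
  set ρ := P.map (fun ω => (U ω, V ω)) with hρ
  set ρ' := (P.map U).prod (P.map V) with hρ'
  -- the algebra case
  have key : ∀ D ∈ rectAlg E E', |ρ.real D - ρ'.real D| ≤ 2 * β k := by
    rintro _ ⟨m, m', a, b, J, ha, hb, rfl⟩
    classical
    have hA := hβ k m m' (fun i => U ⁻¹' (a ⁻¹' {i})) (fun j => V ⁻¹' (b ⁻¹' {j}))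
      (fun i => hU (ha (measurableSet_singleton i))) (fun j => hV (hb (measurableSet_singleton j)))
      (by
        intro i j hij
        simp only [Function.onFun]
        exact Disjoint.preimage _ (Disjoint.preimage _ (by simpa using hij)))
      (by
        intro i j hij
        simp only [Function.onFun]
        exact Disjoint.preimage _ (Disjoint.preimage _ (by simpa using hij)))
      (by ext ω; simp) (by ext ω; simp)
    have hab : Measurable fun e : E × E' => (a e.1, b e.2) := by fun_prop
    have hset : ∀ ν : Measure (E × E'), IsProbabilityMeasure ν →
        ν.real {e | (a e.1, b e.2) ∈ J} =
          ∑ x ∈ J.toFinset, ν.real {e | (a e.1, b e.2) = x} := by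
      intro ν hν
      have h1 : {e : E × E' | (a e.1, b e.2) ∈ J} =
          ⋃ x ∈ J.toFinset, {e | (a e.1, b e.2) = x} := by
        ext e; simp
      rw [h1, measureReal_biUnion_finset]
      · intro x _ y _ hxy
        rw [Function.onFun, Set.disjoint_left]
        intro e h1 h2
        exact hxy (h1.symm.trans h2)
      · intro x _
        exact hab (measurableSet_singleton x)
    rw [hset ρ inferInstance, hset ρ' inferInstance, ← Finset.sum_sub_distrib]
    have h2 : ∀ x : Fin m × Fin m', ρ.real {e | (a e.1, b e.2) = x} =
        (P (U ⁻¹' (a ⁻¹' {x.1}) ∩ V ⁻¹' (b ⁻¹' {x.2}))).toReal := by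
      intro x
      have hm : MeasurableSet {e : E × E' | (a e.1, b e.2) = x} := hab (measurableSet_singleton x)
      rw [measureReal_def, hρ, Measure.map_apply hUV hm]
      congr 2
      ext ω; simp [Prod.ext_iff]
    have h3 : ∀ x : Fin m × Fin m', ρ'.real {e | (a e.1, b e.2) = x} =
        (P (U ⁻¹' (a ⁻¹' {x.1}))).toReal * (P (V ⁻¹' (b ⁻¹' {x.2}))).toReal := by
      intro x
      have : {e : E × E' | (a e.1, b e.2) = x} = (a ⁻¹' {x.1}) ×ˢ (b ⁻¹' {x.2}) := by
        ext e; simp [Prod.ext_iff]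
      rw [measureReal_def, this, hρ', Measure.prod_prod, ENNReal.toReal_mul,
        Measure.map_apply hU' (ha (measurableSet_singleton _)),
        Measure.map_apply hV' (hb (measurableSet_singleton _))]
    calc |∑ x ∈ J.toFinset, (ρ.real {e | (a e.1, b e.2) = x} - ρ'.real {e | (a e.1, b e.2) = x})|
        ≤ ∑ x ∈ J.toFinset, |ρ.real {e | (a e.1, b e.2) = x} - ρ'.real {e | (a e.1, b e.2) = x}| :=
          Finset.abs_sum_le_sum_abs _ _
      _ ≤ ∑ x : Fin m × Fin m',
            |ρ.real {e | (a e.1, b e.2) = x} - ρ'.real {e | (a e.1, b e.2) = x}| :=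
          Finset.sum_le_sum_of_subset_of_nonneg (Finset.subset_univ _) (fun _ _ _ => abs_nonneg _)
      _ ≤ 2 * β k := by
          rw [Fintype.sum_prod_type]
          simp only [h2, h3]
          linarith
  -- approximation
  have hd := Measure.MeasureDense.of_generateFrom_isSetAlgebra_finite (ρ + ρ')
    (rectAlg_isSetAlgebra E E') (rectAlg_generateFrom E E')
  refine le_of_forall_pos_le_add fun ε hε => ?_
  obtain ⟨D, hD, hDε⟩ := hd.approx C hC (measure_ne_top _ _) (ε / 2) (by positivity)
  have hDm : MeasurableSet D := hd.measurable D hD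
  have hsum : (ρ + ρ') (symmDiff C D) < ENNReal.ofReal (ε / 2) := hDε
  rw [Measure.add_apply] at hsum
  have b1 : |ρ.real C - ρ.real D| ≤ ε / 2 := by
    refine (abs_measureReal_sub_le_measureReal_symmDiff' hC.nullMeasurableSet hDm.nullMeasurableSet (by simp) (by simp)).trans ?_
    rw [measureReal_def]
    exact ENNReal.toReal_le_of_le_ofReal (by positivity) (le_self_add.trans hsum.le)
  have b2 : |ρ'.real C - ρ'.real D| ≤ ε / 2 := by
    refine (abs_measureReal_sub_le_measureReal_symmDiff' hC.nullMeasurableSet hDm.nullMeasurableSet (by simp) (by simp)).trans ?_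
    rw [measureReal_def]
    exact ENNReal.toReal_le_of_le_ofReal (by positivity) (le_add_self.trans hsum.le)
  have b3 := key D hD
  rw [abs_le] at *
  constructor <;> linarith [b1.1, b1.2, b2.1, b2.2, b3.1, b3.2]

/-- Total variation bound for integrals of bounded functions. -/
lemma tv_integral {S : Type*} [MeasurableSpace S] (ρ ρ' : Measure S) [IsProbabilityMeasure ρ]
    [IsProbabilityMeasure ρ'] (b : ℝ)
    (hb : ∀ C, MeasurableSet C → |ρ.real C - ρ'.real C| ≤ b) (Φ : S → ℝ) (hΦ : Measurable Φ)
    (M : ℝ) (hM : ∀ s, |Φ s| ≤ M) : |∫ s, Φ s ∂ρ - ∫ s, Φ s ∂ρ'| ≤ 2 * M * b := by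
  have hne : Nonempty S := by
    by_contra hne
    rw [not_nonempty_iff] at hne
    have := measure_univ (μ := ρ)
    simp [Set.univ_eq_empty_iff.2 hne] at this
  have hM0 : 0 ≤ M := (abs_nonneg _).trans (hM hne.some)
  have hi : ∀ ν : Measure S, IsProbabilityMeasure ν → Integrable (fun s => Φ s + M) ν := by
    intro ν hν
    refine Integrable.of_bound (C := 2 * M) (by fun_prop) (ae_of_all _ fun s => ?_)
    have := abs_le.1 (hM s)
    rw [Real.norm_eq_abs, abs_le]; constructor <;> linarith
  have hi' : ∀ ν : Measure S, IsProbabilityMeasure ν → Integrable Φ ν := by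
    intro ν hν
    exact Integrable.of_bound (C := M) (by fun_prop) (ae_of_all _ hM)
  have heq : ∀ ν : Measure S, IsProbabilityMeasure ν →
      ∫ s, Φ s ∂ν = (∫ t in Ioc 0 (2 * M), ν.real {a | t ≤ Φ a + M}) - M := by
    intro ν hν
    rw [← (hi ν hν).integral_eq_integral_Ioc_meas_le (ae_of_all _ fun s => ?_)
      (ae_of_all _ fun s => ?_), integral_add (hi' ν hν) (integrable_const _)]
    · simp
    · have := abs_le.1 (hM s)
      simp only [Pi.zero_apply]; linarith
    · have := abs_le.1 (hM s)
      simp only; linarith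
  have hmeas : ∀ ν : Measure S, IsProbabilityMeasure ν →
      IntegrableOn (fun t => ν.real {a | t ≤ Φ a + M}) (Ioc 0 (2 * M)) := by
    intro ν hν
    have hanti : Antitone fun t => ν.real {a | t ≤ Φ a + M} := by
      intro s t hst
      exact measureReal_mono (fun a ha => le_trans hst ha)
    refine Measure.integrableOn_of_bounded (M := 1) measure_Ioc_lt_top.ne hanti.measurable.aestronglyMeasurable
      (ae_of_all _ fun t => ?_)
    rw [Real.norm_eq_abs, abs_of_nonneg measureReal_nonneg]
    exact measureReal_le_one
  rw [heq ρ inferInstance, heq ρ' inferInstance, sub_sub_sub_cancel_right,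
    ← integral_sub (hmeas ρ inferInstance) (hmeas ρ' inferInstance)]
  have := norm_setIntegral_le_of_norm_le_const (μ := volume) (s := Ioc 0 (2 * M)) (C := b)
    (f := fun t => ρ.real {a | t ≤ Φ a + M} - ρ'.real {a | t ≤ Φ a + M}) measure_Ioc_lt_top
    (fun t _ => hb _ (measurableSet_le measurable_const (by fun_prop)))
  rw [Real.norm_eq_abs] at this
  refine this.trans ?_
  rw [measureReal_def, Real.volume_Ioc, ENNReal.toReal_ofReal (by linarith)]
  linarith

end UQuantile


namespace UQuantile

/-- The σ-field generated by `Z_i`, `i ≤ s`. -/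
@[reducible] def pastS {Ω : Type*} (Z : ℤ → Ω → ℝ) (s : ℤ) : MeasurableSpace Ω :=
  MeasurableSpace.comap (fun ω (i : {i : ℤ // i ≤ s}) => Z i ω) MeasurableSpace.pi

/-- The σ-field generated by `Z_i`, `s ≤ i`. -/
@[reducible] def futS {Ω : Type*} (Z : ℤ → Ω → ℝ) (s : ℤ) : MeasurableSpace Ω :=
  MeasurableSpace.comap (fun ω (i : {i : ℤ // s ≤ i}) => Z i ω) MeasurableSpace.pi

lemma measurable_pastS {Ω : Type*} (Z : ℤ → Ω → ℝ) (s i : ℤ) (h : i ≤ s) :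
    Measurable[pastS Z s] (Z i) := by
  have h1 : Measurable[pastS Z s] (fun ω (i : {i : ℤ // i ≤ s}) => Z i ω) :=
    comap_measurable _
  exact (measurable_pi_apply (⟨i, h⟩ : {i : ℤ // i ≤ s})).comp h1

lemma measurable_futS {Ω : Type*} (Z : ℤ → Ω → ℝ) (s i : ℤ) (h : s ≤ i) :
    Measurable[futS Z s] (Z i) := by
  have h1 : Measurable[futS Z s] (fun ω (i : {i : ℤ // s ≤ i}) => Z i ω) :=
    comap_measurable _
  exact (measurable_pi_apply (⟨i, h⟩ : {i : ℤ // s ≤ i})).comp h1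

lemma proc_shift {Ω : Type*} [MeasurableSpace Ω] (P : Measure Ω) [IsProbabilityMeasure P]
    (X Z : ℤ → Ω → ℝ) (hX : ∀ i, Measurable (X i)) (hZ : ∀ i, Measurable (Z i))
    (hst : IsPairStationary P X Z) (k : ℤ) :
    P.map (fun ω (i : ℤ) => (X i ω, Z i ω)) =
      P.map (fun ω (i : ℤ) => (X (i + k) ω, Z (i + k) ω)) := by
  have m1 : Measurable (fun ω (i : ℤ) => (X i ω, Z i ω)) :=
    measurable_pi_lambda _ fun i => (hX i).prodMk (hZ i)
  have m2 : Measurable (fun ω (i : ℤ) => (X (i + k) ω, Z (i + k) ω)) :=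
    measurable_pi_lambda _ fun i => (hX _).prodMk (hZ _)
  refine (ProbabilityTheory.map_eq_iff_forall_finset_map_restrict_eq
    (X := fun (i : ℤ) ω => (X i ω, Z i ω)) (Y := fun (i : ℤ) ω => (X (i + k) ω, Z (i + k) ω))
    m1.aemeasurable m2.aemeasurable).2 fun I => ?_
  have h := hst k I.card (fun j => (I.equivFin.symm j : ℤ))
  let e : (Fin I.card → ℝ × ℝ) → (I → ℝ × ℝ) := fun v i => v (I.equivFin i)
  have he : Measurable e := measurable_pi_lambda _ fun i => measurable_pi_apply _
  have h' := congrArg (Measure.map e) h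
  rw [Measure.map_map he (measurable_pi_lambda _ fun i => (hX _).prodMk (hZ _)),
    Measure.map_map he (measurable_pi_lambda _ fun i => (hX _).prodMk (hZ _))] at h'
  convert h' using 2 <;>
  · ext ω i <;> simp [e]

/-- Expectations of functionals of the process are shift invariant. -/
lemma map_shift {Ω : Type*} [MeasurableSpace Ω] (P : Measure Ω) [IsProbabilityMeasure P]
    (X Z : ℤ → Ω → ℝ) (hX : ∀ i, Measurable (X i)) (hZ : ∀ i, Measurable (Z i))
    (hst : IsPairStationary P X Z) (k : ℤ) {E : Type*} [MeasurableSpace E]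
    (F : (ℤ → ℝ × ℝ) → E) (hF : Measurable F) :
    P.map (fun ω => F (fun i => (X i ω, Z i ω))) =
      P.map (fun ω => F (fun i => (X (i + k) ω, Z (i + k) ω))) := by
  have m1 : Measurable (fun ω (i : ℤ) => (X i ω, Z i ω)) :=
    measurable_pi_lambda _ fun i => (hX i).prodMk (hZ i)
  have m2 : Measurable (fun ω (i : ℤ) => (X (i + k) ω, Z (i + k) ω)) :=
    measurable_pi_lambda _ fun i => (hX _).prodMk (hZ _)
  have := congrArg (Measure.map F) (proc_shift P X Z hX hZ hst k)
  rwa [Measure.map_map hF m1, Measure.map_map hF m2] at this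

lemma pastS_le {Ω : Type*} [MeasurableSpace Ω] (Z : ℤ → Ω → ℝ) (hZ : ∀ i, Measurable (Z i)) (s : ℤ) :
    pastS Z s ≤ (inferInstance : MeasurableSpace Ω) :=
  (measurable_pi_lambda _ fun _ => hZ _).comap_le

lemma futS_le {Ω : Type*} [MeasurableSpace Ω] (Z : ℤ → Ω → ℝ) (hZ : ∀ i, Measurable (Z i)) (s : ℤ) :
    futS Z s ≤ (inferInstance : MeasurableSpace Ω) :=
  (measurable_pi_lambda _ fun _ => hZ _).comap_le

lemma mix_set {Ω : Type*} [MeasurableSpace Ω] (P : Measure Ω) [IsProbabilityMeasure P]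
    (X Z : ℤ → Ω → ℝ) (hX : ∀ i, Measurable (X i)) (hZ : ∀ i, Measurable (Z i))
    (hst : IsPairStationary P X Z) (β : ℕ → ℝ) (hβ : IsBetaBound P Z β)
    (s : ℤ) (k : ℕ) {E E' : Type*} [MeasurableSpace E] [MeasurableSpace E']
    (U : Ω → E) (V : Ω → E')
    (hU : Measurable[pastS Z s] U) (hV : Measurable[futS Z (s + k)] V)
    (C : Set (E × E')) (hC : MeasurableSet C) :
    |(P.map (fun ω => (U ω, V ω))).real C - ((P.map U).prod (P.map V)).real C| ≤ 2 * β k := by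
  have hU' : Measurable U := hU.mono (pastS_le Z hZ s) le_rfl
  have hV' : Measurable V := hV.mono (futS_le Z hZ _) le_rfl
  have : IsProbabilityMeasure (P.map U) := Measure.isProbabilityMeasure_map hU'.aemeasurable
  have : IsProbabilityMeasure (P.map V) := Measure.isProbabilityMeasure_map hV'.aemeasurable
  -- canonical past and future
  let A0 : Ω → ({i : ℤ // i ≤ s} → ℝ) := fun ω i => Z i ω
  let B0 : Ω → ({i : ℤ // s + k ≤ i} → ℝ) := fun ω i => Z i ω
  let A : Ω → ({i : ℤ // i ≤ s} → ℝ) := fun ω i => Z (i + (-s)) ω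
  let B : Ω → ({i : ℤ // s + k ≤ i} → ℝ) := fun ω i => Z (i + (-s)) ω
  have mA0 : Measurable A0 := measurable_pi_lambda _ fun i => hZ _
  have mB0 : Measurable B0 := measurable_pi_lambda _ fun i => hZ _
  have hA : Measurable[pastSigma Z] A := by
    refine @measurable_pi_lambda _ _ _ (pastSigma Z) _ _ fun i => ?_
    have : Measurable[MeasurableSpace.comap (Z (i + (-s))) Real.measurableSpace] (Z (i + (-s))) :=
      comap_measurable _
    exact this.mono (le_iSup (fun i : {i : ℤ // i ≤ 0} =>
      MeasurableSpace.comap (Z i) Real.measurableSpace) ⟨i + (-s), by linarith [i.2]⟩) le_rfl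
  have hB : Measurable[futureSigma Z k] B := by
    refine @measurable_pi_lambda _ _ _ (futureSigma Z k) _ _ fun i => ?_
    have : Measurable[MeasurableSpace.comap (Z (i + (-s))) Real.measurableSpace] (Z (i + (-s))) :=
      comap_measurable _
    exact this.mono (le_iSup (fun i : {i : ℤ // (k : ℤ) ≤ i} =>
      MeasurableSpace.comap (Z i) Real.measurableSpace) ⟨i + (-s), by linarith [i.2]⟩) le_rfl
  have e1 : P.map (fun ω => (A0 ω, B0 ω)) = P.map (fun ω => (A ω, B ω)) :=
    map_shift P X Z hX hZ hst (-s)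
      (fun z => ((fun i : {i : ℤ // i ≤ s} => (z i).2), (fun i : {i : ℤ // s + k ≤ i} => (z i).2)))
      (by fun_prop)
  have e2 : P.map A0 = P.map A :=
    map_shift P X Z hX hZ hst (-s) (fun z => (fun i : {i : ℤ // i ≤ s} => (z i).2)) (by fun_prop)
  have e3 : P.map B0 = P.map B :=
    map_shift P X Z hX hZ hst (-s) (fun z => (fun i : {i : ℤ // s + k ≤ i} => (z i).2))
      (by fun_prop)
  have hW : Measurable[(pastS Z s).prod (futS Z (s + k))] (fun w : Ω × Ω => (U w.1, V w.2)) := by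
    let m1 : MeasurableSpace (Ω × Ω) := (pastS Z s).prod (futS Z (s + k))
    refine Measurable.prodMk ?_ ?_
    · exact Measurable.comp hU (@measurable_fst Ω Ω (pastS Z s) (futS Z (s + k)))
    · exact Measurable.comp hV (@measurable_snd Ω Ω (pastS Z s) (futS Z (s + k)))
  have hCm := hW hC
  have hprod : (pastS Z s).prod (futS Z (s + k)) =
      MeasurableSpace.comap (Prod.map A0 B0) inferInstance := by
    rw [MeasurableSpace.prod]
    simp only [pastS, futS, MeasurableSpace.comap_comp]
    rw [show (inferInstance : MeasurableSpace (({i : ℤ // i ≤ s} → ℝ) × ({i : ℤ // s + k ≤ i} → ℝ)))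
      = MeasurableSpace.comap Prod.fst MeasurableSpace.pi ⊔
        MeasurableSpace.comap Prod.snd MeasurableSpace.pi from rfl,
      MeasurableSpace.comap_sup, MeasurableSpace.comap_comp, MeasurableSpace.comap_comp]
    rfl
  rw [hprod] at hCm
  obtain ⟨D, hD, hDC⟩ := hCm
  have key := beta_set P Z hZ β hβ k A B hA hB D hD
  rw [← e1, ← e2, ← e3] at key
  have r1 : (P.map (fun ω => (U ω, V ω))).real C = (P.map (fun ω => (A0 ω, B0 ω))).real D := by
    rw [measureReal_def, measureReal_def, Measure.map_apply (hU'.prodMk hV') hC,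
      Measure.map_apply (mA0.prodMk mB0) hD]
    congr 2
    ext ω
    have := Set.ext_iff.1 hDC (ω, ω)
    simpa using this.symm
  have r2 : ((P.map U).prod (P.map V)).real C = ((P.map A0).prod (P.map B0)).real D := by
    rw [Measure.map_prod_map P P hU' hV', Measure.map_prod_map P P mA0 mB0,
      measureReal_def, measureReal_def, Measure.map_apply (hU'.prodMap hV') hC,
      Measure.map_apply (mA0.prodMap mB0) hD, hDC]
    rfl
  rw [r1, r2]
  exact key

lemma mix_real {Ω : Type*} [MeasurableSpace Ω] (P : Measure Ω) [IsProbabilityMeasure P]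
    (X Z : ℤ → Ω → ℝ) (hX : ∀ i, Measurable (X i)) (hZ : ∀ i, Measurable (Z i))
    (hst : IsPairStationary P X Z) (β : ℕ → ℝ) (hβ : IsBetaBound P Z β)
    (s : ℤ) (k : ℕ) {E E' : Type*} [MeasurableSpace E] [MeasurableSpace E']
    (U : Ω → E) (V : Ω → E')
    (hU : Measurable[pastS Z s] U) (hV : Measurable[futS Z (s + k)] V)
    (Φ : E × E' → ℝ) (hΦ : Measurable Φ) (M : ℝ) (hM : ∀ e, |Φ e| ≤ M) :
    |∫ ω, Φ (U ω, V ω) ∂P - ∫ w, Φ (U w.1, V w.2) ∂(P.prod P)| ≤ 4 * M * β k := by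
  have hU' : Measurable U := hU.mono (pastS_le Z hZ s) le_rfl
  have hV' : Measurable V := hV.mono (futS_le Z hZ _) le_rfl
  have : IsProbabilityMeasure (P.map U) := Measure.isProbabilityMeasure_map hU'.aemeasurable
  have : IsProbabilityMeasure (P.map V) := Measure.isProbabilityMeasure_map hV'.aemeasurable
  have : IsProbabilityMeasure (P.map fun ω => (U ω, V ω)) :=
    Measure.isProbabilityMeasure_map (hU'.prodMk hV').aemeasurable
  have h := tv_integral (P.map (fun ω => (U ω, V ω))) ((P.map U).prod (P.map V)) (2 * β k)
    (mix_set P X Z hX hZ hst β hβ s k U V hU hV) Φ hΦ M hM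
  rw [integral_map (hU'.prodMk hV').aemeasurable hΦ.aestronglyMeasurable,
    Measure.map_prod_map P P hU' hV',
    integral_map (hU'.prodMap hV').aemeasurable hΦ.aestronglyMeasurable] at h
  simp only [Prod.map] at h
  linarith

lemma mix_cov_real {Ω : Type*} [MeasurableSpace Ω] (P : Measure Ω) [IsProbabilityMeasure P]
    (X Z : ℤ → Ω → ℝ) (hX : ∀ i, Measurable (X i)) (hZ : ∀ i, Measurable (Z i))
    (hst : IsPairStationary P X Z) (β : ℕ → ℝ) (hβ : IsBetaBound P Z β)
    (s : ℤ) (k : ℕ) (A B : Ω → ℝ) (hA : Measurable[pastS Z s] A)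
    (hB : Measurable[futS Z (s + k)] B) (K M : ℝ) (hAK : ∀ ω, |A ω| ≤ K) (hBM : ∀ ω, |B ω| ≤ M)
    (hK : 0 ≤ K) :
    |∫ ω, A ω * B ω ∂P - (∫ ω, A ω ∂P) * ∫ ω, B ω ∂P| ≤ 4 * (K * M) * β k := by
  -- truncate the product to make it globally bounded
  have hM : 0 ≤ M := by
    have : Nonempty Ω := by
      by_contra hne
      rw [not_nonempty_iff] at hne
      have := measure_univ (μ := P)
      simp [Set.univ_eq_empty_iff.2 hne] at this
    exact (abs_nonneg _).trans (hBM this.some)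
  let c : ℝ → ℝ → ℝ := fun R x => max (-R) (min R x)
  have hc : ∀ R x, |x| ≤ R → c R x = x := by
    intro R x h
    simp only [c]
    rw [min_eq_right (abs_le.1 h).2, max_eq_right (abs_le.1 h).1]
  have hcb : ∀ R x, 0 ≤ R → |c R x| ≤ R := by
    intro R x h
    simp only [c, abs_le]
    exact ⟨le_max_left _ _, max_le (by linarith) (min_le_left _ _)⟩
  have h := mix_real P X Z hX hZ hst β hβ s k A B hA hB (fun e => c K e.1 * c M e.2)
    (by fun_prop) (K * M) (fun e => by
      rw [abs_mul]
      exact mul_le_mul (hcb _ _ hK) (hcb _ _ hM) (abs_nonneg _) hK)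
  simp only [hc K _ (hAK _), hc M _ (hBM _)] at h
  rwa [integral_prod_mul] at h

end UQuantile


namespace UQuantile

/-- All the data used in the proof, at the fixed level `t = U⁻¹(p)`. -/
structure Setup {Ω : Type*} [MeasurableSpace Ω] (P : Measure Ω) where
  X : ℤ → Ω → ℝ
  Z : ℤ → Ω → ℝ
  hX : ∀ i, Measurable (X i)
  hZ : ∀ i, Measurable (Z i)
  hst : IsPairStationary P X Z
  β : ℕ → ℝ
  β0 : ∀ k, 0 ≤ β k
  hβ : IsBetaBound P Z β
  f : (l : ℕ) → ((Fin (2 * l + 1) → ℝ) → ℝ)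
  hf : ∀ l, Measurable (f l)
  Ca : ℝ
  Ca0 : 0 ≤ Ca
  approx : ∀ l : ℕ, 1 ≤ l →
    P.real {ω | ((l : ℝ)⁻¹) ^ 6 < |X 0 ω - f l fun i => Z (((i : ℕ) : ℤ) - (l : ℤ)) ω|}
      ≤ Ca * ((l : ℝ)⁻¹) ^ 6
  H : ℝ → ℝ → ℝ
  M : ℝ
  M1 : 1 ≤ M
  H0 : ∀ x y, 0 ≤ H x y
  HM : ∀ x y, H x y ≤ M
  Hm : Measurable fun q : ℝ × ℝ => H q.1 q.2
  Hs : ∀ x y, H x y = H y x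
  L : ℝ
  L0 : 0 ≤ L
  var : ∀ ε > (0 : ℝ),
    ∫⁻ q : ℝ × ℝ, ENNReal.ofReal
        ((⨆ r ∈ Metric.closedBall q ε, |H r.1 r.2 - H q.1 q.2|) ^ 2)
          ∂((P.map (X 0)).prod (P.map (X 0)))
      ≤ ENNReal.ofReal (L * ε)

lemma intb {S : Type*} [MeasurableSpace S] {ν : Measure S} [IsFiniteMeasure ν] {g : S → ℝ}
    (hg : Measurable g) (C : ℝ) (hC : ∀ s, |g s| ≤ C) : Integrable g ν :=
  Integrable.of_bound (C := C) hg.aestronglyMeasurable (ae_of_all _ hC)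

lemma transfer {E E' : Type*} [MeasurableSpace E] [MeasurableSpace E'] [StandardBorelSpace E']
    [Nonempty E'] (π : Measure (E × E')) [IsFiniteMeasure π] (F : E × E' → ℝ≥0∞)
    (hF : Measurable F) (φ : E → ℝ≥0∞) (hφ : ∀ e e', F (e, e') ≤ φ e) :
    ∫⁻ x, F x ∂π ≤ ∫⁻ e, φ e ∂π.fst := by
  rw [← Measure.lintegral_condKernel hF]
  refine lintegral_mono fun e => ?_
  calc ∫⁻ ω, F (e, ω) ∂π.condKernel e ≤ ∫⁻ _, φ e ∂π.condKernel e := lintegral_mono (hφ e)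
    _ = φ e := by simp

namespace Setup
variable {Ω : Type*} [MeasurableSpace Ω] {P : Measure Ω} (S : Setup P)

/-- marginal law -/
def μ : Measure ℝ := P.map (S.X 0)

/-- oscillation of the kernel -/
def osc (ε : ℝ) (q : ℝ × ℝ) : ℝ := ⨆ r ∈ Metric.closedBall q ε, |S.H r.1 r.2 - S.H q.1 q.2|

/-- window approximation -/
def Y (l : ℕ) (i : ℤ) (ω : Ω) : ℝ := S.f l fun a => S.Z (((a : ℕ) : ℤ) - (l : ℤ) + i) ω

/-- approximation rate -/
def e (_ : Setup P) (l : ℕ) : ℝ := ((l : ℝ)⁻¹) ^ 3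

lemma e_pos (l : ℕ) (hl : 1 ≤ l) : 0 < S.e l := by
  unfold e; have : (0 : ℝ) < l := by exact_mod_cast hl
  positivity

lemma e_le_one (l : ℕ) (hl : 1 ≤ l) : S.e l ≤ 1 := by
  unfold e
  have : (1 : ℝ) ≤ l := by exact_mod_cast hl
  exact pow_le_one₀ (by positivity) (inv_le_one_of_one_le₀ this)

lemma e_sq (l : ℕ) : ((l : ℝ)⁻¹) ^ 6 = S.e l ^ 2 := by
  unfold e; ring

lemma M0 : 0 ≤ S.M := by linarith [S.M1]

lemma absH (x y x' y' : ℝ) : |S.H x y - S.H x' y'| ≤ S.M := by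
  rw [abs_le]; constructor <;> linarith [S.H0 x y, S.HM x y, S.H0 x' y', S.HM x' y']

lemma osc_bdd (ε : ℝ) (q : ℝ × ℝ) :
    BddAbove (range fun r : ℝ × ℝ => ⨆ (_ : r ∈ Metric.closedBall q ε), |S.H r.1 r.2 - S.H q.1 q.2|) := by
  refine ⟨S.M, ?_⟩
  rintro _ ⟨r, rfl⟩
  exact Real.iSup_le (fun _ => S.absH _ _ _ _) S.M0

lemma le_osc (ε : ℝ) (q r : ℝ × ℝ) (h : dist r q ≤ ε) : |S.H r.1 r.2 - S.H q.1 q.2| ≤ S.osc ε q := by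
  refine le_ciSup_of_le (S.osc_bdd ε q) r ?_
  rw [ciSup_pos (Metric.mem_closedBall.2 h)]

lemma osc_nonneg (ε : ℝ) (q : ℝ × ℝ) : 0 ≤ S.osc ε q :=
  Real.iSup_nonneg fun _ => Real.iSup_nonneg fun _ => abs_nonneg _

lemma osc_le (ε : ℝ) (q t : ℝ × ℝ) (hε : 0 < ε) (h : dist t q ≤ ε) :
    S.osc ε t ≤ 2 * S.osc (2 * ε) q := by
  have h0 := S.osc_nonneg (2 * ε) q
  refine Real.iSup_le (fun r => Real.iSup_le (fun hr => ?_) (by linarith)) (by linarith)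
  have hr' : dist r t ≤ ε := Metric.mem_closedBall.1 hr
  have h1 := S.le_osc (2 * ε) q r ((dist_triangle r t q).trans (by linarith))
  have h2 := S.le_osc (2 * ε) q t (by linarith)
  calc |S.H r.1 r.2 - S.H t.1 t.2|
      = |(S.H r.1 r.2 - S.H q.1 q.2) - (S.H t.1 t.2 - S.H q.1 q.2)| := by congr 1; ring
    _ ≤ |S.H r.1 r.2 - S.H q.1 q.2| + |S.H t.1 t.2 - S.H q.1 q.2| := abs_sub _ _
    _ ≤ _ := by linarith

variable [IsProbabilityMeasure P]

instance : IsProbabilityMeasure S.μ := Measure.isProbabilityMeasure_map (S.hX 0).aemeasurable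

lemma map_X (i : ℤ) : P.map (S.X i) = S.μ := by
  have := map_shift P S.X S.Z S.hX S.hZ S.hst i (fun z => (z 0).1) (by fun_prop)
  simp only [zero_add] at this
  exact this.symm

lemma mY (l : ℕ) (i : ℤ) : Measurable (S.Y l i) :=
  (S.hf l).comp (measurable_pi_lambda _ fun _ => S.hZ _)

lemma mY_past (l : ℕ) (i s : ℤ) (h : i + l ≤ s) : Measurable[pastS S.Z s] (S.Y l i) := by
  refine (S.hf l).comp (@measurable_pi_lambda _ _ _ (pastS S.Z s) _ _ fun a =>
    measurable_pastS S.Z s _ ?_)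
  have := a.2; omega

lemma mY_fut (l : ℕ) (i s : ℤ) (h : s ≤ i - l) : Measurable[futS S.Z s] (S.Y l i) := by
  refine (S.hf l).comp (@measurable_pi_lambda _ _ _ (futS S.Z s) _ _ fun a =>
    measurable_futS S.Z s _ ?_)
  have := a.2; omega

lemma approx_i (l : ℕ) (hl : 1 ≤ l) (i : ℤ) :
    P.real {ω | S.e l ^ 2 < |S.X i ω - S.Y l i ω|} ≤ S.Ca * S.e l ^ 2 := by
  have h := map_shift P S.X S.Z S.hX S.hZ S.hst i
    (fun z => |(z 0).1 - S.f l (fun a => (z (((a : ℕ) : ℤ) - (l : ℤ))).2)|)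
    (by have := S.hf l; fun_prop)
  have hm : MeasurableSet (Ioi (S.e l ^ 2)) := measurableSet_Ioi
  have h' := congrArg (fun ν => ν.real (Ioi (S.e l ^ 2))) h
  simp only [measureReal_def] at h'
  rw [Measure.map_apply, Measure.map_apply] at h'
  · have h2 := S.approx l hl
    rw [S.e_sq] at h2
    refine le_trans (le_of_eq ?_) h2
    simp only [measureReal_def]
    simp only [zero_add] at h'
    exact h'.symm
  · have := S.hX; have := S.hZ; have := S.hf l; fun_prop
  · exact hm
  · have := S.hX; have := S.hZ; have := S.hf l; fun_prop
  · exact hm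

/-- Master variation bound. -/
lemma var_master {Ω' : Type*} [MeasurableSpace Ω'] (P' : Measure Ω') [IsProbabilityMeasure P']
    (Q T : Ω' → ℝ × ℝ) (hQ : Measurable Q) (hT : Measurable T) (hlaw : P'.map Q = S.μ.prod S.μ)
    (ε ε' c a : ℝ) (hε' : 0 < ε') (hc : 0 ≤ c) (ha : 0 < a)
    (D : (ℝ × ℝ) × (ℝ × ℝ) → ℝ) (hD : Measurable D) (hD0 : ∀ x, 0 ≤ D x) (hDM : ∀ x, D x ≤ S.M)
    (hDo : ∀ q t, dist t q ≤ ε → D (q, t) ≤ c * S.osc ε' q) :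
    ∫ ω, D (Q ω, T ω) ∂P' ≤ c ^ 2 * S.L * ε' / a + a + S.M * P'.real {ω | ε < dist (T ω) (Q ω)} := by
  classical
  let D1 : (ℝ × ℝ) × (ℝ × ℝ) → ℝ := fun x => if dist x.2 x.1 ≤ ε then D x else 0
  have hs : MeasurableSet {x : (ℝ × ℝ) × (ℝ × ℝ) | dist x.2 x.1 ≤ ε} :=
    measurableSet_le (by fun_prop) measurable_const
  have hD1 : Measurable D1 := Measurable.ite hs hD measurable_const
  have hD10 : ∀ x, 0 ≤ D1 x := fun x => by simp only [D1]; split_ifs <;> simp [hD0]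
  have hD1M : ∀ x, |D1 x| ≤ S.M := fun x => by
    rw [abs_of_nonneg (hD10 x)]; simp only [D1]; split_ifs <;> simp [hDM, S.M0]
  have hQT : Measurable fun ω => (Q ω, T ω) := hQ.prodMk hT
  have hbad : MeasurableSet {ω | ε < dist (T ω) (Q ω)} :=
    measurableSet_lt measurable_const (by fun_prop)
  -- second moment of D1
  have : IsProbabilityMeasure (P'.map fun ω => (Q ω, T ω)) :=
    Measure.isProbabilityMeasure_map hQT.aemeasurable
  have h2 : ∫⁻ x, ENNReal.ofReal (D1 x ^ 2) ∂(P'.map fun ω => (Q ω, T ω)) ≤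
      ENNReal.ofReal (c ^ 2 * (S.L * ε')) := by
    refine (transfer _ (fun x => ENNReal.ofReal (D1 x ^ 2)) (by fun_prop)
      (fun q => ENNReal.ofReal (c ^ 2) * ENNReal.ofReal (S.osc ε' q ^ 2)) ?_).trans ?_
    · intro q t
      rw [← ENNReal.ofReal_mul (by positivity), ← mul_pow]
      refine ENNReal.ofReal_le_ofReal (pow_le_pow_left₀ (hD10 _) ?_ 2)
      simp only [D1]
      split_ifs with h
      · exact hDo q t h
      · exact mul_nonneg hc (S.osc_nonneg _ _)
    · rw [lintegral_const_mul' _ _ ENNReal.ofReal_ne_top, ENNReal.ofReal_mul (by positivity)]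
      gcongr
      rw [Measure.fst_map_prodMk hT, hlaw]
      exact S.var ε' hε'
  have h3 : ∫ ω, D1 (Q ω, T ω) ^ 2 ∂P' ≤ c ^ 2 * (S.L * ε') := by
    rw [integral_eq_lintegral_of_nonneg_ae (ae_of_all _ fun _ => sq_nonneg _)
      (by have := hD1.comp hQT; exact (this.pow_const 2).aestronglyMeasurable)]
    rw [lintegral_map (by fun_prop) hQT] at h2
    have hL := S.L0
    exact ENNReal.toReal_le_of_le_ofReal (by positivity) h2
  have hm1 : Measurable fun ω => D1 (Q ω, T ω) := hD1.comp hQT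
  have i1 : Integrable (fun ω => D1 (Q ω, T ω) ^ 2) P' :=
    intb (hm1.pow_const 2) (S.M ^ 2) fun ω => by
      rw [abs_pow]; exact pow_le_pow_left₀ (abs_nonneg _) (hD1M _) 2
  have i2 : Integrable ({ω | ε < dist (T ω) (Q ω)}.indicator (fun _ => S.M)) P' :=
    (integrable_const _).indicator hbad
  have h4 : ∀ ω, D (Q ω, T ω) ≤ D1 (Q ω, T ω) ^ 2 / a + a +
      {ω | ε < dist (T ω) (Q ω)}.indicator (fun _ => S.M) ω := by
    intro ω
    have hsq : D1 (Q ω, T ω) ≤ D1 (Q ω, T ω) ^ 2 / a + a := by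
      rw [div_add' _ _ _ ha.ne', le_div_iff₀ ha]
      nlinarith [sq_nonneg (D1 (Q ω, T ω) - a), hD10 (Q ω, T ω)]
    by_cases h : ε < dist (T ω) (Q ω)
    · have : {ω | ε < dist (T ω) (Q ω)}.indicator (fun _ => S.M) ω = S.M :=
        indicator_of_mem (s := {ω | ε < dist (T ω) (Q ω)}) h _
      rw [this]
      have : 0 ≤ D1 (Q ω, T ω) ^ 2 / a := by positivity
      linarith [hDM (Q ω, T ω)]
    · have : {ω | ε < dist (T ω) (Q ω)}.indicator (fun _ => S.M) ω = 0 :=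
        indicator_of_notMem (s := {ω | ε < dist (T ω) (Q ω)}) h _
      rw [this, add_zero]
      have : D1 (Q ω, T ω) = D (Q ω, T ω) := by simp only [D1]; rw [if_pos (not_lt.1 h)]
      rw [this] at hsq ⊢
      exact hsq
  have i3 : Integrable (fun ω => D1 (Q ω, T ω) ^ 2 / a + a) P' :=
    (i1.div_const a).add (integrable_const a)
  calc ∫ ω, D (Q ω, T ω) ∂P' ≤ ∫ ω, (D1 (Q ω, T ω) ^ 2 / a + a +
      {ω | ε < dist (T ω) (Q ω)}.indicator (fun _ => S.M) ω) ∂P' := by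
        refine integral_mono (intb (hD.comp hQT) S.M fun ω => ?_)
          (i3.add i2) h4
        rw [abs_of_nonneg (hD0 _)]; exact hDM _
    _ = (∫ ω, D1 (Q ω, T ω) ^ 2 ∂P') / a + a + S.M * P'.real {ω | ε < dist (T ω) (Q ω)} := by
        rw [integral_add i3 i2,
          integral_add (i1.div_const a) (integrable_const a), integral_div, integral_indicator hbad]
        simp [mul_comm]
    _ ≤ _ := by
        have : (∫ ω, D1 (Q ω, T ω) ^ 2 ∂P') / a ≤ c ^ 2 * S.L * ε' / a := by
          gcongr; linarith
        linarith

end Setup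
end UQuantile


namespace UQuantile
namespace Setup
variable {Ω : Type*} [MeasurableSpace Ω] {P : Measure Ω} (S : Setup P) [IsProbabilityMeasure P]

/-- constant in the approximation lemmas -/
def K : ℝ := 8 * S.L + 2 + 4 * S.M * S.Ca

lemma K0 : 0 ≤ S.K := by
  have := S.L0; have := S.M0; have := S.Ca0; unfold K; positivity

lemma tail_pair {Ω' : Type*} [MeasurableSpace Ω'] (P' : Measure Ω') [IsProbabilityMeasure P']
    (a b c d : Ω' → ℝ) (ε η : ℝ) (h1 : P'.real {ω | ε < |a ω - c ω|} ≤ η)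
    (h2 : P'.real {ω | ε < |b ω - d ω|} ≤ η) :
    P'.real {ω | ε < dist (c ω, d ω) (a ω, b ω)} ≤ 2 * η := by
  refine (measureReal_mono (?_ : _ ⊆ {ω | ε < |a ω - c ω|} ∪ {ω | ε < |b ω - d ω|})).trans
    ((measureReal_union_le _ _).trans (by linarith))
  intro ω hω
  simp only [mem_setOf_eq, Prod.dist_eq, Real.dist_eq, lt_max_iff, mem_union] at hω ⊢
  rwa [abs_sub_comm (a ω), abs_sub_comm (b ω)]

lemma static {Ω' : Type*} [MeasurableSpace Ω'] (P' : Measure Ω') [IsProbabilityMeasure P']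
    (l : ℕ) (hl : 1 ≤ l) (Q T : Ω' → ℝ × ℝ) (hQ : Measurable Q) (hT : Measurable T)
    (hlaw : P'.map Q = S.μ.prod S.μ)
    (htail : P'.real {ω | S.e l ^ 2 < dist (T ω) (Q ω)} ≤ 2 * (S.Ca * S.e l ^ 2)) :
    ∫ ω, |S.H (T ω).1 (T ω).2 - S.H (Q ω).1 (Q ω).2| ∂P' ≤ S.K * S.e l := by
  have he := S.e_pos l hl
  have he1 := S.e_le_one l hl
  have hHm := S.Hm
  have h := S.var_master P' Q T hQ hT hlaw (S.e l ^ 2) (S.e l ^ 2) 1 (S.e l) (by positivity)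
    (by norm_num) he (fun x => |S.H x.2.1 x.2.2 - S.H x.1.1 x.1.2|)
    (by
      have h1 : Measurable fun x : (ℝ × ℝ) × (ℝ × ℝ) => S.H x.2.1 x.2.2 := hHm.comp measurable_snd
      have h2 : Measurable fun x : (ℝ × ℝ) × (ℝ × ℝ) => S.H x.1.1 x.1.2 := hHm.comp measurable_fst
      exact (h1.sub h2).abs)
    (fun x => abs_nonneg _) (fun x => S.absH _ _ _ _)
    (fun q t hd => by rw [one_mul]; exact S.le_osc _ _ _ hd)
  refine h.trans ?_
  have h1 : 1 ^ 2 * S.L * S.e l ^ 2 / S.e l = S.L * S.e l := by field_simp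
  rw [h1]
  have h2 : S.M * P'.real {ω | S.e l ^ 2 < dist (T ω) (Q ω)} ≤ S.M * (2 * (S.Ca * S.e l ^ 2)) :=
    mul_le_mul_of_nonneg_left htail S.M0
  have h3 : S.M * S.Ca * S.e l ^ 2 ≤ S.M * S.Ca * S.e l := by
    refine mul_le_mul_of_nonneg_left ?_ (mul_nonneg S.M0 S.Ca0); nlinarith
  unfold K
  nlinarith [mul_nonneg S.L0 he.le, mul_nonneg (mul_nonneg S.M0 S.Ca0) he.le]

lemma law_prod (i j : ℤ) :
    (P.prod P).map (fun w => (S.X i w.1, S.X j w.2)) = S.μ.prod S.μ := by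
  have := Measure.map_prod_map P P (S.hX i) (S.hX j)
  rw [S.map_X, S.map_X] at this
  rw [this]; rfl

lemma tail_fst {Ω'' : Type*} [MeasurableSpace Ω''] (ν : Measure Ω'') [IsProbabilityMeasure ν]
    (l : ℕ) (hl : 1 ≤ l) (i : ℤ) :
    (P.prod ν).real {w | S.e l ^ 2 < |S.X i w.1 - S.Y l i w.1|} ≤ S.Ca * S.e l ^ 2 := by
  have hm : MeasurableSet {ω | S.e l ^ 2 < |S.X i ω - S.Y l i ω|} :=
    measurableSet_lt measurable_const (((S.hX i).sub (S.mY l i)).abs)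
  have := (measurePreserving_fst (μ := P) (ν := ν)).measureReal_preimage hm.nullMeasurableSet
  exact this.le.trans (S.approx_i l hl i)

lemma tail_snd (l : ℕ) (hl : 1 ≤ l) (i : ℤ) :
    (P.prod P).real {w | S.e l ^ 2 < |S.X i w.2 - S.Y l i w.2|} ≤ S.Ca * S.e l ^ 2 := by
  have hm : MeasurableSet {ω | S.e l ^ 2 < |S.X i ω - S.Y l i ω|} :=
    measurableSet_lt measurable_const (((S.hX i).sub (S.mY l i)).abs)
  have := (measurePreserving_snd (μ := P) (ν := P)).measureReal_preimage hm.nullMeasurableSet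
  exact this.le.trans (S.approx_i l hl i)

lemma tail_zero {Ω' : Type*} [MeasurableSpace Ω'] (P' : Measure Ω') (l : ℕ) (a : Ω' → ℝ) :
    P'.real {ω | S.e l ^ 2 < |a ω - a ω|} ≤ S.Ca * S.e l ^ 2 := by
  have : {ω | S.e l ^ 2 < |a ω - a ω|} = ∅ := by
    ext ω; simp; positivity
  rw [this]; simp; exact mul_nonneg S.Ca0 (sq_nonneg _)

lemma sHH (l : ℕ) (hl : 1 ≤ l) (i j : ℤ) :
    ∫ w, |S.H (S.Y l i w.1) (S.Y l j w.2) - S.H (S.X i w.1) (S.X j w.2)| ∂(P.prod P) ≤ S.K * S.e l := by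
  have hX := S.hX; have hY := S.mY l
  exact S.static (P.prod P) l hl (fun w => (S.X i w.1, S.X j w.2)) (fun w => (S.Y l i w.1, S.Y l j w.2))
    (by fun_prop) (by fun_prop) (S.law_prod i j)
    (tail_pair _ _ _ _ _ _ _ (S.tail_fst P l hl i) (S.tail_snd l hl j))

lemma sHX (l : ℕ) (hl : 1 ≤ l) (i j : ℤ) :
    ∫ w, |S.H (S.X i w.1) (S.Y l j w.2) - S.H (S.X i w.1) (S.X j w.2)| ∂(P.prod P) ≤ S.K * S.e l := by
  have hX := S.hX; have hY := S.mY l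
  exact S.static (P.prod P) l hl (fun w => (S.X i w.1, S.X j w.2)) (fun w => (S.X i w.1, S.Y l j w.2))
    (by fun_prop) (by fun_prop) (S.law_prod i j)
    (tail_pair _ _ _ _ _ _ _ (S.tail_zero _ l _) (S.tail_snd l hl j))

lemma sXH (l : ℕ) (hl : 1 ≤ l) (i j : ℤ) :
    ∫ w, |S.H (S.Y l i w.1) (S.X j w.2) - S.H (S.X i w.1) (S.X j w.2)| ∂(P.prod P) ≤ S.K * S.e l := by
  have hX := S.hX; have hY := S.mY l
  exact S.static (P.prod P) l hl (fun w => (S.X i w.1, S.X j w.2)) (fun w => (S.Y l i w.1, S.X j w.2))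
    (by fun_prop) (by fun_prop) (S.law_prod i j)
    (tail_pair _ _ _ _ _ _ _ (S.tail_fst P l hl i) (S.tail_zero _ l _))

/-- mean of the kernel -/
def θ : ℝ := ∫ x, ∫ y, S.H x y ∂S.μ ∂S.μ
/-- projection -/
def g1 (x : ℝ) : ℝ := (∫ y, S.H x y ∂S.μ) - S.θ
/-- degenerate part -/
def g2 (x y : ℝ) : ℝ := S.H x y - S.g1 x - S.g1 y - S.θ

lemma Hm1 (x : ℝ) : Measurable (S.H x) := S.Hm.comp (measurable_const.prodMk measurable_id)

lemma H_int {ν : Measure ℝ} [IsProbabilityMeasure ν] (x : ℝ) : Integrable (S.H x) ν :=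
  intb (S.Hm1 x) S.M fun s => by rw [abs_of_nonneg (S.H0 _ _)]; exact S.HM _ _

lemma Hproj_m : Measurable fun x => ∫ y, S.H x y ∂S.μ := by
  have h : StronglyMeasurable (Function.uncurry S.H) := S.Hm.stronglyMeasurable
  exact h.integral_prod_right.measurable

lemma Hproj_bd (x : ℝ) : 0 ≤ (∫ y, S.H x y ∂S.μ) ∧ (∫ y, S.H x y ∂S.μ) ≤ S.M := by
  constructor
  · exact integral_nonneg fun y => S.H0 x y
  · calc (∫ y, S.H x y ∂S.μ) ≤ ∫ _, S.M ∂S.μ :=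
        integral_mono (S.H_int x) (integrable_const _) fun y => S.HM x y
      _ = S.M := by simp

lemma Hproj_int {ν : Measure ℝ} [IsProbabilityMeasure ν] :
    Integrable (fun x => ∫ y, S.H x y ∂S.μ) ν :=
  intb S.Hproj_m S.M fun x => by rw [abs_of_nonneg (S.Hproj_bd x).1]; exact (S.Hproj_bd x).2

lemma θ_bd : 0 ≤ S.θ ∧ S.θ ≤ S.M := by
  constructor
  · exact integral_nonneg fun y => (S.Hproj_bd y).1
  · calc S.θ ≤ ∫ _, S.M ∂S.μ :=
        integral_mono S.Hproj_int (integrable_const _) fun y => (S.Hproj_bd y).2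
      _ = S.M := by simp

lemma g1_m : Measurable S.g1 := S.Hproj_m.sub measurable_const

lemma g1_bd (x : ℝ) : |S.g1 x| ≤ S.M := by
  unfold g1; rw [abs_le]
  have := S.Hproj_bd x; have := S.θ_bd
  constructor <;> linarith

lemma g1_int {ν : Measure ℝ} [IsProbabilityMeasure ν] : Integrable S.g1 ν :=
  intb S.g1_m S.M S.g1_bd

lemma g1_mean : ∫ x, S.g1 x ∂S.μ = 0 := by
  unfold g1
  rw [integral_sub S.Hproj_int (integrable_const _)]
  simp [θ]

lemma g2_m : Measurable fun q : ℝ × ℝ => S.g2 q.1 q.2 := by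
  have := S.g1_m; have := S.Hm
  unfold g2; fun_prop

lemma g2_bd (x y : ℝ) : |S.g2 x y| ≤ 4 * S.M := by
  unfold g2
  have h1 := abs_le.1 (S.g1_bd x); have h2 := abs_le.1 (S.g1_bd y)
  have := S.θ_bd; have := S.H0 x y; have := S.HM x y
  rw [abs_le]; constructor <;> linarith

lemma g2_symm (x y : ℝ) : S.g2 x y = S.g2 y x := by
  unfold g2; rw [S.Hs x y]; ring

lemma g2_deg (x : ℝ) : ∫ y, S.g2 x y ∂S.μ = 0 := by
  unfold g2
  have i1 := S.H_int (ν := S.μ) x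
  have i2 : Integrable (fun y => S.H x y - S.g1 x) S.μ := i1.sub (integrable_const _)
  have i3 : Integrable (fun y => S.H x y - S.g1 x - S.g1 y) S.μ := i2.sub S.g1_int
  rw [integral_sub i3 (integrable_const _), integral_sub i2 S.g1_int,
    integral_sub i1 (integrable_const _), S.g1_mean]
  simp [g1]

lemma g2_degX (i : ℤ) (x : ℝ) : ∫ ω, S.g2 x (S.X i ω) ∂P = 0 := by
  rw [← S.g2_deg x, ← S.map_X i, integral_map (S.hX i).aemeasurable]
  exact (S.g2_m.comp (measurable_const.prodMk measurable_id)).aestronglyMeasurable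

lemma g1_meanX (i : ℤ) : ∫ ω, S.g1 (S.X i ω) ∂P = 0 := by
  rw [← S.g1_mean, ← S.map_X i, integral_map (S.hX i).aemeasurable]
  exact S.g1_m.aestronglyMeasurable

lemma g1_approx (l : ℕ) (hl : 1 ≤ l) (i : ℤ) :
    ∫ ω, |S.g1 (S.Y l i ω) - S.g1 (S.X i ω)| ∂P ≤ S.K * S.e l := by
  have hX := S.hX; have hY := S.mY l; have hHm := S.Hm
  have h := S.static (P.prod S.μ) l hl (fun w => (S.X i w.1, w.2)) (fun w => (S.Y l i w.1, w.2))
    (by fun_prop) (by fun_prop)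
    (by
      have := Measure.map_prod_map P S.μ (S.hX i) measurable_id
      rw [S.map_X, Measure.map_id] at this
      rw [this]; rfl)
    (tail_pair _ _ _ _ _ _ _ (S.tail_fst S.μ l hl i) (S.tail_zero _ l _))
  refine le_trans ?_ h
  have hm : Measurable fun w : Ω × ℝ => |S.H (S.Y l i w.1) w.2 - S.H (S.X i w.1) w.2| := by
    fun_prop
  have hi : Integrable (fun w : Ω × ℝ => |S.H (S.Y l i w.1) w.2 - S.H (S.X i w.1) w.2|)
      (P.prod S.μ) := intb hm S.M fun w => by rw [abs_abs]; exact S.absH _ _ _ _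
  rw [integral_prod _ hi]
  refine integral_mono ?_ hi.integral_prod_left fun ω => ?_
  · have := S.g1_m
    exact intb (by fun_prop) (S.M + S.M) fun ω => by
      rw [abs_abs]; exact (abs_sub _ _).trans (add_le_add (S.g1_bd _) (S.g1_bd _))
  · show |S.g1 (S.Y l i ω) - S.g1 (S.X i ω)| ≤ _
    have : S.g1 (S.Y l i ω) - S.g1 (S.X i ω) = ∫ y, (S.H (S.Y l i ω) y - S.H (S.X i ω) y) ∂S.μ := by
      rw [integral_sub (S.H_int _) (S.H_int _)]; unfold g1; ring
    rw [this]
    exact abs_integral_le_integral_abs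

/-- dynamic approximation -/
lemma dynamic (l : ℕ) (hl : 1 ≤ l) (i j : ℤ) (hij : i + 3 * l ≤ j) :
    ∫ ω, |S.H (S.Y l i ω) (S.Y l j ω) - S.H (S.X i ω) (S.X j ω)| ∂P ≤
      S.K * S.e l + 4 * S.M * S.β l := by
  classical
  have hX := S.hX; have hY := S.mY l; have hHm := S.Hm
  have he := S.e_pos l hl
  have he1 := S.e_le_one l hl
  let π : Measure ((ℝ × ℝ) × (ℝ × ℝ)) :=
    P.map (fun ω => ((S.Y l i ω, S.Y l j ω), (S.X i ω, S.X j ω)))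
  have hmap : Measurable fun ω => ((S.Y l i ω, S.Y l j ω), (S.X i ω, S.X j ω)) := by fun_prop
  have : IsProbabilityMeasure π := Measure.isProbabilityMeasure_map hmap.aemeasurable
  let F : (ℝ × ℝ) × (ℝ × ℝ) → ℝ := fun x =>
    if dist x.2 x.1 ≤ S.e l ^ 2 then |S.H x.2.1 x.2.2 - S.H x.1.1 x.1.2| else 0
  have hs : MeasurableSet {x : (ℝ × ℝ) × (ℝ × ℝ) | dist x.2 x.1 ≤ S.e l ^ 2} :=
    measurableSet_le (by fun_prop) measurable_const
  have hF : Measurable F := by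
    refine Measurable.ite hs ?_ measurable_const
    have h1 : Measurable fun x : (ℝ × ℝ) × (ℝ × ℝ) => S.H x.2.1 x.2.2 := hHm.comp measurable_snd
    have h2 : Measurable fun x : (ℝ × ℝ) × (ℝ × ℝ) => S.H x.1.1 x.1.2 := hHm.comp measurable_fst
    exact (h1.sub h2).abs
  have hF0 : ∀ x, 0 ≤ F x := fun x => by simp only [F]; split_ifs <;> simp
  have hFM : ∀ x, F x ≤ S.M := fun x => by
    simp only [F]; split_ifs
    · exact S.absH _ _ _ _
    · exact S.M0
  have hFa : ∀ x, |F x| ≤ S.M := fun x => by rw [abs_of_nonneg (hF0 x)]; exact hFM x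
  have hFo : ∀ y x, F (y, x) ≤ S.osc (S.e l ^ 2) y := fun y x => by
    simp only [F]; split_ifs with h
    · exact S.le_osc _ _ _ h
    · exact S.osc_nonneg _ _
  let G : ℝ × ℝ → ℝ := fun y => ∫ x, F (y, x) ∂(π.condKernel y)
  have hG : Measurable G := (hF.stronglyMeasurable.integral_kernel_prod_right').measurable
  have hFi : ∀ y, Integrable (fun x => F (y, x)) (π.condKernel y) := fun y =>
    intb (hF.comp (measurable_const.prodMk measurable_id)) S.M fun x => hFa _
  have hG0 : ∀ y, 0 ≤ G y := fun y => integral_nonneg fun x => hF0 _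
  have hGM : ∀ y, G y ≤ S.M := fun y => by
    calc G y ≤ ∫ _, S.M ∂(π.condKernel y) := integral_mono (hFi y) (integrable_const _) fun x => hFM _
      _ = S.M := by simp
  have hGo : ∀ y, G y ≤ S.osc (S.e l ^ 2) y := fun y => by
    calc G y ≤ ∫ _, S.osc (S.e l ^ 2) y ∂(π.condKernel y) :=
          integral_mono (hFi y) (integrable_const _) fun x => hFo y x
      _ = _ := by simp
  have hFπ : ∫ x, F x ∂π = ∫ ω, G (S.Y l i ω, S.Y l j ω) ∂P := by
    have h1 := Measure.integral_condKernel (ρ := π) (f := F) (intb hF S.M hFa)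
    rw [← h1]
    have h2 : π.fst = P.map (fun ω => (S.Y l i ω, S.Y l j ω)) := by
      simp only [π]; rw [Measure.fst_map_prodMk (by fun_prop)]
    rw [h2, integral_map (by fun_prop) hG.aestronglyMeasurable]
  have hmix := mix_real P S.X S.Z S.hX S.hZ S.hst S.β S.hβ (i + l) l (S.Y l i) (S.Y l j)
    (S.mY_past l i _ le_rfl) (S.mY_fut l j _ (by linarith)) G hG S.M
    (fun y => by rw [abs_of_nonneg (hG0 y)]; exact hGM y)
  have hvm := S.var_master (P.prod P) (fun w => (S.X i w.1, S.X j w.2))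
    (fun w => (S.Y l i w.1, S.Y l j w.2)) (by fun_prop) (by fun_prop) (S.law_prod i j)
    (S.e l ^ 2) (2 * S.e l ^ 2) 2 (S.e l) (by positivity) (by norm_num) he
    (fun x => G x.2) (hG.comp measurable_snd) (fun x => hG0 _) (fun x => hGM _)
    (fun q t hd => (hGo t).trans (S.osc_le _ q t (by positivity) hd))
  have ht := tail_pair _ _ _ _ _ _ _ (S.tail_fst P l hl i) (S.tail_snd l hl j)
  have ht2 := tail_pair _ _ _ _ _ _ _ (S.approx_i l hl i) (S.approx_i l hl j)
  have hbad : MeasurableSet {ω | S.e l ^ 2 < dist (S.Y l i ω, S.Y l j ω) (S.X i ω, S.X j ω)} :=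
    measurableSet_lt measurable_const (by fun_prop)
  have iF : Integrable (fun ω => F ((S.Y l i ω, S.Y l j ω), (S.X i ω, S.X j ω))) P :=
    intb (hF.comp hmap) S.M fun ω => hFa _
  have hle : ∫ ω, |S.H (S.Y l i ω) (S.Y l j ω) - S.H (S.X i ω) (S.X j ω)| ∂P ≤
      ∫ ω, (F ((S.Y l i ω, S.Y l j ω), (S.X i ω, S.X j ω)) +
        {ω | S.e l ^ 2 < dist (S.Y l i ω, S.Y l j ω) (S.X i ω, S.X j ω)}.indicator
          (fun _ => S.M) ω) ∂P := by
    refine integral_mono (intb (by fun_prop) S.M fun ω => by rw [abs_abs]; exact S.absH _ _ _ _)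
      (iF.add ((integrable_const _).indicator hbad)) fun ω => ?_
    show |S.H (S.Y l i ω) (S.Y l j ω) - S.H (S.X i ω) (S.X j ω)| ≤ F _ + _
    by_cases h : S.e l ^ 2 < dist (S.Y l i ω, S.Y l j ω) (S.X i ω, S.X j ω)
    · rw [indicator_of_mem (by exact h)]
      linarith [S.absH (S.Y l i ω) (S.Y l j ω) (S.X i ω) (S.X j ω),
        hF0 ((S.Y l i ω, S.Y l j ω), (S.X i ω, S.X j ω))]
    · rw [indicator_of_notMem (by exact h), add_zero]
      simp only [F]
      rw [if_pos (by rw [dist_comm]; exact not_lt.1 h), abs_sub_comm]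
  rw [integral_add iF ((integrable_const _).indicator hbad), integral_indicator hbad] at hle
  have hFπ' : ∫ x, F x ∂π = ∫ ω, F ((S.Y l i ω, S.Y l j ω), (S.X i ω, S.X j ω)) ∂P :=
    integral_map hmap.aemeasurable hF.aestronglyMeasurable
  rw [← hFπ', hFπ] at hle
  simp only [integral_const, smul_eq_mul, measureReal_restrict_apply_univ] at hle
  have h1 : (2 : ℝ) ^ 2 * S.L * (2 * S.e l ^ 2) / S.e l = 8 * S.L * S.e l := by field_simp; ring
  rw [h1] at hvm
  have hm := (abs_le.1 hmix).2
  have h3 : S.M * S.Ca * S.e l ^ 2 ≤ S.M * S.Ca * S.e l := by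
    refine mul_le_mul_of_nonneg_left ?_ (mul_nonneg S.M0 S.Ca0); nlinarith
  have h4 := mul_le_mul_of_nonneg_left ht S.M0
  have h5 := mul_le_mul_of_nonneg_left ht2 S.M0
  unfold K
  nlinarith

end Setup
end UQuantile


namespace UQuantile
namespace Setup
variable {Ω : Type*} [MeasurableSpace Ω] {P : Measure Ω} (S : Setup P) [IsProbabilityMeasure P]

lemma int_abs_sub {Ω' : Type*} [MeasurableSpace Ω'] (P' : Measure Ω') [IsProbabilityMeasure P']
    {f g : Ω' → ℝ} {C : ℝ} (hf : Measurable f) (hg : Measurable g) (hfC : ∀ x, |f x| ≤ C)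
    (hgC : ∀ x, |g x| ≤ C) : Integrable (fun x => |f x - g x|) P' :=
  intb (hf.sub hg).abs (C + C) fun x => by
    rw [abs_abs]; exact (abs_sub _ _).trans (add_le_add (hfC x) (hgC x))

lemma Ha (x y : ℝ) : |S.H x y| ≤ S.M := by rw [abs_of_nonneg (S.H0 _ _)]; exact S.HM _ _

/-- integral of a three-term majorant -/
lemma int_le3 {Ω' : Type*} [MeasurableSpace Ω'] (P' : Measure Ω') [IsProbabilityMeasure P']
    {u a b c : Ω' → ℝ} (ha : Integrable a P') (hb : Integrable b P') (hc : Integrable c P')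
    (hu : Integrable u P') (h : ∀ x, u x ≤ a x + b x + c x) {A B C : ℝ}
    (hA : ∫ x, a x ∂P' ≤ A) (hB : ∫ x, b x ∂P' ≤ B) (hC : ∫ x, c x ∂P' ≤ C) :
    ∫ x, u x ∂P' ≤ A + B + C := by
  have i1 : Integrable (fun x => a x + b x) P' := ha.add hb
  calc ∫ x, u x ∂P' ≤ ∫ x, (a x + b x + c x) ∂P' := integral_mono hu (i1.add hc) h
    _ = (∫ x, a x ∂P') + (∫ x, b x ∂P') + ∫ x, c x ∂P' := by
      rw [integral_add i1 hc, integral_add ha hb]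
    _ ≤ _ := by linarith

lemma pg_fst (l : ℕ) (hl : 1 ≤ l) (i j : ℤ) :
    ∫ w, |S.g2 (S.Y l i w.1) (S.Y l j w.2) - S.g2 (S.X i w.1) (S.Y l j w.2)| ∂(P.prod P)
      ≤ 3 * S.K * S.e l := by
  have hX := S.hX; have hY := S.mY l; have hHm := S.Hm; have hg1 := S.g1_m; have hg2 := S.g2_m
  have h3 : ∫ w, |S.g1 (S.Y l i w.1) - S.g1 (S.X i w.1)| ∂(P.prod P) ≤ S.K * S.e l := by
    rw [integral_fun_fst (μ := P) (ν := P) (f := fun ω => |S.g1 (S.Y l i ω) - S.g1 (S.X i ω)|)]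
    simpa using S.g1_approx l hl i
  refine (int_le3 (P.prod P) (int_abs_sub _ (C := S.M) ?_ ?_ ?_ ?_)
    (int_abs_sub _ (C := S.M) ?_ ?_ ?_ ?_) (int_abs_sub _ (C := S.M) ?_ ?_ ?_ ?_)
    (int_abs_sub _ (C := 4 * S.M) ?_ ?_ ?_ ?_) ?_ (S.sHH l hl i j)
    (S.sHX l hl i j) h3).trans (le_of_eq (by ring))
  any_goals fun_prop
  any_goals intro w; exact S.Ha _ _
  any_goals intro w; exact S.g1_bd _
  any_goals intro w; exact S.g2_bd _ _
  intro w
  unfold g2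
  have e : S.H (S.Y l i w.1) (S.Y l j w.2) - S.g1 (S.Y l i w.1) - S.g1 (S.Y l j w.2) - S.θ -
      (S.H (S.X i w.1) (S.Y l j w.2) - S.g1 (S.X i w.1) - S.g1 (S.Y l j w.2) - S.θ) =
      (S.H (S.Y l i w.1) (S.Y l j w.2) - S.H (S.X i w.1) (S.X j w.2)) -
      (S.H (S.X i w.1) (S.Y l j w.2) - S.H (S.X i w.1) (S.X j w.2)) -
      (S.g1 (S.Y l i w.1) - S.g1 (S.X i w.1)) := by ring
  rw [e]
  exact (abs_sub _ _).trans (add_le_add (abs_sub _ _) le_rfl)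

lemma pg_snd (l : ℕ) (hl : 1 ≤ l) (i j : ℤ) :
    ∫ w, |S.g2 (S.Y l i w.1) (S.Y l j w.2) - S.g2 (S.Y l i w.1) (S.X j w.2)| ∂(P.prod P)
      ≤ 3 * S.K * S.e l := by
  have hX := S.hX; have hY := S.mY l; have hHm := S.Hm; have hg1 := S.g1_m; have hg2 := S.g2_m
  have h3 : ∫ w, |S.g1 (S.Y l j w.2) - S.g1 (S.X j w.2)| ∂(P.prod P) ≤ S.K * S.e l := by
    rw [integral_fun_snd (μ := P) (ν := P) (f := fun ω => |S.g1 (S.Y l j ω) - S.g1 (S.X j ω)|)]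
    simpa using S.g1_approx l hl j
  refine (int_le3 (P.prod P) (int_abs_sub _ (C := S.M) ?_ ?_ ?_ ?_)
    (int_abs_sub _ (C := S.M) ?_ ?_ ?_ ?_) (int_abs_sub _ (C := S.M) ?_ ?_ ?_ ?_)
    (int_abs_sub _ (C := 4 * S.M) ?_ ?_ ?_ ?_) ?_ (S.sHH l hl i j)
    (S.sXH l hl i j) h3).trans (le_of_eq (by ring))
  any_goals fun_prop
  any_goals intro w; exact S.Ha _ _
  any_goals intro w; exact S.g1_bd _
  any_goals intro w; exact S.g2_bd _ _
  intro w
  unfold g2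
  have e : S.H (S.Y l i w.1) (S.Y l j w.2) - S.g1 (S.Y l i w.1) - S.g1 (S.Y l j w.2) - S.θ -
      (S.H (S.Y l i w.1) (S.X j w.2) - S.g1 (S.Y l i w.1) - S.g1 (S.X j w.2) - S.θ) =
      (S.H (S.Y l i w.1) (S.Y l j w.2) - S.H (S.X i w.1) (S.X j w.2)) -
      (S.H (S.Y l i w.1) (S.X j w.2) - S.H (S.X i w.1) (S.X j w.2)) -
      (S.g1 (S.Y l j w.2) - S.g1 (S.X j w.2)) := by ring
  rw [e]
  exact (abs_sub _ _).trans (add_le_add (abs_sub _ _) le_rfl)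

lemma dyn_g2 (l : ℕ) (hl : 1 ≤ l) (i j : ℤ) (hij : i + 3 * l ≤ j) :
    ∫ ω, |S.g2 (S.Y l i ω) (S.Y l j ω) - S.g2 (S.X i ω) (S.X j ω)| ∂P
      ≤ 3 * S.K * S.e l + 4 * S.M * S.β l := by
  have hX := S.hX; have hY := S.mY l; have hHm := S.Hm; have hg1 := S.g1_m; have hg2 := S.g2_m
  refine (int_le3 P (int_abs_sub _ (C := S.M) ?_ ?_ ?_ ?_)
    (int_abs_sub _ (C := S.M) ?_ ?_ ?_ ?_) (int_abs_sub _ (C := S.M) ?_ ?_ ?_ ?_)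
    (int_abs_sub _ (C := 4 * S.M) ?_ ?_ ?_ ?_) ?_ (S.dynamic l hl i j hij)
    (S.g1_approx l hl i) (S.g1_approx l hl j)).trans (le_of_eq (by ring))
  any_goals fun_prop
  any_goals intro w; exact S.Ha _ _
  any_goals intro w; exact S.g1_bd _
  any_goals intro w; exact S.g2_bd _ _
  intro w
  unfold g2
  have e : S.H (S.Y l i w) (S.Y l j w) - S.g1 (S.Y l i w) - S.g1 (S.Y l j w) - S.θ -
      (S.H (S.X i w) (S.X j w) - S.g1 (S.X i w) - S.g1 (S.X j w) - S.θ) =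
      (S.H (S.Y l i w) (S.Y l j w) - S.H (S.X i w) (S.X j w)) -
      (S.g1 (S.Y l i w) - S.g1 (S.X i w)) -
      (S.g1 (S.Y l j w) - S.g1 (S.X j w)) := by ring
  rw [e]
  exact (abs_sub _ _).trans (add_le_add (abs_sub _ _) le_rfl)

/-- rate for isolated indices -/
def ρ (l : ℕ) : ℝ := 64 * S.M ^ 2 * S.β l + 12 * S.M * S.K * S.e l

lemma prod_close {Ω' : Type*} [MeasurableSpace Ω'] (P' : Measure Ω') [IsProbabilityMeasure P']
    (a b r : Ω' → ℝ) (ha : Measurable a) (hb : Measurable b) (hr : Measurable r) (C : ℝ)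
    (hac : ∀ w, |a w| ≤ C) (hbc : ∀ w, |b w| ≤ C) (hrc : ∀ w, |r w| ≤ C) (η : ℝ)
    (h : ∫ w, |a w - b w| ∂P' ≤ η) (h0 : ∫ w, b w * r w ∂P' = 0) (hC : 0 ≤ C) :
    |∫ w, a w * r w ∂P'| ≤ C * η := by
  have ib : ∀ c : Ω' → ℝ, Measurable c → (∀ w, |c w| ≤ C) → Integrable (fun w => c w * r w) P' :=
    fun c hc hcc => intb (hc.mul hr) (C * C) fun w => by
      rw [abs_mul]; exact mul_le_mul (hcc w) (hrc w) (abs_nonneg _) hC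
  have : ∫ w, a w * r w ∂P' = ∫ w, (a w - b w) * r w ∂P' := by
    simp only [sub_mul]
    rw [integral_sub (ib a ha hac) (ib b hb hbc), h0, sub_zero]
  rw [this]
  calc |∫ w, (a w - b w) * r w ∂P'| ≤ ∫ w, |(a w - b w) * r w| ∂P' := abs_integral_le_integral_abs
    _ ≤ ∫ w, C * |a w - b w| ∂P' := by
      refine integral_mono_of_nonneg (ae_of_all _ fun _ => abs_nonneg _)
        ((int_abs_sub P' ha hb hac hbc).const_mul C) (ae_of_all _ fun w => ?_)
      show |(a w - b w) * r w| ≤ C * |a w - b w|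
      rw [abs_mul, mul_comm]
      exact mul_le_mul_of_nonneg_right (hrc w) (abs_nonneg _)
    _ = C * ∫ w, |a w - b w| ∂P' := integral_const_mul _ _
    _ ≤ _ := mul_le_mul_of_nonneg_left h hC

lemma iso_min (l : ℕ) (hl : 1 ≤ l) (i j k m : ℤ) (hj : i + 3 * l ≤ j) (hk : i + 3 * l ≤ k)
    (hm : i + 3 * l ≤ m) :
    |∫ ω, S.g2 (S.Y l i ω) (S.Y l j ω) * S.g2 (S.Y l k ω) (S.Y l m ω) ∂P| ≤ S.ρ l := by
  have hX := S.hX; have hY := S.mY l; have hg2 := S.g2_m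
  have hM := S.M0
  have hmix := mix_real P S.X S.Z S.hX S.hZ S.hst S.β S.hβ (i + l) l (S.Y l i)
    (fun ω => (S.Y l j ω, S.Y l k ω, S.Y l m ω))
    (S.mY_past l i _ le_rfl) (Measurable.prodMk (S.mY_fut l j _ (by linarith))
      (Measurable.prodMk (S.mY_fut l k _ (by linarith)) (S.mY_fut l m _ (by linarith))))
    (fun x => S.g2 x.1 x.2.1 * S.g2 x.2.2.1 x.2.2.2) (by fun_prop) (4 * S.M * (4 * S.M))
    (fun y => by rw [abs_mul]; exact mul_le_mul (S.g2_bd _ _) (S.g2_bd _ _) (abs_nonneg _)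
                  (by positivity))
  have hc := prod_close (P.prod P) (fun w => S.g2 (S.Y l i w.1) (S.Y l j w.2))
    (fun w => S.g2 (S.X i w.1) (S.Y l j w.2)) (fun w => S.g2 (S.Y l k w.2) (S.Y l m w.2))
    (by fun_prop) (by fun_prop) (by fun_prop) (4 * S.M) (fun w => S.g2_bd _ _)
    (fun w => S.g2_bd _ _) (fun w => S.g2_bd _ _) _ (S.pg_fst l hl i j) ?_ (by positivity)
  · have h1 := abs_le.1 hmix
    have h2 := abs_le.1 hc
    unfold ρ
    rw [abs_le]
    constructor <;> nlinarith
  · rw [integral_prod_symm]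
    · simp only [integral_mul_const]
      have : ∀ y : Ω, ∫ x, S.g2 (S.X i x) (S.Y l j y) ∂P = 0 := fun y => by
        simp_rw [S.g2_symm _ (S.Y l j y)]; exact S.g2_degX i _
      simp [this]
    · exact intb (by fun_prop) (4 * S.M * (4 * S.M)) fun w => by
        rw [abs_mul]; exact mul_le_mul (S.g2_bd _ _) (S.g2_bd _ _) (abs_nonneg _) (by positivity)

lemma iso_max (l : ℕ) (hl : 1 ≤ l) (i j k m : ℤ) (hi : i + 3 * l ≤ j) (hk : k + 3 * l ≤ j)
    (hm : m + 3 * l ≤ j) :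
    |∫ ω, S.g2 (S.Y l i ω) (S.Y l j ω) * S.g2 (S.Y l k ω) (S.Y l m ω) ∂P| ≤ S.ρ l := by
  have hX := S.hX; have hY := S.mY l; have hg2 := S.g2_m
  have hM := S.M0
  have hmix := mix_real P S.X S.Z S.hX S.hZ S.hst S.β S.hβ (j - 2 * l) l
    (fun ω => (S.Y l i ω, S.Y l k ω, S.Y l m ω)) (S.Y l j)
    (Measurable.prodMk (S.mY_past l i _ (by linarith))
      (Measurable.prodMk (S.mY_past l k _ (by linarith)) (S.mY_past l m _ (by linarith))))
    (S.mY_fut l j _ (by linarith))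
    (fun x => S.g2 x.1.1 x.2 * S.g2 x.1.2.1 x.1.2.2) (by fun_prop) (4 * S.M * (4 * S.M))
    (fun y => by rw [abs_mul]; exact mul_le_mul (S.g2_bd _ _) (S.g2_bd _ _) (abs_nonneg _)
                  (by positivity))
  have hc := prod_close (P.prod P) (fun w => S.g2 (S.Y l i w.1) (S.Y l j w.2))
    (fun w => S.g2 (S.Y l i w.1) (S.X j w.2)) (fun w => S.g2 (S.Y l k w.1) (S.Y l m w.1))
    (by fun_prop) (by fun_prop) (by fun_prop) (4 * S.M) (fun w => S.g2_bd _ _)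
    (fun w => S.g2_bd _ _) (fun w => S.g2_bd _ _) _ (S.pg_snd l hl i j) ?_ (by positivity)
  · have h1 := abs_le.1 hmix
    have h2 := abs_le.1 hc
    unfold ρ
    rw [abs_le]
    constructor <;> nlinarith
  · rw [integral_prod]
    · simp only [integral_mul_const]
      have : ∀ y : Ω, ∫ x, S.g2 (S.Y l i y) (S.X j x) ∂P = 0 := fun y => S.g2_degX j _
      simp [this]
    · exact intb (by fun_prop) (4 * S.M * (4 * S.M)) fun w => by
        rw [abs_mul]; exact mul_le_mul (S.g2_bd _ _) (S.g2_bd _ _) (abs_nonneg _) (by positivity)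

/-- far pairs -/
def far (n l : ℕ) : Finset (ℤ × ℤ) :=
  (Finset.Icc (1 : ℤ) n ×ˢ Finset.Icc (1 : ℤ) n).filter fun p => p.1 + 3 * l ≤ p.2

/-- close ordered pairs -/
def close (n l : ℕ) : Finset (ℤ × ℤ) :=
  (Finset.Icc (1 : ℤ) n ×ˢ Finset.Icc (1 : ℤ) n).filter fun p => p.1 < p.2 ∧ ¬ (p.1 + 3 * l ≤ p.2)

lemma far_card (n l : ℕ) : ((far n l).card : ℝ) ≤ (n : ℝ) ^ 2 := by
  have : (far n l).card ≤ n * n := by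
    refine (Finset.card_filter_le _ _).trans ?_
    rw [Finset.card_product]; simp
  calc ((far n l).card : ℝ) ≤ ((n * n : ℕ) : ℝ) := by exact_mod_cast this
    _ = _ := by push_cast; ring

lemma close_card (n l : ℕ) : ((close n l).card : ℝ) ≤ n * (3 * l) := by
  have : (close n l).card ≤ n * (3 * l) := by
    have hsub : close n l ⊆ (Finset.Icc (1 : ℤ) n).biUnion fun i =>
        (Finset.Ioo i (i + 3 * l)).image fun j => (i, j) := by
      rintro ⟨i, j⟩ h
      simp only [close, Finset.mem_filter, Finset.mem_product, Finset.mem_Icc, not_le] at h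
      simp only [Finset.mem_biUnion, Finset.mem_Icc, Finset.mem_image, Finset.mem_Ioo]
      exact ⟨i, h.1.1, j, h.2, rfl⟩
    refine (Finset.card_le_card hsub).trans ?_
    refine (Finset.card_biUnion_le_card_mul _ _ (3 * l) fun i _ => ?_).trans (by simp)
    refine Finset.card_image_le.trans ?_
    rw [Int.card_Ioo]; omega
  calc ((close n l).card : ℝ) ≤ ((n * (3 * l) : ℕ) : ℝ) := by exact_mod_cast this
    _ = _ := by push_cast; ring

lemma sum_split (n l : ℕ) (hl : 1 ≤ l) (f : ℤ → ℤ → ℝ) :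
    ∑ i ∈ Finset.Icc (1 : ℤ) (n : ℤ), ∑ j ∈ Finset.Ioc i (n : ℤ), f i j =
      ∑ p ∈ close n l, f p.1 p.2 + ∑ p ∈ far n l, f p.1 p.2 := by
  have h1 : ∑ i ∈ Finset.Icc (1 : ℤ) (n : ℤ), ∑ j ∈ Finset.Ioc i (n : ℤ), f i j =
      ∑ p ∈ (Finset.Icc (1 : ℤ) n ×ˢ Finset.Icc (1 : ℤ) n).filter (fun p => p.1 < p.2),
        f p.1 p.2 := by
    rw [Finset.sum_filter, Finset.sum_product]
    refine Finset.sum_congr rfl fun i hi => ?_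
    rw [← Finset.sum_filter]
    refine Finset.sum_congr ?_ fun _ _ => rfl
    ext j
    simp only [Finset.mem_Ioc, Finset.mem_filter, Finset.mem_Icc] at hi ⊢
    omega
  rw [h1, ← Finset.sum_filter_not_add_sum_filter _ (fun p : ℤ × ℤ => p.1 + 3 * l ≤ p.2),
    Finset.filter_filter, Finset.filter_filter]
  congr 1
  refine Finset.sum_congr ?_ fun _ _ => rfl
  ext p
  simp only [far, Finset.mem_filter]
  constructor
  · rintro ⟨h, _, h2⟩; exact ⟨h, h2⟩
  · rintro ⟨h, h2⟩; exact ⟨h, by omega, h2⟩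

/-- second moment of the windowed degenerate part -/
lemma second_moment (n l : ℕ) (hl : 1 ≤ l) :
    ∫ ω, (∑ p ∈ far n l, S.g2 (S.Y l p.1 ω) (S.Y l p.2 ω)) ^ 2 ∂P ≤
      (n : ℝ) ^ 4 * S.ρ l + 16 * S.M ^ 2 * ((n : ℝ) ^ 2 * (6 * l) ^ 2) := by
  classical
  have hY := S.mY l; have hg2 := S.g2_m; have hM := S.M0
  have hK := S.K0; have he := (S.e_pos l hl).le; have hb := S.β0 l
  have hρ : 0 ≤ S.ρ l := by unfold ρ; positivity
  have hintg : ∀ p q : ℤ × ℤ, Integrable (fun ω => S.g2 (S.Y l p.1 ω) (S.Y l p.2 ω) *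
      S.g2 (S.Y l q.1 ω) (S.Y l q.2 ω)) P := fun p q =>
    intb (by fun_prop) (4 * S.M * (4 * S.M)) fun w => by
        rw [abs_mul]; exact mul_le_mul (S.g2_bd _ _) (S.g2_bd _ _) (abs_nonneg _) (by positivity)
  have hexp : ∫ ω, (∑ p ∈ far n l, S.g2 (S.Y l p.1 ω) (S.Y l p.2 ω)) ^ 2 ∂P =
      ∑ p ∈ far n l, ∑ q ∈ far n l, ∫ ω, S.g2 (S.Y l p.1 ω) (S.Y l p.2 ω) *
      S.g2 (S.Y l q.1 ω) (S.Y l q.2 ω) ∂P := by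
    simp_rw [pow_two, Finset.sum_mul_sum]
    rw [integral_finset_sum _ fun p _ => integrable_finset_sum _ fun q _ => hintg p q]
    refine Finset.sum_congr rfl fun p _ => ?_
    rw [integral_finset_sum _ fun q _ => hintg p q]
  rw [hexp]
  have hterm : ∀ p ∈ far n l, ∀ q ∈ far n l, ∫ ω, S.g2 (S.Y l p.1 ω) (S.Y l p.2 ω) *
      S.g2 (S.Y l q.1 ω) (S.Y l q.2 ω) ∂P ≤ S.ρ l + if (|q.1 - p.1| < 3 * l ∧ |q.2 - p.2| < 3 * l)
        then 16 * S.M ^ 2 else 0 := by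
    intro p hp q hq
    simp only [far, Finset.mem_filter] at hp hq
    have hp2 := hp.2; have hq2 := hq.2
    have hcomm : ∀ ω, S.g2 (S.Y l p.1 ω) (S.Y l p.2 ω) * S.g2 (S.Y l q.1 ω) (S.Y l q.2 ω) =
      S.g2 (S.Y l q.1 ω) (S.Y l q.2 ω) * S.g2 (S.Y l p.1 ω) (S.Y l p.2 ω) := fun ω => mul_comm _ _
    split_ifs with h
    · have h16 : ∫ ω, S.g2 (S.Y l p.1 ω) (S.Y l p.2 ω) *
          S.g2 (S.Y l q.1 ω) (S.Y l q.2 ω) ∂P ≤ ∫ _, 16 * S.M ^ 2 ∂P := by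
        refine integral_mono (hintg p q) (integrable_const _) fun w => (le_abs_self _).trans ?_
        show |S.g2 (S.Y l p.1 w) (S.Y l p.2 w) * S.g2 (S.Y l q.1 w) (S.Y l q.2 w)| ≤ _
        rw [abs_mul]
        exact (mul_le_mul (S.g2_bd _ _) (S.g2_bd _ _) (abs_nonneg _) (by positivity)).trans
          (le_of_eq (by ring))
      simp only [integral_const, probReal_univ, one_smul] at h16
      linarith
    · rw [add_zero]
      refine (le_abs_self _).trans ?_
      rw [abs_lt, abs_lt] at h
      by_cases c1 : p.1 + 3 * l ≤ q.1
      · exact S.iso_min l hl _ _ _ _ hp2 c1 (by omega)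
      by_cases c2 : q.1 + 3 * l ≤ p.1
      · simp_rw [hcomm]; exact S.iso_min l hl _ _ _ _ hq2 c2 (by omega)
      by_cases c3 : p.2 + 3 * l ≤ q.2
      · simp_rw [hcomm]; exact S.iso_max l hl _ _ _ _ hq2 (by omega) c3
      · exact S.iso_max l hl _ _ _ _ hp2 (by omega) (by omega)
  refine (Finset.sum_le_sum fun p hp => Finset.sum_le_sum fun q hq => hterm p hp q hq).trans ?_
  have hcount : ∀ p ∈ far n l, ∑ q ∈ far n l, (S.ρ l +
      if (|q.1 - p.1| < 3 * l ∧ |q.2 - p.2| < 3 * l) then 16 * S.M ^ 2 else 0) ≤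
      (n : ℝ) ^ 2 * S.ρ l + 16 * S.M ^ 2 * (6 * l) ^ 2 := by
    intro p _
    rw [Finset.sum_add_distrib, Finset.sum_const, nsmul_eq_mul, ← Finset.sum_filter,
      Finset.sum_const, nsmul_eq_mul, mul_comm (16 * S.M ^ 2)]
    refine add_le_add (mul_le_mul_of_nonneg_right (far_card n l) hρ)
      (mul_le_mul_of_nonneg_right ?_ (by positivity))
    have : ((far n l).filter fun q => |q.1 - p.1| < 3 * l ∧ |q.2 - p.2| < 3 * l).card ≤
        (6 * l) * (6 * l) := by
      refine (Finset.card_le_card (?_ : _ ⊆ Finset.Ioo (p.1 - 3 * l) (p.1 + 3 * l) ×ˢ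
        Finset.Ioo (p.2 - 3 * l) (p.2 + 3 * l))).trans ?_
      · intro q hq
        simp only [Finset.mem_filter, abs_lt] at hq
        simp only [Finset.mem_product, Finset.mem_Ioo]
        omega
      · rw [Finset.card_product, Int.card_Ioo, Int.card_Ioo]
        exact Nat.mul_le_mul (by omega) (by omega)
    calc _ ≤ (((6 * l) * (6 * l) : ℕ) : ℝ) := by exact_mod_cast this
      _ = _ := by push_cast; ring
  refine (Finset.sum_le_sum hcount).trans ?_
  rw [Finset.sum_const, nsmul_eq_mul]
  refine (mul_le_mul_of_nonneg_right (far_card n l) (by positivity)).trans (le_of_eq (by ring))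

lemma abs_le_sqrt_sq {Ω' : Type*} [MeasurableSpace Ω'] (P' : Measure Ω') [IsProbabilityMeasure P']
    (R : Ω' → ℝ) (hR : Measurable R) (C : ℝ) (hC : ∀ w, |R w| ≤ C) (b : ℝ)
    (hb : ∫ w, R w ^ 2 ∂P' ≤ b) : ∫ w, |R w| ∂P' ≤ Real.sqrt b := by
  refine Real.le_sqrt_of_sq_le (le_trans ?_ hb)
  set m := ∫ w, |R w| ∂P' with hm
  have i1 : Integrable (fun w => R w ^ 2) P' := intb (hR.pow_const 2) (C ^ 2) fun w => by
    rw [abs_pow]; exact pow_le_pow_left₀ (abs_nonneg _) (hC w) 2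
  have i2 : Integrable (fun w => |R w|) P' := intb hR.abs C fun w => by rw [abs_abs]; exact hC w
  have h : 0 ≤ ∫ w, (R w ^ 2 - 2 * m * |R w| + m ^ 2) ∂P' := by
    refine integral_nonneg fun w => ?_
    show 0 ≤ R w ^ 2 - 2 * m * |R w| + m ^ 2
    rw [← sq_abs (R w)]; nlinarith [sq_nonneg (|R w| - m)]
  have i3 : Integrable (fun w => R w ^ 2 - 2 * m * |R w|) P' := i1.sub (i2.const_mul _)
  rw [integral_add i3 (integrable_const _), integral_sub i1 (i2.const_mul _),
    integral_const_mul, ← hm] at h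
  simp at h
  nlinarith

end Setup
end UQuantile


namespace UQuantile
namespace Setup
variable {Ω : Type*} [MeasurableSpace Ω] {P : Measure Ω} (S : Setup P) [IsProbabilityMeasure P]

/-- overall rate -/
def Fr (n l : ℕ) : ℝ := (l : ℝ) ^ 2 / n + n * (S.β l + S.e l)

lemma Fr_nonneg (n l : ℕ) : 0 ≤ S.Fr n l := by
  have := S.β0 l
  have : 0 ≤ S.e l := by unfold e; positivity
  unfold Fr; positivity

lemma abs_sum_far (n l : ℕ) (hl : 1 ≤ l) :
    ∫ ω, |∑ i ∈ Finset.Icc (1 : ℤ) (n : ℤ), ∑ j ∈ Finset.Ioc i (n : ℤ), S.g2 (S.X i ω) (S.X j ω)| ∂P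
      ≤ 4 * S.M * (n * (3 * l)) + (n : ℝ) ^ 2 * (3 * S.K * S.e l + 4 * S.M * S.β l) +
        Real.sqrt ((n : ℝ) ^ 4 * S.ρ l + 16 * S.M ^ 2 * ((n : ℝ) ^ 2 * (6 * l) ^ 2)) := by
  have hX := S.hX; have hY := S.mY l; have hg2 := S.g2_m; have hM := S.M0
  have hsum : ∀ (s : Finset (ℤ × ℤ)) (V : ℤ → Ω → ℝ) ω,
      |∑ p ∈ s, S.g2 (V p.1 ω) (V p.2 ω)| ≤ s.card * (4 * S.M) := fun s V ω => by
    refine (Finset.abs_sum_le_sum_abs _ _).trans ?_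
    refine (Finset.sum_le_sum fun p _ => S.g2_bd _ _).trans ?_
    simp
  have icl : Integrable (fun ω => |∑ p ∈ close n l, S.g2 (S.X p.1 ω) (S.X p.2 ω)|) P :=
    intb (by fun_prop) ((close n l).card * (4 * S.M)) fun ω => by rw [abs_abs]; exact hsum _ _ _
  have idf : Integrable (fun ω => ∑ p ∈ far n l, |S.g2 (S.Y l p.1 ω) (S.Y l p.2 ω) -
      S.g2 (S.X p.1 ω) (S.X p.2 ω)|) P :=
    integrable_finset_sum _ fun p _ => int_abs_sub P (C := 4 * S.M) (by fun_prop) (by fun_prop)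
      (fun _ => S.g2_bd _ _) (fun _ => S.g2_bd _ _)
  have idy : Integrable (fun ω => |∑ p ∈ far n l, S.g2 (S.Y l p.1 ω) (S.Y l p.2 ω)|) P :=
    intb (by fun_prop) ((far n l).card * (4 * S.M)) fun ω => by rw [abs_abs]; exact hsum _ _ _
  have hx : ∀ ω, ∑ i ∈ Finset.Icc (1 : ℤ) (n : ℤ), ∑ j ∈ Finset.Ioc i (n : ℤ),
      S.g2 (S.X i ω) (S.X j ω) = ∑ p ∈ close n l, S.g2 (S.X p.1 ω) (S.X p.2 ω) +
        ∑ p ∈ far n l, S.g2 (S.X p.1 ω) (S.X p.2 ω) := fun ω =>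
    sum_split n l hl (fun i j => S.g2 (S.X i ω) (S.X j ω))
  simp_rw [hx]
  refine int_le3 P icl idf idy ?_ ?_ ?_ ?_ ?_
  · refine intb (by fun_prop) ((close n l).card * (4 * S.M) + (far n l).card * (4 * S.M)) fun ω => ?_
    rw [abs_abs]
    exact (abs_add_le _ _).trans (add_le_add (hsum _ _ _) (hsum _ _ _))
  · intro ω
    show |∑ p ∈ close n l, S.g2 (S.X p.1 ω) (S.X p.2 ω) +
        ∑ p ∈ far n l, S.g2 (S.X p.1 ω) (S.X p.2 ω)| ≤ _
    have e1 : ∑ p ∈ far n l, S.g2 (S.X p.1 ω) (S.X p.2 ω) =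
      -(∑ p ∈ far n l, (S.g2 (S.Y l p.1 ω) (S.Y l p.2 ω) - S.g2 (S.X p.1 ω) (S.X p.2 ω))) +
       ∑ p ∈ far n l, S.g2 (S.Y l p.1 ω) (S.Y l p.2 ω) := by
      rw [Finset.sum_sub_distrib]; ring
    rw [e1, ← add_assoc]
    refine (abs_add_le _ _).trans (add_le_add ((abs_add_le _ _).trans (add_le_add le_rfl ?_)) le_rfl)
    rw [abs_neg]
    exact Finset.abs_sum_le_sum_abs _ _
  · calc _ ≤ ∫ _, (n * (3 * l)) * (4 * S.M) ∂P := by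
          refine integral_mono icl (integrable_const _) fun ω => (hsum _ _ _).trans ?_
          exact mul_le_mul_of_nonneg_right (close_card n l) (by positivity)
      _ = _ := by simp; ring
  · rw [integral_finset_sum _ fun p _ => int_abs_sub P (C := 4 * S.M) (by fun_prop) (by fun_prop)
      (fun _ => S.g2_bd _ _) (fun _ => S.g2_bd _ _)]
    have : ∀ p ∈ far n l, ∫ ω, |S.g2 (S.Y l p.1 ω) (S.Y l p.2 ω) -
      S.g2 (S.X p.1 ω) (S.X p.2 ω)| ∂P ≤ 3 * S.K * S.e l + 4 * S.M * S.β l := fun p hp => by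
      simp only [far, Finset.mem_filter] at hp
      exact S.dyn_g2 l hl _ _ hp.2
    refine (Finset.sum_le_sum this).trans ?_
    rw [Finset.sum_const, nsmul_eq_mul]
    have h1 := S.K0; have h2 := (S.e_pos l hl).le; have h3 := S.β0 l
    exact mul_le_mul_of_nonneg_right (far_card n l) (by positivity)
  · exact abs_le_sqrt_sq P _ (by fun_prop) ((far n l).card * (4 * S.M)) (hsum _ _) _
      (S.second_moment n l hl)

lemma deg_bound : ∃ C : ℝ, 0 ≤ C ∧ ∀ n l : ℕ, 2 ≤ n → 1 ≤ l →
    ∫ ω, |Real.sqrt n * ((2 / ((n : ℝ) * ((n : ℝ) - 1))) * ∑ i ∈ Finset.Icc (1 : ℤ) (n : ℤ),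
      ∑ j ∈ Finset.Ioc i (n : ℤ), S.g2 (S.X i ω) (S.X j ω))| ∂P ≤
      C * (S.Fr n l + Real.sqrt (S.Fr n l)) := by
  have hM := S.M0; have hK := S.K0
  set C2 : ℝ := 640 * S.M ^ 2 + 12 * S.M * S.K with hC2
  have hC20 : 0 ≤ C2 := by positivity
  refine ⟨48 * S.M + 4 * (3 * S.K + 4 * S.M) + 4 * Real.sqrt C2, by positivity, ?_⟩
  intro n l hn hl
  have hb := S.β0 l; have he := (S.e_pos l hl).le
  have hn2 : (2 : ℝ) ≤ n := by exact_mod_cast hn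
  set s := Real.sqrt n with hs
  have hs2 : s ^ 2 = n := Real.sq_sqrt (by positivity)
  have hs1 : 1 ≤ s := by rw [hs]; exact Real.one_le_sqrt.2 (by linarith)
  have hs0 : 0 < s := by linarith
  have hκ : s * (2 / ((n : ℝ) * ((n : ℝ) - 1))) ≤ 4 / s ^ 3 := by
    rw [← hs2] at hn2 ⊢
    have h1 : 0 < s ^ 2 - 1 := by linarith
    rw [mul_div_assoc', div_le_div_iff₀ (by positivity) (by positivity)]
    have : 0 < s ^ 2 := by positivity
    nlinarith
  have hκ0 : 0 ≤ s * (2 / ((n : ℝ) * ((n : ℝ) - 1))) := by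
    have : 0 < (n : ℝ) - 1 := by linarith
    positivity
  simp_rw [← mul_assoc, abs_mul _ (Finset.sum _ _)]
  rw [integral_const_mul, abs_of_nonneg hκ0]
  have hmain := S.abs_sum_far n l hl
  have h0 := integral_nonneg (μ := P) (f := fun ω => |∑ i ∈ Finset.Icc (1 : ℤ) (n : ℤ),
    ∑ j ∈ Finset.Ioc i (n : ℤ), S.g2 (S.X i ω) (S.X j ω)|) (fun _ => abs_nonneg _)
  refine (mul_le_mul hκ hmain h0 (by positivity)).trans ?_
  have hF0 := S.Fr_nonneg n l
  have a1 : 4 / s ^ 3 * (4 * S.M * (n * (3 * l))) ≤ 48 * S.M * Real.sqrt (S.Fr n l) := by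
    have : (l : ℝ) / s ≤ Real.sqrt (S.Fr n l) := by
      refine Real.le_sqrt_of_sq_le ?_
      rw [div_pow, hs2]; unfold Fr
      have : 0 ≤ n * (S.β l + S.e l) := by positivity
      linarith
    calc 4 / s ^ 3 * (4 * S.M * (n * (3 * l))) = 48 * S.M * ((l : ℝ) / s) := by
          rw [← hs2]; field_simp; ring
      _ ≤ _ := by gcongr
  have a2 : 4 / s ^ 3 * ((n : ℝ) ^ 2 * (3 * S.K * S.e l + 4 * S.M * S.β l)) ≤
      4 * (3 * S.K + 4 * S.M) * S.Fr n l := by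
    have e1 : 4 / s ^ 3 * ((n : ℝ) ^ 2 * (3 * S.K * S.e l + 4 * S.M * S.β l)) =
      4 * (s * (3 * S.K * S.e l + 4 * S.M * S.β l)) := by
      rw [← hs2]; field_simp
    rw [e1, mul_assoc]
    have e2 : s * (3 * S.K * S.e l + 4 * S.M * S.β l) ≤ s * ((3 * S.K + 4 * S.M) * (S.β l + S.e l)) := by
      gcongr; nlinarith [mul_nonneg hK hb, mul_nonneg hM he]
    have e3 : s * ((3 * S.K + 4 * S.M) * (S.β l + S.e l)) ≤ s ^ 2 * ((3 * S.K + 4 * S.M) * (S.β l + S.e l)) := by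
      gcongr; nlinarith
    have e4 : s ^ 2 * ((3 * S.K + 4 * S.M) * (S.β l + S.e l)) ≤ (3 * S.K + 4 * S.M) * S.Fr n l := by
      unfold Fr; rw [hs2]
      have : 0 ≤ (3 * S.K + 4 * S.M) * ((l : ℝ) ^ 2 / n) := by positivity
      nlinarith
    linarith
  have a3 : 4 / s ^ 3 * Real.sqrt ((n : ℝ) ^ 4 * S.ρ l + 16 * S.M ^ 2 * ((n : ℝ) ^ 2 * (6 * l) ^ 2)) ≤
      4 * Real.sqrt C2 * Real.sqrt (S.Fr n l) := by
    have : Real.sqrt ((n : ℝ) ^ 4 * S.ρ l + 16 * S.M ^ 2 * ((n : ℝ) ^ 2 * (6 * l) ^ 2)) ≤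
        s ^ 3 * Real.sqrt (C2 * S.Fr n l) := by
      rw [Real.sqrt_le_left (by positivity), mul_pow (s ^ 3), Real.sq_sqrt (by positivity)]
      have e1 : (s ^ 3) ^ 2 * (C2 * S.Fr n l) = C2 * (s ^ 4 * (l : ℝ) ^ 2 + s ^ 8 * (S.β l + S.e l)) := by
        unfold Fr; rw [← hs2]; field_simp
      rw [e1, ← hs2]
      unfold ρ
      have b1 : 0 ≤ s ^ 4 * (l : ℝ) ^ 2 * (12 * S.M * S.K + 64 * S.M ^ 2) := by positivity
      have b2 : 0 ≤ s ^ 8 * S.β l * (12 * S.M * S.K + 576 * S.M ^ 2) := by positivity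
      have b3 : 0 ≤ s ^ 8 * S.e l * (640 * S.M ^ 2) := by positivity
      rw [hC2]
      nlinarith
    rw [Real.sqrt_mul hC20] at this
    calc _ ≤ 4 / s ^ 3 * (s ^ 3 * (Real.sqrt C2 * Real.sqrt (S.Fr n l))) := by gcongr
      _ = _ := by field_simp
  have p1 : 0 ≤ Real.sqrt (S.Fr n l) := Real.sqrt_nonneg _
  have p2 : 0 ≤ Real.sqrt C2 := Real.sqrt_nonneg _
  rw [mul_add, mul_add]
  have q1 : 0 ≤ S.M * S.Fr n l := by positivity
  have q2 : 0 ≤ Real.sqrt C2 * S.Fr n l := by positivity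
  have q3 : 0 ≤ (3 * S.K + 4 * S.M) * Real.sqrt (S.Fr n l) := by positivity
  nlinarith

end Setup
end UQuantile


namespace UQuantile
namespace Setup
variable {Ω : Type*} [MeasurableSpace Ω] {P : Measure Ω} (S : Setup P) [IsProbabilityMeasure P]

/-- summands of the linear part -/
def W (i : ℕ) (ω : Ω) : ℝ := S.g1 (S.X ((i : ℤ) + 1) ω)
/-- partial sums -/
def T (j : ℕ) (ω : Ω) : ℝ := ∑ i ∈ Finset.range j, S.W i ω
/-- autocovariances -/
def cz (r : ℤ) : ℝ := ∫ ω, S.g1 (S.X 0 ω) * S.g1 (S.X r ω) ∂P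

lemma W_m (i : ℕ) : Measurable (S.W i) := S.g1_m.comp (S.hX _)
lemma W_bd (i : ℕ) (ω : Ω) : |S.W i ω| ≤ S.M := S.g1_bd _
lemma T_m (j : ℕ) : Measurable (S.T j) := Finset.measurable_fun_sum _ fun i _ => S.W_m i
lemma T_bd (j : ℕ) (ω : Ω) : |S.T j ω| ≤ j * S.M := by
  refine (Finset.abs_sum_le_sum_abs _ _).trans ((Finset.sum_le_sum fun i _ => S.W_bd i ω).trans ?_)
  simp
lemma W_mean (i : ℕ) : ∫ ω, S.W i ω ∂P = 0 := S.g1_meanX _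

lemma cz_stat (i j : ℤ) : ∫ ω, S.g1 (S.X i ω) * S.g1 (S.X j ω) ∂P = S.cz (j - i) := by
  have hg := S.g1_m
  have h := map_shift P S.X S.Z S.hX S.hZ S.hst i
    (fun z => S.g1 (z 0).1 * S.g1 (z (j - i)).1) (by fun_prop)
  have hX := S.hX
  have h' := congrArg (fun ν => ∫ x, x ∂ν) h
  simp only at h'
  rw [integral_map (by fun_prop) (by fun_prop), integral_map (by fun_prop) (by fun_prop)] at h'
  simp only [zero_add, sub_add_cancel] at h'
  exact h'.symm

lemma cz_neg (r : ℤ) : S.cz (-r) = S.cz r := by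
  rw [← zero_sub, ← S.cz_stat r 0]; unfold cz; simp_rw [mul_comm]

lemma W_cov (i j : ℕ) : ∫ ω, S.W i ω * S.W j ω ∂P = S.cz ((j : ℤ) - i) := by
  have := S.cz_stat ((i : ℤ) + 1) ((j : ℤ) + 1)
  rw [add_sub_add_right_eq_sub] at this
  exact this

lemma mul_close (A A' V V' : Ω → ℝ) (hA : Measurable A) (hA' : Measurable A')
    (hV : Measurable V) (hV' : Measurable V') (a v α γ : ℝ) (hAa' : ∀ ω, |A' ω| ≤ a)
    (hAa : ∀ ω, |A ω| ≤ a)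
    (hVv : ∀ ω, |V ω| ≤ v) (hVv' : ∀ ω, |V' ω| ≤ v) (hα : ∫ ω, |A' ω - A ω| ∂P ≤ α)
    (hγ : ∫ ω, |V' ω - V ω| ∂P ≤ γ) (ha : 0 ≤ a) (hv : 0 ≤ v) :
    |∫ ω, A ω * V ω ∂P - ∫ ω, A' ω * V' ω ∂P| ≤ v * α + a * γ := by
  have ib : ∀ (A V : Ω → ℝ), Measurable A → Measurable V → (∀ ω, |A ω| ≤ a) → (∀ ω, |V ω| ≤ v) →
      Integrable (fun ω => A ω * V ω) P := fun A V hA hV h1 h2 =>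
    intb (hA.mul hV) (a * v) fun ω => by
      rw [abs_mul]; exact mul_le_mul (h1 ω) (h2 ω) (abs_nonneg _) ha
  rw [← integral_sub (ib A V hA hV hAa hVv) (ib A' V' hA' hV' hAa' hVv')]
  refine abs_integral_le_integral_abs.trans ?_
  have i1 := (int_abs_sub P hA' hA hAa' hAa).const_mul v
  have i2 := (int_abs_sub P hV' hV hVv' hVv).const_mul a
  calc ∫ ω, |A ω * V ω - A' ω * V' ω| ∂P ≤ ∫ ω, (v * |A' ω - A ω| + a * |V' ω - V ω|) ∂P := by
        refine integral_mono_of_nonneg (ae_of_all _ fun _ => abs_nonneg _) (i1.add i2)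
          (ae_of_all _ fun ω => ?_)
        show |A ω * V ω - A' ω * V' ω| ≤ v * |A' ω - A ω| + a * |V' ω - V ω|
        have : A ω * V ω - A' ω * V' ω = -(V ω * (A' ω - A ω)) - A' ω * (V' ω - V ω) := by ring
        rw [this]
        refine (abs_sub _ _).trans ?_
        rw [abs_neg, abs_mul, abs_mul]
        exact add_le_add (mul_le_mul_of_nonneg_right (hVv ω) (abs_nonneg _))
          (mul_le_mul_of_nonneg_right (hAa' ω) (abs_nonneg _))
    _ = v * ∫ ω, |A' ω - A ω| ∂P + a * ∫ ω, |V' ω - V ω| ∂P := by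
        rw [integral_add i1 i2, integral_const_mul, integral_const_mul]
    _ ≤ _ := add_le_add (mul_le_mul_of_nonneg_left hα hv) (mul_le_mul_of_nonneg_left hγ ha)

lemma decoup (l : ℕ) (s : ℤ) (A A' V V' : Ω → ℝ) (hA : Measurable A)
    (hV : Measurable V) (hAp : Measurable[pastS S.Z s] A') (hVf : Measurable[futS S.Z (s + l)] V')
    (a v α γ : ℝ) (hAa' : ∀ ω, |A' ω| ≤ a) (hAa : ∀ ω, |A ω| ≤ a)
    (hVv : ∀ ω, |V ω| ≤ v) (hVv' : ∀ ω, |V' ω| ≤ v) (hα : ∫ ω, |A' ω - A ω| ∂P ≤ α)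
    (hγ : ∫ ω, |V' ω - V ω| ∂P ≤ γ) (ha : 0 ≤ a) (hv : 0 ≤ v) :
    |∫ ω, A ω * V ω ∂P - (∫ ω, A ω ∂P) * ∫ ω, V ω ∂P| ≤ 4 * (a * v) * S.β l + 2 * (v * α + a * γ) := by
  have hA' : Measurable A' := hAp.mono (pastS_le S.Z S.hZ _) le_rfl
  have hV' : Measurable V' := hVf.mono (futS_le S.Z S.hZ _) le_rfl
  have h1 := mix_cov_real P S.X S.Z S.hX S.hZ S.hst S.β S.hβ s l A' V' hAp hVf a v hAa' hVv' ha
  have h2 := mul_close A A' V V' hA hA' hV hV' a v α γ hAa' hAa hVv hVv' hα hγ ha hv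
  have bd : ∀ (B : Ω → ℝ) (b : ℝ), (∀ ω, |B ω| ≤ b) → |∫ ω, B ω ∂P| ≤ b := fun B b hB => by
    have := norm_integral_le_of_norm_le_const (μ := P) (f := B) (C := b) (ae_of_all _ hB)
    simpa using this
  have sb : ∀ (B B' : Ω → ℝ) (b η : ℝ), Measurable B → Measurable B' → (∀ ω, |B ω| ≤ b) →
      (∀ ω, |B' ω| ≤ b) → ∫ ω, |B' ω - B ω| ∂P ≤ η → |∫ ω, B' ω ∂P - ∫ ω, B ω ∂P| ≤ η :=
    fun B B' b η hB hB' hb hb' h => by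
      rw [← integral_sub (intb hB' b hb') (intb hB b hb)]
      exact abs_integral_le_integral_abs.trans h
  have h3 : |(∫ ω, A' ω ∂P) * (∫ ω, V' ω ∂P) - (∫ ω, A ω ∂P) * ∫ ω, V ω ∂P| ≤ v * α + a * γ := by
    have e : (∫ ω, A' ω ∂P) * (∫ ω, V' ω ∂P) - (∫ ω, A ω ∂P) * ∫ ω, V ω ∂P =
      (∫ ω, V ω ∂P) * ((∫ ω, A' ω ∂P) - ∫ ω, A ω ∂P) +
        (∫ ω, A' ω ∂P) * ((∫ ω, V' ω ∂P) - ∫ ω, V ω ∂P) := by ring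
    rw [e]
    refine (abs_add_le _ _).trans ?_
    rw [abs_mul, abs_mul]
    exact add_le_add (mul_le_mul (bd V v hVv) (sb A A' a α hA hA' hAa hAa' hα) (abs_nonneg _) hv)
      (mul_le_mul (bd A' a hAa') (sb V V' v γ hV hV' hVv hVv' hγ) (abs_nonneg _) ha)
  have h1' := abs_le.1 h1; have h2' := abs_le.1 h2; have h3' := abs_le.1 h3
  rw [abs_le]; constructor <;> linarith

lemma cz_bound (l : ℕ) (hl : 1 ≤ l) (r : ℤ) (hr : 3 * (l : ℤ) ≤ r) :
    |S.cz r| ≤ 4 * S.M ^ 2 * S.β l + 4 * S.M * S.K * S.e l := by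
  have h := S.decoup l (l : ℤ) (fun ω => S.g1 (S.X 0 ω)) (fun ω => S.g1 (S.Y l 0 ω))
    (fun ω => S.g1 (S.X r ω)) (fun ω => S.g1 (S.Y l r ω)) (S.g1_m.comp (S.hX _))
    (S.g1_m.comp (S.hX _)) (S.g1_m.comp (S.mY_past l 0 _ (by linarith)))
    (S.g1_m.comp (S.mY_fut l r _ (by linarith))) S.M S.M _ _ (fun _ => S.g1_bd _)
    (fun _ => S.g1_bd _) (fun _ => S.g1_bd _) (fun _ => S.g1_bd _)
    (S.g1_approx l hl 0) (S.g1_approx l hl r) S.M0 S.M0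
  rw [S.g1_meanX, zero_mul, sub_zero] at h
  refine h.trans (le_of_eq (by ring))

lemma summable_div3 (f : ℕ → ℝ) (hf : ∀ k, 0 ≤ f k) (hs : Summable f) :
    Summable fun r : ℕ => f (r / 3) := by
  refine summable_of_sum_range_le (c := 3 * ∑' k, f k) (fun r => hf _) fun n => ?_
  have h3 : ∀ N : ℕ, ∑ r ∈ Finset.range (3 * N), f (r / 3) = 3 * ∑ k ∈ Finset.range N, f k := by
    intro N
    induction N with
    | zero => simp
    | succ N ih =>
      rw [show 3 * (N + 1) = 3 * N + 1 + 1 + 1 by ring, Finset.sum_range_succ, Finset.sum_range_succ,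
        Finset.sum_range_succ, ih, Finset.sum_range_succ]
      have e1 : 3 * N / 3 = N := by omega
      have e2 : (3 * N + 1) / 3 = N := by omega
      have e3 : (3 * N + 1 + 1) / 3 = N := by omega
      rw [e1, e2, e3]; ring
  calc ∑ r ∈ Finset.range n, f (r / 3) ≤ ∑ r ∈ Finset.range (3 * n), f (r / 3) :=
        Finset.sum_le_sum_of_subset_of_nonneg (Finset.range_mono (by omega)) fun _ _ _ => hf _
    _ = 3 * ∑ k ∈ Finset.range n, f k := h3 n
    _ ≤ _ := by
      have := hs.sum_le_tsum (Finset.range n) (fun i _ => hf i)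
      linarith

lemma cz_summable (hβ : Summable S.β) : Summable S.cz := by
  have he : Summable S.e := by
    have := (Real.summable_nat_pow_inv (p := 3)).2 (by norm_num)
    refine this.congr fun l => ?_
    unfold e; rw [inv_pow]
  have he0 : ∀ k, 0 ≤ S.e k := fun k => by unfold e; positivity
  have hM := S.M0; have hK := S.K0
  have hs := summable_div3 (fun l => 4 * S.M ^ 2 * S.β l + 4 * S.M * S.K * S.e l)
    (fun k => by have := S.β0 k; have := he0 k; positivity)
    ((hβ.mul_left _).add (he.mul_left _))
  have hn : Summable fun n : ℕ => S.cz (n : ℤ) := by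
    refine Summable.of_norm_bounded_eventually_nat hs ?_
    filter_upwards [eventually_ge_atTop 3] with r hr
    rw [Real.norm_eq_abs]
    exact S.cz_bound (r / 3) (by omega) _ (by omega)
  exact Summable.of_nat_of_neg hn (by simp_rw [S.cz_neg]; exact hn)

/-- sum of absolute covariances -/
def B : ℝ := ∑' r : ℤ, |S.cz r|

lemma B0 : 0 ≤ S.B := tsum_nonneg fun _ => abs_nonneg _

lemma T_add (a q : ℕ) (ω : Ω) : S.T (a + q) ω = S.T a ω + ∑ r ∈ Finset.range q, S.W (a + r) ω :=
  Finset.sum_range_add _ _ _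

lemma var_bound (hβ : Summable S.β) (a q : ℕ) :
    ∫ ω, (S.T (a + q) ω - S.T a ω) ^ 2 ∂P ≤ q * S.B := by
  simp_rw [S.T_add, add_sub_cancel_left, pow_two, Finset.sum_mul_sum]
  have hintg : ∀ i j, Integrable (fun ω => S.W i ω * S.W j ω) P := fun i j =>
    intb ((S.W_m i).mul (S.W_m j)) (S.M * S.M) fun ω => by
      rw [abs_mul]; exact mul_le_mul (S.W_bd _ _) (S.W_bd _ _) (abs_nonneg _) S.M0
  rw [integral_finset_sum _ fun p _ => integrable_finset_sum _ fun q _ => hintg _ _]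
  simp_rw [integral_finset_sum _ fun q _ => hintg _ _, S.W_cov]
  have : ∀ i ∈ Finset.range q, ∑ j ∈ Finset.range q, S.cz (((a + j : ℕ) : ℤ) - (a + i : ℕ)) ≤ S.B := by
    intro i _
    refine (Finset.sum_le_sum fun j _ => le_abs_self _).trans ?_
    have hinj : Set.InjOn (fun j : ℕ => ((a + j : ℕ) : ℤ) - (a + i : ℕ)) (Finset.range q) := by
      intro x _ y _ h; simp only at h; omega
    rw [← Finset.sum_image (f := fun r => |S.cz r|) hinj]
    exact (S.cz_summable hβ).abs.sum_le_tsum _ fun _ _ => abs_nonneg _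
  refine (Finset.sum_le_sum this).trans ?_
  simp

end Setup
end UQuantile


namespace UQuantile

/-- `exp(ix)` -/
def ex (x : ℝ) : ℂ := Complex.exp (x * Complex.I)

lemma ex_add (x y : ℝ) : ex (x + y) = ex x * ex y := by
  unfold ex; rw [← Complex.exp_add]; push_cast; ring_nf

lemma ex_zero : ex 0 = 1 := by simp [ex]

lemma ex_norm (x : ℝ) : ‖ex x‖ = 1 := Complex.norm_exp_ofReal_mul_I x

lemma ex_m : Measurable ex := by unfold ex; fun_prop

lemma ex_1 (x : ℝ) : ‖ex x - 1‖ ≤ |x| := by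
  have := Real.norm_exp_I_mul_ofReal_sub_one_le (x := x)
  rw [mul_comm] at this; exact this

lemma ex_2 (x : ℝ) : ‖ex x - 1 - x * Complex.I‖ ≤ 3 * |x| ^ 2 := by
  rcases le_total |x| 1 with h | h
  · have h1 := Complex.norm_exp_sub_sum_le_norm_mul_exp (x * Complex.I) 2
    have hn : ‖(x : ℂ) * Complex.I‖ = |x| := by simp
    rw [hn] at h1
    have h2 : Real.exp |x| ≤ 3 := (Real.exp_le_exp.2 h).trans (by
      have := Real.exp_one_lt_d9; linarith)
    simp [Finset.sum_range_succ] at h1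
    have h3 : ex x - 1 - x * Complex.I = Complex.exp (x * Complex.I) - (1 + x * Complex.I) := by
      unfold ex; ring
    rw [h3]
    have : x ^ 2 * Real.exp |x| ≤ 3 * |x| ^ 2 := by rw [← sq_abs]; nlinarith [sq_nonneg |x|]
    exact h1.trans this
  · calc ‖ex x - 1 - x * Complex.I‖ ≤ ‖ex x - 1‖ + ‖x * Complex.I‖ := norm_sub_le _ _
      _ ≤ |x| + |x| := by
        refine add_le_add (ex_1 x) (by simp)
      _ ≤ _ := by nlinarith

lemma ex_3 (x : ℝ) : ‖ex x - 1 - x * Complex.I + x ^ 2 / 2‖ ≤ 4 * |x| ^ 3 := by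
  rcases le_total |x| 1 with h | h
  · have h1 := Complex.norm_exp_sub_sum_le_norm_mul_exp (x * Complex.I) 3
    have hn : ‖(x : ℂ) * Complex.I‖ = |x| := by simp
    rw [hn] at h1
    have h2 : Real.exp |x| ≤ 3 := (Real.exp_le_exp.2 h).trans (by
      have := Real.exp_one_lt_d9; linarith)
    have h3 : ex x - 1 - x * Complex.I + x ^ 2 / 2 = Complex.exp (x * Complex.I) -
        ∑ m ∈ Finset.range 3, (x * Complex.I) ^ m / (m.factorial : ℂ) := by
      simp [Finset.sum_range_succ, ex, mul_pow, Nat.factorial]; ring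
    rw [h3]
    refine h1.trans ?_
    have : 0 ≤ |x| ^ 3 := by positivity
    nlinarith
  · calc ‖ex x - 1 - x * Complex.I + x ^ 2 / 2‖ ≤ ‖ex x - 1 - x * Complex.I‖ + ‖(x : ℂ) ^ 2 / 2‖ :=
          norm_add_le _ _
      _ ≤ 3 * |x| ^ 2 + |x| ^ 2 := by
        refine add_le_add (ex_2 x) ?_
        simp
        nlinarith [sq_nonneg x]
      _ ≤ _ := by nlinarith [sq_nonneg |x|]

lemma ex_sub (x y : ℝ) : ‖ex (x + y) - ex x‖ ≤ |y| := by
  rw [ex_add, ← mul_sub_one, norm_mul, ex_norm, one_mul]; exact ex_1 y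

lemma ex_step (τ d1 d2 u : ℝ) :
    ‖ex (τ + d1 + d2 + u) - ex (τ + d1 + d2) - (Complex.I * u * ex (τ + d1) - u * d2 * ex τ -
      u ^ 2 / 2 * ex τ)‖ ≤ 4 * |u| ^ 3 + 3 * |u| * |d2| ^ 2 + |u| * |d2| * |d1| +
        |u| ^ 2 * |d1 + d2| := by
  have key : ex (τ + d1 + d2 + u) - ex (τ + d1 + d2) - (Complex.I * u * ex (τ + d1) - u * d2 * ex τ -
      u ^ 2 / 2 * ex τ) =
      ex (τ + d1 + d2) * (ex u - 1 - u * Complex.I + u ^ 2 / 2) +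
      ex (τ + d1) * (u * Complex.I) * (ex d2 - 1 - d2 * Complex.I) -
      u * d2 * (ex (τ + d1) - ex τ) - u ^ 2 / 2 * (ex (τ + d1 + d2) - ex τ) := by
    rw [ex_add (τ + d1 + d2) u, ex_add (τ + d1) d2]
    linear_combination (ex (τ + d1) * u * d2) * Complex.I_sq
  rw [key]
  have n1 : ‖ex (τ + d1 + d2) * (ex u - 1 - u * Complex.I + u ^ 2 / 2)‖ ≤ 4 * |u| ^ 3 := by
    rw [norm_mul, ex_norm, one_mul]; exact ex_3 u
  have n2 : ‖ex (τ + d1) * (u * Complex.I) * (ex d2 - 1 - d2 * Complex.I)‖ ≤ 3 * |u| * |d2| ^ 2 := by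
    rw [norm_mul, norm_mul, ex_norm, one_mul]
    have : ‖(u : ℂ) * Complex.I‖ = |u| := by simp
    rw [this]
    nlinarith [ex_2 d2, abs_nonneg u]
  have n3 : ‖(u : ℂ) * d2 * (ex (τ + d1) - ex τ)‖ ≤ |u| * |d2| * |d1| := by
    rw [norm_mul, norm_mul]
    simp only [Complex.norm_real, Real.norm_eq_abs]
    exact mul_le_mul_of_nonneg_left (ex_sub _ _) (by positivity)
  have n4 : ‖(u : ℂ) ^ 2 / 2 * (ex (τ + d1 + d2) - ex τ)‖ ≤ |u| ^ 2 * |d1 + d2| := by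
    rw [norm_mul, add_assoc]
    refine mul_le_mul ?_ (ex_sub _ _) (norm_nonneg _) (by positivity)
    simp
    nlinarith [sq_nonneg u]
  refine (norm_sub_le _ _).trans (add_le_add ((norm_sub_le _ _).trans
    (add_le_add ((norm_add_le _ _).trans (add_le_add n1 n2)) n3)) n4)

namespace Setup
variable {Ω : Type*} [MeasurableSpace Ω] {P : Measure Ω} (S : Setup P) [IsProbabilityMeasure P]

/-- characteristic function of partial sums -/
def φ (s : ℝ) (j : ℕ) : ℂ := ∫ ω, ex (s * S.T j ω) ∂P

lemma intc {ν : Measure Ω} [IsFiniteMeasure ν] {g : Ω → ℂ}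
    (hg : Measurable g) (C : ℝ) (hC : ∀ s, ‖g s‖ ≤ C) : Integrable g ν :=
  Integrable.of_bound (C := C) hg.aestronglyMeasurable (ae_of_all _ hC)

lemma exT_m (s : ℝ) (j : ℕ) : Measurable fun ω => ex (s * S.T j ω) :=
  ex_m.comp ((S.T_m j).const_mul s)

lemma exV_int (s : ℝ) (j : ℕ) (V : Ω → ℝ) (hV : Measurable V) (v : ℝ) (hv : ∀ ω, |V ω| ≤ v) :
    Integrable (fun ω => ex (s * S.T j ω) * (V ω : ℂ)) P :=
  intc ((S.exT_m s j).mul (Complex.measurable_ofReal.comp hV)) v fun ω => by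
    rw [norm_mul, ex_norm, one_mul, Complex.norm_real]; exact hv ω

lemma ex_int (s : ℝ) (j : ℕ) : Integrable (fun ω => ex (s * S.T j ω)) P :=
  intc (S.exT_m s j) 1 fun ω => (ex_norm _).le

/-- windowed partial sums -/
def TY (l j : ℕ) (ω : Ω) : ℝ := ∑ i ∈ Finset.range j, S.g1 (S.Y l ((i : ℤ) + 1) ω)

lemma TY_past (l j : ℕ) : Measurable[pastS S.Z ((j : ℤ) + l)] (S.TY l j) := by
  refine @Finset.measurable_fun_sum ℝ ℕ Ω _ _ _ (pastS S.Z ((j : ℤ) + l)) _ _ fun i hi => ?_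
  have := Finset.mem_range.1 hi
  exact S.g1_m.comp (S.mY_past l _ _ (by omega))

lemma TY_close (l : ℕ) (hl : 1 ≤ l) (j : ℕ) : ∫ ω, |S.TY l j ω - S.T j ω| ∂P ≤ j * (S.K * S.e l) := by
  have hY := S.mY l; have hX := S.hX; have hg := S.g1_m
  have hi : ∀ i : ℕ, Integrable (fun ω => |S.g1 (S.Y l ((i : ℤ) + 1) ω) - S.g1 (S.X ((i : ℤ) + 1) ω)|) P :=
    fun i => int_abs_sub P (C := S.M) (by fun_prop) (by fun_prop) (fun _ => S.g1_bd _) (fun _ => S.g1_bd _)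
  calc ∫ ω, |S.TY l j ω - S.T j ω| ∂P ≤ ∫ ω, ∑ i ∈ Finset.range j,
        |S.g1 (S.Y l ((i : ℤ) + 1) ω) - S.g1 (S.X ((i : ℤ) + 1) ω)| ∂P := by
        refine integral_mono_of_nonneg (ae_of_all _ fun _ => abs_nonneg _)
          (integrable_finset_sum _ fun i _ => hi i) (ae_of_all _ fun ω => ?_)
        show |S.TY l j ω - S.T j ω| ≤ _
        unfold TY T
        rw [← Finset.sum_sub_distrib]
        exact Finset.abs_sum_le_sum_abs _ _
    _ = ∑ i ∈ Finset.range j, ∫ ω, |S.g1 (S.Y l ((i : ℤ) + 1) ω) - S.g1 (S.X ((i : ℤ) + 1) ω)| ∂P :=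
        integral_finset_sum _ fun i _ => hi i
    _ ≤ ∑ i ∈ Finset.range j, S.K * S.e l := Finset.sum_le_sum fun i _ => S.g1_approx l hl _
    _ = _ := by simp

lemma rdecoup (ψ : ℝ → ℝ) (hψm : Measurable ψ) (hψ1 : ∀ x, |ψ x| ≤ 1)
    (hψL : ∀ x y, |ψ x - ψ y| ≤ |x - y|) (l : ℕ) (hl : 1 ≤ l) (s : ℝ) (b : ℕ) (V V' : Ω → ℝ)
    (hV : Measurable V) (hVf : Measurable[futS S.Z ((b : ℤ) + l + l)] V')
    (v γ : ℝ) (hVv : ∀ ω, |V ω| ≤ v) (hVv' : ∀ ω, |V' ω| ≤ v)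
    (hγ : ∫ ω, |V' ω - V ω| ∂P ≤ γ) (hv : 0 ≤ v) :
    |∫ ω, ψ (s * S.T b ω) * V ω ∂P - (∫ ω, ψ (s * S.T b ω) ∂P) * ∫ ω, V ω ∂P| ≤
      4 * v * S.β l + 2 * (v * (|s| * (b * (S.K * S.e l))) + γ) := by
  have hp := S.TY_past l b
  have hTYm : Measurable (S.TY l b) := hp.mono (pastS_le S.Z S.hZ _) le_rfl
  have hp' : Measurable[pastS S.Z ((b : ℤ) + l)] fun ω => ψ (s * S.TY l b ω) :=
    (hψm.comp (measurable_const_mul s)).comp hp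
  have hTb : ∀ ω, |S.TY l b ω| ≤ b * S.M := fun ω => by
    refine (Finset.abs_sum_le_sum_abs _ _).trans ((Finset.sum_le_sum fun i _ => S.g1_bd _).trans ?_)
    simp
  have h := S.decoup l ((b : ℤ) + l) (fun ω => ψ (s * S.T b ω)) (fun ω => ψ (s * S.TY l b ω)) V V'
    (hψm.comp ((S.T_m b).const_mul s)) hV hp' hVf 1 v (|s| * (b * (S.K * S.e l))) γ
    (fun _ => hψ1 _) (fun _ => hψ1 _) hVv hVv' ?_ hγ zero_le_one hv
  · refine h.trans (le_of_eq (by ring))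
  · calc ∫ ω, |ψ (s * S.TY l b ω) - ψ (s * S.T b ω)| ∂P ≤ ∫ ω, |s| * |S.TY l b ω - S.T b ω| ∂P := by
          refine integral_mono_of_nonneg (ae_of_all _ fun _ => abs_nonneg _)
            ((int_abs_sub P hTYm (S.T_m b) hTb (S.T_bd b)).const_mul _) (ae_of_all _ fun ω => ?_)
          refine (hψL _ _).trans (le_of_eq ?_)
          rw [← mul_sub, abs_mul]
      _ = |s| * ∫ ω, |S.TY l b ω - S.T b ω| ∂P := integral_const_mul _ _
      _ ≤ _ := mul_le_mul_of_nonneg_left (S.TY_close l hl b) (abs_nonneg _)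

lemma int_split (u v : Ω → ℝ) (hu : Integrable u P) (hv : Integrable v P) :
    ∫ ω, ((u ω : ℂ) + v ω * Complex.I) ∂P = ((∫ ω, u ω ∂P : ℝ) : ℂ) + ((∫ ω, v ω ∂P : ℝ) : ℂ) * Complex.I := by
  have hu' : Integrable (fun ω => (u ω : ℂ)) P := hu.ofReal
  have hv' : Integrable (fun ω => (v ω : ℂ)) P := hv.ofReal
  rw [integral_add hu' (hv'.mul_const _), integral_mul_const]
  congr 1
  · exact integral_ofReal
  · congr 1; exact integral_ofReal

lemma cdecoup (l : ℕ) (hl : 1 ≤ l) (s : ℝ) (b : ℕ) (V V' : Ω → ℝ)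
    (hV : Measurable V) (hVf : Measurable[futS S.Z ((b : ℤ) + l + l)] V')
    (v γ : ℝ) (hVv : ∀ ω, |V ω| ≤ v) (hVv' : ∀ ω, |V' ω| ≤ v)
    (hγ : ∫ ω, |V' ω - V ω| ∂P ≤ γ) (hv : 0 ≤ v) :
    ‖∫ ω, ex (s * S.T b ω) * (V ω : ℂ) ∂P - S.φ s b * ((∫ ω, V ω ∂P : ℝ) : ℂ)‖ ≤
      2 * (4 * v * S.β l + 2 * (v * (|s| * (b * (S.K * S.e l))) + γ)) := by
  have hc := S.rdecoup Real.cos Real.measurable_cos Real.abs_cos_le_one Real.abs_cos_sub_cos_le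
    l hl s b V V' hV hVf v γ hVv hVv' hγ hv
  have hs := S.rdecoup Real.sin Real.measurable_sin Real.abs_sin_le_one Real.abs_sin_sub_sin_le
    l hl s b V V' hV hVf v γ hVv hVv' hγ hv
  have mT : Measurable fun ω => s * S.T b ω := (S.T_m b).const_mul s
  have mc := Real.measurable_cos.comp mT
  have ms := Real.measurable_sin.comp mT
  have ic : Integrable (fun ω => Real.cos (s * S.T b ω)) P := intb mc 1 fun _ => Real.abs_cos_le_one _
  have is : Integrable (fun ω => Real.sin (s * S.T b ω)) P := intb ms 1 fun _ => Real.abs_sin_le_one _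
  have icV : Integrable (fun ω => Real.cos (s * S.T b ω) * V ω) P := intb (mc.mul hV) (1 * v) fun ω => by
    rw [abs_mul]; exact mul_le_mul (Real.abs_cos_le_one _) (hVv ω) (abs_nonneg _) zero_le_one
  have isV : Integrable (fun ω => Real.sin (s * S.T b ω) * V ω) P := intb (ms.mul hV) (1 * v) fun ω => by
    rw [abs_mul]; exact mul_le_mul (Real.abs_sin_le_one _) (hVv ω) (abs_nonneg _) zero_le_one
  have hex : ∀ x : ℝ, ex x = (Real.cos x : ℂ) + (Real.sin x : ℂ) * Complex.I := fun x => by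
    unfold ex; rw [Complex.exp_mul_I]; push_cast; rfl
  have e1 : ∫ ω, ex (s * S.T b ω) * (V ω : ℂ) ∂P = ((∫ ω, Real.cos (s * S.T b ω) * V ω ∂P : ℝ) : ℂ) +
      ((∫ ω, Real.sin (s * S.T b ω) * V ω ∂P : ℝ) : ℂ) * Complex.I := by
    rw [← int_split _ _ icV isV]
    refine integral_congr_ae (ae_of_all _ fun ω => ?_)
    simp only [hex]; push_cast; ring
  have e2 : S.φ s b = ((∫ ω, Real.cos (s * S.T b ω) ∂P : ℝ) : ℂ) +
      ((∫ ω, Real.sin (s * S.T b ω) ∂P : ℝ) : ℂ) * Complex.I := by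
    rw [← int_split _ _ ic is]
    exact integral_congr_ae (ae_of_all _ fun ω => hex _)
  rw [e1, e2]
  set c1 := ∫ ω, Real.cos (s * S.T b ω) * V ω ∂P
  set c2 := ∫ ω, Real.sin (s * S.T b ω) * V ω ∂P
  set d1 := ∫ ω, Real.cos (s * S.T b ω) ∂P
  set d2 := ∫ ω, Real.sin (s * S.T b ω) ∂P
  set w := ∫ ω, V ω ∂P
  have e3 : (c1 : ℂ) + c2 * Complex.I - (d1 + d2 * Complex.I) * w =
      ((c1 - d1 * w : ℝ) : ℂ) + ((c2 - d2 * w : ℝ) : ℂ) * Complex.I := by push_cast; ring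
  rw [e3]
  refine (norm_add_le _ _).trans ?_
  rw [norm_mul, Complex.norm_I, mul_one, Complex.norm_real, Complex.norm_real, Real.norm_eq_abs,
    Real.norm_eq_abs]
  linarith

/-- decoupling rate -/
def η (s : ℝ) (N l : ℕ) : ℝ :=
  16 * S.M ^ 2 * S.β l + 8 * S.M ^ 2 * S.K * (|s| * N * S.e l) + 8 * S.M * S.K * S.e l

lemma dec1 (l : ℕ) (hl : 1 ≤ l) (s : ℝ) (N b j : ℕ) (hb : b ≤ N) (hj : b + 3 * l ≤ j) :
    ‖∫ ω, ex (s * S.T b ω) * (S.W j ω : ℂ) ∂P‖ ≤ S.η s N l := by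
  have h := S.cdecoup l hl s b (S.W j) (fun ω => S.g1 (S.Y l ((j : ℤ) + 1) ω)) (S.W_m j)
    (S.g1_m.comp (S.mY_fut l _ _ (by omega))) S.M _ (S.W_bd j) (fun _ => S.g1_bd _)
    (S.g1_approx l hl _) S.M0
  rw [S.W_mean, Complex.ofReal_zero, mul_zero, sub_zero] at h
  refine h.trans ?_
  have hM := S.M0; have hM1 := S.M1; have hβ := S.β0 l; have hK := S.K0; have he := (S.e_pos l hl).le
  have hbN : (b : ℝ) ≤ N := by exact_mod_cast hb
  have hM2 : S.M ≤ S.M ^ 2 := by nlinarith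
  unfold η
  have a1 : S.M * S.β l ≤ S.M ^ 2 * S.β l := by gcongr
  have a2 : S.M * (|s| * (b * (S.K * S.e l))) ≤ S.M ^ 2 * (|s| * (N * (S.K * S.e l))) := by gcongr
  have a3 : S.K * S.e l ≤ S.M * (S.K * S.e l) := by nlinarith [mul_nonneg hK he]
  have p1 : 0 ≤ S.M ^ 2 * S.β l := by positivity
  have p2 : 0 ≤ S.M ^ 2 * (|s| * (N * (S.K * S.e l))) := by positivity
  have p3 : 0 ≤ S.M * (S.K * S.e l) := by positivity
  nlinarith

lemma dec2 (l : ℕ) (hl : 1 ≤ l) (s : ℝ) (N b k j : ℕ) (hb : b ≤ N) (hk : b + 3 * l ≤ k)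
    (hj : b + 3 * l ≤ j) :
    ‖∫ ω, ex (s * S.T b ω) * ((S.W k ω * S.W j ω : ℝ) : ℂ) ∂P - S.φ s b * (S.cz ((j : ℤ) - k) : ℂ)‖
      ≤ S.η s N l := by
  have hM := S.M0
  have hY := S.mY l; have hX := S.hX; have hg := S.g1_m
  have hk' : Measurable[futS S.Z ((b : ℤ) + l + l)] fun ω => S.g1 (S.Y l ((k : ℤ) + 1) ω) :=
    S.g1_m.comp (S.mY_fut l _ _ (by omega))
  have hj' : Measurable[futS S.Z ((b : ℤ) + l + l)] fun ω => S.g1 (S.Y l ((j : ℤ) + 1) ω) :=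
    S.g1_m.comp (S.mY_fut l _ _ (by omega))
  have hkj : Measurable[futS S.Z ((b : ℤ) + l + l)] fun ω =>
      S.g1 (S.Y l ((k : ℤ) + 1) ω) * S.g1 (S.Y l ((j : ℤ) + 1) ω) :=
    Measurable.mul hk' hj'
  have h := S.cdecoup l hl s b (fun ω => S.W k ω * S.W j ω)
    (fun ω => S.g1 (S.Y l ((k : ℤ) + 1) ω) * S.g1 (S.Y l ((j : ℤ) + 1) ω)) ((S.W_m k).mul (S.W_m j))
    hkj (S.M ^ 2)
    (S.M * (S.K * S.e l) + S.M * (S.K * S.e l))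
    (fun ω => by rw [abs_mul, pow_two]; exact mul_le_mul (S.W_bd _ _) (S.W_bd _ _) (abs_nonneg _) hM)
    (fun ω => by rw [abs_mul, pow_two]; exact mul_le_mul (S.g1_bd _) (S.g1_bd _) (abs_nonneg _) hM)
    ?_ (by positivity)
  · rw [S.W_cov] at h
    refine h.trans ?_
    have hM1 := S.M1; have hβ := S.β0 l; have hK := S.K0; have he := (S.e_pos l hl).le
    have hbN : (b : ℝ) ≤ N := by exact_mod_cast hb
    unfold η
    have a2 : S.M ^ 2 * (|s| * (b * (S.K * S.e l))) ≤ S.M ^ 2 * (|s| * (N * (S.K * S.e l))) := by gcongr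
    have p1 : 0 ≤ S.M ^ 2 * S.β l := by positivity
    have p2 : 0 ≤ S.M ^ 2 * (|s| * (N * (S.K * S.e l))) := by positivity
    nlinarith
  · have ii : ∀ i : ℤ, Integrable (fun ω => S.M * |S.g1 (S.Y l i ω) - S.g1 (S.X i ω)|) P :=
      fun i => (int_abs_sub P (C := S.M) (by fun_prop) (by fun_prop) (fun _ => S.g1_bd _)
        (fun _ => S.g1_bd _)).const_mul _
    calc _ ≤ ∫ ω, (S.M * |S.g1 (S.Y l ((k : ℤ) + 1) ω) - S.g1 (S.X ((k : ℤ) + 1) ω)| +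
          S.M * |S.g1 (S.Y l ((j : ℤ) + 1) ω) - S.g1 (S.X ((j : ℤ) + 1) ω)|) ∂P := by
          refine integral_mono_of_nonneg (ae_of_all _ fun _ => abs_nonneg _) ((ii _).add (ii _))
            (ae_of_all _ fun ω => ?_)
          show |S.g1 (S.Y l ((k : ℤ) + 1) ω) * S.g1 (S.Y l ((j : ℤ) + 1) ω) -
            S.g1 (S.X ((k : ℤ) + 1) ω) * S.g1 (S.X ((j : ℤ) + 1) ω)| ≤
            S.M * |S.g1 (S.Y l ((k : ℤ) + 1) ω) - S.g1 (S.X ((k : ℤ) + 1) ω)| +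
            S.M * |S.g1 (S.Y l ((j : ℤ) + 1) ω) - S.g1 (S.X ((j : ℤ) + 1) ω)|
          have e : ∀ a b c d : ℝ, a * b - c * d = b * (a - c) + c * (b - d) := by intros; ring
          rw [e]
          refine (abs_add_le _ _).trans ?_
          rw [abs_mul, abs_mul]
          exact add_le_add (mul_le_mul_of_nonneg_right (S.g1_bd _) (abs_nonneg _))
            (mul_le_mul_of_nonneg_right (S.g1_bd _) (abs_nonneg _))
      _ = _ := integral_add (ii _) (ii _)
      _ ≤ _ := by
        rw [integral_const_mul, integral_const_mul]
        exact add_le_add (mul_le_mul_of_nonneg_left (S.g1_approx l hl _) hM)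
          (mul_le_mul_of_nonneg_left (S.g1_approx l hl _) hM)

end Setup
end UQuantile


namespace UQuantile
namespace Setup
variable {Ω : Type*} [MeasurableSpace Ω] {P : Measure Ω} (S : Setup P) [IsProbabilityMeasure P]

/-- truncated half long-run variance -/
def vq (q : ℕ) : ℝ := S.cz 0 / 2 + ∑ r ∈ Finset.range q, S.cz ((r : ℤ) + 1)

lemma vq_bd (hβ : Summable S.β) (q : ℕ) : |S.vq q| ≤ S.B := by
  have h1 : ∑ r ∈ Finset.range (q + 1), |S.cz (r : ℤ)| ≤ S.B := by
    have hinj : Set.InjOn (fun j : ℕ => (j : ℤ)) (Finset.range (q + 1)) := by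
      intro x _ y _ h; simp only at h; omega
    rw [← Finset.sum_image (f := fun r => |S.cz r|) hinj]
    exact (S.cz_summable hβ).abs.sum_le_tsum _ fun _ _ => abs_nonneg _
  rw [Finset.sum_range_succ'] at h1
  unfold vq
  refine (abs_add_le _ _).trans ?_
  have h2 := Finset.abs_sum_le_sum_abs (fun r : ℕ => S.cz ((r : ℤ) + 1)) (Finset.range q)
  have h3 : |S.cz 0 / 2| ≤ |S.cz 0| := by
    rw [abs_div, abs_two]; linarith [abs_nonneg (S.cz 0)]
  push_cast at h1
  linarith

lemma D_int (a q : ℕ) : Integrable (fun ω => (S.T (a + q) ω - S.T a ω) ^ 2) P := by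
  have m1 := S.T_m (a + q); have m2 := S.T_m a
  refine intb (by fun_prop) ((((a + q : ℕ) : ℝ) * S.M + a * S.M) ^ 2) fun ω => ?_
  rw [abs_pow]
  exact pow_le_pow_left₀ (abs_nonneg _) ((abs_sub _ _).trans (add_le_add (S.T_bd _ _) (S.T_bd _ _))) 2

lemma φ_close (hβ : Summable S.β) (s : ℝ) (b m : ℕ) :
    ‖S.φ s (b + m) - S.φ s b‖ ≤ |s| * (1 + m * S.B) := by
  unfold φ
  rw [← integral_sub (S.ex_int s _) (S.ex_int s _)]
  calc _ ≤ ∫ ω, |s| * (1 + (S.T (b + m) ω - S.T b ω) ^ 2) ∂P := by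
        refine norm_integral_le_of_norm_le (((integrable_const _).add (S.D_int b m)).const_mul _)
          (ae_of_all _ fun ω => ?_)
        have h := ex_sub (s * S.T b ω) (s * (S.T (b + m) ω - S.T b ω))
        rw [← mul_add, add_sub_cancel] at h
        refine h.trans ?_
        rw [abs_mul]
        refine mul_le_mul_of_nonneg_left ?_ (abs_nonneg _)
        rw [← sq_abs]
        nlinarith [sq_nonneg (|S.T (b + m) ω - S.T b ω| - 1), abs_nonneg (S.T (b + m) ω - S.T b ω)]
    _ = |s| * (1 + ∫ ω, (S.T (b + m) ω - S.T b ω) ^ 2 ∂P) := by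
        rw [integral_const_mul, integral_add (integrable_const _) (S.D_int b m)]; simp
    _ ≤ _ := by
        have := S.var_bound hβ b m
        exact mul_le_mul_of_nonneg_left (by linarith) (abs_nonneg _)

lemma φ_le (s : ℝ) (j : ℕ) : ‖S.φ s j‖ ≤ 1 := by
  have := norm_integral_le_of_norm_le_const (μ := P) (f := fun ω => ex (s * S.T j ω)) (C := 1)
    (ae_of_all _ fun ω => (ex_norm _).le)
  simpa [φ] using this

lemma φ_zero (s : ℝ) : S.φ s 0 = 1 := by
  unfold φ T; simp [ex_zero]

lemma φ_triv (s : ℝ) (j : ℕ) : ‖S.φ s (j + 1) - S.φ s j‖ ≤ |s| * S.M := by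
  unfold φ
  rw [← integral_sub (S.ex_int s _) (S.ex_int s _)]
  have := norm_integral_le_of_norm_le_const (μ := P)
    (f := fun ω => ex (s * S.T (j + 1) ω) - ex (s * S.T j ω)) (C := |s| * S.M)
    (ae_of_all _ fun ω => by
      have h := ex_sub (s * S.T j ω) (s * S.W j ω)
      have e : S.T (j + 1) ω = S.T j ω + S.W j ω := Finset.sum_range_succ _ _
      rw [e, mul_add]
      refine h.trans ?_
      rw [abs_mul]
      exact mul_le_mul_of_nonneg_left (S.W_bd _ _) (abs_nonneg _))
  simpa using this

lemma int_comb (A B C D E : Ω → ℂ) (hA : Integrable A P) (hB : Integrable B P) (hC : Integrable C P)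
    (hD : Integrable D P) (hE : Integrable E P) :
    ∫ ω, A ω ∂P - ∫ ω, B ω ∂P - (∫ ω, C ω ∂P - ∫ ω, D ω ∂P - ∫ ω, E ω ∂P) =
      ∫ ω, (A ω - B ω - (C ω - D ω - E ω)) ∂P := by
  have h1 : Integrable (fun ω => A ω - B ω) P := hA.sub hB
  have h2 : Integrable (fun ω => C ω - D ω) P := hC.sub hD
  have h3 : Integrable (fun ω => C ω - D ω - E ω) P := h2.sub hE
  rw [integral_sub h1 h3, integral_sub hA hB, integral_sub h2 hE, integral_sub hC hD]

lemma int_comb2 (A B C : Ω → ℝ) (hA : Integrable A P) (hB : Integrable B P) (hC : Integrable C P) :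
    ∫ ω, (5 + (A ω + (4 * B ω + C ω))) ∂P =
      5 + (∫ ω, A ω ∂P + (4 * ∫ ω, B ω ∂P + ∫ ω, C ω ∂P)) := by
  have h1 : Integrable (fun ω => 4 * B ω) P := hB.const_mul 4
  have h2 : Integrable (fun ω => 4 * B ω + C ω) P := h1.add hC
  have h3 : Integrable (fun ω => A ω + (4 * B ω + C ω)) P := hA.add h2
  rw [integral_add (integrable_const _) h3, integral_add hA h2, integral_add h1 hC, integral_const_mul]
  simp

lemma rem_real (M w x y z : ℝ) (hM1 : 1 ≤ M) (hw0 : 0 ≤ w) (hw : w ≤ M) (hx : 0 ≤ x) (hy : 0 ≤ y)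
    (hz : 0 ≤ z) : 4 * w ^ 3 + 3 * (w * y ^ 2) + w * (y * x) + w ^ 2 * z ≤
            M ^ 3 * (5 + (x ^ 2 + (4 * y ^ 2 + z ^ 2))) := by
  have hM3 : M ≤ M ^ 3 := le_self_pow₀ hM1 (by norm_num)
  have hM32 : M ^ 2 ≤ M ^ 3 := pow_le_pow_right₀ hM1 (by norm_num)
  have w3 : w ^ 3 ≤ M ^ 3 := pow_le_pow_left₀ hw0 hw 3
  have w2 : w ^ 2 ≤ M ^ 3 := (pow_le_pow_left₀ hw0 hw 2).trans hM32
  have w1 : w ≤ M ^ 3 := hw.trans hM3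
  have t1 : w * y ^ 2 ≤ M ^ 3 * y ^ 2 := by gcongr
  have t2 : w * (y * x) ≤ M ^ 3 * (x ^ 2 + y ^ 2) :=
    mul_le_mul w1 (by nlinarith [sq_nonneg (x - y)]) (by positivity) (by positivity)
  have t3 : w ^ 2 * z ≤ M ^ 3 * (1 + z ^ 2) :=
    mul_le_mul w2 (by nlinarith [sq_nonneg (z - 1)]) (by positivity) (by positivity)
  linarith

set_option maxHeartbeats 800000 in
lemma rem_bound (hβ : Summable S.β) (s : ℝ) (b q : ℕ) :
    ‖S.φ s (b + q + q + 1) - S.φ s (b + q + q) -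
      (Complex.I * s * (∫ ω, ex (s * S.T (b + q) ω) * (S.W (b + q + q) ω : ℂ) ∂P) -
       (s : ℂ) ^ 2 * (∑ r ∈ Finset.range q, ∫ ω, ex (s * S.T b ω) *
          ((S.W (b + q + r) ω * S.W (b + q + q) ω : ℝ) : ℂ) ∂P) -
       (s : ℂ) ^ 2 / 2 * ∫ ω, ex (s * S.T b ω) *
          ((S.W (b + q + q) ω * S.W (b + q + q) ω : ℝ) : ℂ) ∂P)‖ ≤
      |s| ^ 3 * (8 * S.M ^ 3) * (1 + 2 * q * S.B) := by
  have hM := S.M0; have hM1 := S.M1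
  have iW : ∀ k, Integrable (fun ω => ex (s * S.T k ω) * (S.W (b + q + q) ω : ℂ)) P := fun k =>
    S.exV_int s k _ (S.W_m _) S.M (S.W_bd _)
  have iWW : ∀ k, Integrable (fun ω => ex (s * S.T b ω) *
          ((S.W k ω * S.W (b + q + q) ω : ℝ) : ℂ)) P := fun k =>
    S.exV_int s b _ ((S.W_m _).mul (S.W_m _)) (S.M * S.M) fun ω => by
      rw [abs_mul]; exact mul_le_mul (S.W_bd _ _) (S.W_bd _ _) (abs_nonneg _) hM
  have iS : Integrable (fun ω => ∑ r ∈ Finset.range q, ex (s * S.T b ω) *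
          ((S.W (b + q + r) ω * S.W (b + q + q) ω : ℝ) : ℂ)) P :=
    integrable_finset_sum _ fun r _ => iWW _
  rw [← integral_finset_sum _ fun r _ => iWW _]
  unfold φ
  rw [← integral_const_mul, ← integral_const_mul, ← integral_const_mul,
    int_comb _ _ _ _ _ (S.ex_int s _) (S.ex_int s _) ((iW _).const_mul _) (iS.const_mul _)
      ((iWW _).const_mul _)]
  have d1 := S.D_int b q
  have d2 := S.D_int (b + q) q
  have d3 := S.D_int b (q + q)
  have v1 := S.var_bound hβ b q
  have v2 := S.var_bound hβ (b + q) q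
  have v3 := S.var_bound hβ b (q + q)
  rw [← add_assoc] at d3 v3
  set c := |s| ^ 3 * S.M ^ 3 with hc
  have hc0 : 0 ≤ c := by positivity
  calc _ ≤ ∫ ω, c * (5 + ((S.T (b + q) ω - S.T b ω) ^ 2 + (4 * (S.T (b + q + q) ω - S.T (b + q) ω) ^ 2
          + (S.T (b + q + q) ω - S.T b ω) ^ 2))) ∂P := by
        refine norm_integral_le_of_norm_le (((integrable_const _).add
          (d1.add ((d2.const_mul _).add d3))).const_mul _) (ae_of_all _ fun ω => ?_)
        have e1 : S.T (b + q + q) ω - S.T (b + q) ω = ∑ r ∈ Finset.range q, S.W (b + q + r) ω := by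
          rw [S.T_add (b + q) q]; ring
        have e2 : S.T (b + q + q + 1) ω = S.T (b + q + q) ω + S.W (b + q + q) ω :=
          Finset.sum_range_succ _ _
        have h := ex_step (s * S.T b ω) (s * (S.T (b + q) ω - S.T b ω))
          (s * (S.T (b + q + q) ω - S.T (b + q) ω)) (s * S.W (b + q + q) ω)
        have f1 : s * S.T b ω + s * (S.T (b + q) ω - S.T b ω) = s * S.T (b + q) ω := by ring
        have f2 : s * S.T (b + q) ω + s * (S.T (b + q + q) ω - S.T (b + q) ω) =
          s * S.T (b + q + q) ω := by ring
        have f3 : s * S.T (b + q + q) ω + s * S.W (b + q + q) ω = s * S.T (b + q + q + 1) ω := by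
          rw [e2]; ring
        have f4 : s * (S.T (b + q) ω - S.T b ω) + s * (S.T (b + q + q) ω - S.T (b + q) ω) =
          s * (S.T (b + q + q) ω - S.T b ω) := by ring
        rw [f1, f2, f3, f4] at h
        have g1 : ∑ r ∈ Finset.range q, ex (s * S.T b ω) *
          ((S.W (b + q + r) ω * S.W (b + q + q) ω : ℝ) : ℂ) = ex (s * S.T b ω) *
            ((S.T (b + q + q) ω - S.T (b + q) ω : ℝ) : ℂ) * (S.W (b + q + q) ω : ℂ) := by
          rw [e1]; push_cast; rw [Finset.mul_sum, Finset.sum_mul]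
          refine Finset.sum_congr rfl fun r _ => by ring
        rw [g1]
        refine le_trans (le_of_eq ?_) (h.trans ?_)
        · congr 1; push_cast; ring
        · have hw := S.W_bd (b + q + q) ω
          simp only [abs_mul, mul_pow]
          set w := |S.W (b + q + q) ω|
          have hw0 : 0 ≤ w := abs_nonneg _
          rw [← sq_abs (S.T (b + q) ω - S.T b ω), ← sq_abs (S.T (b + q + q) ω - S.T (b + q) ω),
            ← sq_abs (S.T (b + q + q) ω - S.T b ω)]
          set x := |S.T (b + q) ω - S.T b ω|
          set y := |S.T (b + q + q) ω - S.T (b + q) ω|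
          set z := |S.T (b + q + q) ω - S.T b ω|
          have hx : 0 ≤ x := abs_nonneg _
          have hy : 0 ≤ y := abs_nonneg _
          have hz : 0 ≤ z := abs_nonneg _
          have := rem_real S.M w x y z hM1 hw0 hw hx hy hz
          calc _ = |s| ^ 3 * (4 * w ^ 3 + 3 * (w * y ^ 2) + w * (y * x) + w ^ 2 * z) := by ring
            _ ≤ |s| ^ 3 * (S.M ^ 3 * (5 + (x ^ 2 + (4 * y ^ 2 + z ^ 2)))) := by gcongr
            _ = _ := by rw [hc]; ring
    _ = c * (5 + (∫ ω, (S.T (b + q) ω - S.T b ω) ^ 2 ∂P +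
          (4 * ∫ ω, (S.T (b + q + q) ω - S.T (b + q) ω) ^ 2 ∂P
          + ∫ ω, (S.T (b + q + q) ω - S.T b ω) ^ 2 ∂P))) := by
        rw [integral_const_mul, int_comb2 _ _ _ d1 d2 d3]
    _ ≤ c * (5 + (q * S.B + (4 * (q * S.B) + ((q + q : ℕ) : ℝ) * S.B))) := by gcongr
    _ ≤ c * (8 * (1 + 2 * q * S.B)) := by
        refine mul_le_mul_of_nonneg_left ?_ hc0
        have := mul_nonneg (Nat.cast_nonneg (α := ℝ) q) S.B0
        push_cast; nlinarith
    _ = _ := by rw [hc]; ring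

/-- one step error -/
def err (s : ℝ) (N l : ℕ) : ℝ := |s| ^ 3 * (8 * S.M ^ 3 + S.B) * (1 + 6 * l * S.B) +
  (|s| + s ^ 2 * (3 * l + 1)) * S.η s N l

lemma η0 (s : ℝ) (N l : ℕ) (hl : 1 ≤ l) : 0 ≤ S.η s N l := by
  have hM := S.M0; have hβ := S.β0 l; have hK := S.K0; have he := (S.e_pos l hl).le
  unfold η; positivity

lemma step_bound (hβ : Summable S.β) (l : ℕ) (hl : 1 ≤ l) (s : ℝ) (N j : ℕ) (hj : j ≤ N)
    (hj2 : 6 * l ≤ j) :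
    ‖S.φ s (j + 1) - (1 - (s : ℂ) ^ 2 * (S.vq (3 * l) : ℂ)) * S.φ s j‖ ≤ S.err s N l := by
  obtain ⟨b, rfl⟩ : ∃ b, j = b + 3 * l + 3 * l := ⟨j - 6 * l, by omega⟩
  have h1 := S.rem_bound hβ s b (3 * l)
  have h2 := S.dec1 l hl s N (b + 3 * l) (b + 3 * l + 3 * l) (by omega) (by omega)
  have h3 : ∀ r, ‖_‖ ≤ S.η s N l := fun r => S.dec2 l hl s N b (b + 3 * l + r) (b + 3 * l + 3 * l)
    (by omega) (by omega) (by omega)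
  have h4 := S.φ_close hβ s b (3 * l + 3 * l)
  rw [← add_assoc] at h4
  have h5 := h3 (3 * l)
  have hη := S.η0 s N l hl
  set q := 3 * l with hq
  set F : ℕ → ℂ := fun r => ∫ ω, ex (s * S.T b ω) *
          ((S.W (b + q + r) ω * S.W (b + q + q) ω : ℝ) : ℂ) ∂P with hF
  set G := ∫ ω, ex (s * S.T (b + q) ω) * (S.W (b + q + q) ω : ℂ) ∂P
  have hsum : ∑ r ∈ Finset.range q, S.cz (((b + q + q : ℕ) : ℤ) - ((b + q + r : ℕ) : ℤ)) =
      ∑ r ∈ Finset.range q, S.cz ((r : ℤ) + 1) := by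
    rw [← Finset.sum_range_reflect (fun r : ℕ => S.cz ((r : ℤ) + 1))]
    refine Finset.sum_congr rfl fun r hr => ?_
    have := Finset.mem_range.1 hr
    congr 1; omega
  have h6 : ‖∑ r ∈ Finset.range q, F r - S.φ s b * ((∑ r ∈ Finset.range q, S.cz ((r : ℤ) + 1) : ℝ) : ℂ)‖
      ≤ q * S.η s N l := by
    rw [← hsum]; push_cast
    rw [Finset.mul_sum, ← Finset.sum_sub_distrib]
    refine (norm_sum_le _ _).trans ((Finset.sum_le_sum (g := fun _ => S.η s N l) fun r _ => ?_).trans ?_)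
    · have := h3 r; push_cast at this; simpa [hF] using this
    · simp
  have e0 : ((b + q + q : ℕ) : ℤ) - ((b + q + q : ℕ) : ℤ) = 0 := by ring
  rw [e0] at h5
  have hns : ‖(s : ℂ)‖ = |s| := by simp
  have key : S.φ s (b + q + q + 1) - (1 - (s : ℂ) ^ 2 * (S.vq q : ℂ)) * S.φ s (b + q + q) =
      (S.φ s (b + q + q + 1) - S.φ s (b + q + q) - (Complex.I * s * G -
       (s : ℂ) ^ 2 * (∑ r ∈ Finset.range q, F r) - (s : ℂ) ^ 2 / 2 * F q)) +
      Complex.I * s * G -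
      (s : ℂ) ^ 2 * (∑ r ∈ Finset.range q, F r -
        S.φ s b * ((∑ r ∈ Finset.range q, S.cz ((r : ℤ) + 1) : ℝ) : ℂ)) -
      (s : ℂ) ^ 2 / 2 * (F q - S.φ s b * (S.cz 0 : ℂ)) +
      (s : ℂ) ^ 2 * (S.vq q : ℂ) * (S.φ s (b + q + q) - S.φ s b) := by
    unfold vq; push_cast; ring
  rw [key]
  have n2 : ‖Complex.I * s * G‖ ≤ |s| * S.η s N l := by
    rw [norm_mul, norm_mul, Complex.norm_I, one_mul, hns]; gcongr
  have n3 : ‖(s : ℂ) ^ 2 * (∑ r ∈ Finset.range q, F r -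
        S.φ s b * ((∑ r ∈ Finset.range q, S.cz ((r : ℤ) + 1) : ℝ) : ℂ))‖ ≤ s ^ 2 * (q * S.η s N l) := by
    rw [norm_mul, norm_pow, hns, sq_abs]; gcongr
  have n4 : ‖(s : ℂ) ^ 2 / 2 * (F q - S.φ s b * (S.cz 0 : ℂ))‖ ≤ s ^ 2 * S.η s N l := by
    rw [norm_mul, norm_div, norm_pow, hns, sq_abs]
    refine mul_le_mul ?_ h5 (norm_nonneg _) (by positivity)
    simp; nlinarith [sq_nonneg s]
  have n5 : ‖(s : ℂ) ^ 2 * (S.vq q : ℂ) * (S.φ s (b + q + q) - S.φ s b)‖ ≤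
      |s| ^ 2 * S.B * (|s| * (1 + ((q + q : ℕ) : ℝ) * S.B)) := by
    rw [norm_mul, norm_mul, norm_pow, hns, Complex.norm_real, Real.norm_eq_abs]
    have := S.B0
    exact mul_le_mul (mul_le_mul_of_nonneg_left (S.vq_bd hβ q) (by positivity)) h4 (norm_nonneg _)
      (by positivity)
  refine ((norm_add_le _ _).trans (add_le_add ((norm_sub_le _ _).trans (add_le_add ((norm_sub_le _ _).trans
    (add_le_add ((norm_add_le _ _).trans (add_le_add h1 n2)) n3)) n4)) n5)).trans (le_of_eq ?_)
  have hqr : (q : ℝ) = 3 * l := by rw [hq]; push_cast; ring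
  unfold err; push_cast; rw [hqr]; ring

lemma triv_bound (hβ : Summable S.β) (q : ℕ) (s : ℝ) (j : ℕ) :
    ‖S.φ s (j + 1) - (1 - (s : ℂ) ^ 2 * (S.vq q : ℂ)) * S.φ s j‖ ≤ |s| * S.M + s ^ 2 * S.B := by
  have e : S.φ s (j + 1) - (1 - (s : ℂ) ^ 2 * (S.vq q : ℂ)) * S.φ s j =
    S.φ s (j + 1) - S.φ s j + (s : ℂ) ^ 2 * (S.vq q : ℂ) * S.φ s j := by ring
  rw [e]
  refine (norm_add_le _ _).trans (add_le_add (S.φ_triv s j) ?_)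
  rw [norm_mul, norm_mul, norm_pow, Complex.norm_real, Real.norm_eq_abs, sq_abs, Complex.norm_real,
    Real.norm_eq_abs]
  have := S.B0
  calc _ ≤ s ^ 2 * S.B * 1 := mul_le_mul (mul_le_mul_of_nonneg_left (S.vq_bd hβ q) (by positivity))
        (S.φ_le _ _) (norm_nonneg _) (by positivity)
    _ = _ := mul_one _

/-- abstract recursion -/
lemma recur (ψ : ℕ → ℂ) (w : ℂ) (R : ℝ) (d : ℕ → ℝ) (hR : 1 ≤ R) (hw : ‖w‖ ≤ R) (h0 : ψ 0 = 1)
    (hd : ∀ j, 0 ≤ d j)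
    (h : ∀ j, ‖ψ (j + 1) - w * ψ j‖ ≤ d j) (n : ℕ) :
    ‖ψ n - w ^ n‖ ≤ R ^ n * ∑ j ∈ Finset.range n, d j := by
  induction n with
  | zero => simp [h0]
  | succ n ih =>
    have e : ψ (n + 1) - w ^ (n + 1) = (ψ (n + 1) - w * ψ n) + w * (ψ n - w ^ n) := by ring
    rw [e, Finset.sum_range_succ]
    refine (norm_add_le _ _).trans ?_
    rw [norm_mul]
    have h1 : ‖w‖ * ‖ψ n - w ^ n‖ ≤ R * (R ^ n * ∑ j ∈ Finset.range n, d j) :=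
      mul_le_mul hw ih (norm_nonneg _) (by linarith)
    have h2 : d n ≤ R ^ (n + 1) * d n := by
      have := one_le_pow₀ (n := n + 1) hR
      nlinarith [hd n]
    have := h n
    calc _ ≤ R ^ (n + 1) * d n + R * (R ^ n * ∑ j ∈ Finset.range n, d j) := by linarith
      _ = _ := by ring

lemma main_bound (hβ : Summable S.β) (l : ℕ) (hl : 1 ≤ l) (s : ℝ) (n : ℕ) :
    ‖S.φ s n - (1 - (s : ℂ) ^ 2 * (S.vq (3 * l) : ℂ)) ^ n‖ ≤
      Real.exp (n * (s ^ 2 * S.B)) * (6 * l * (|s| * S.M + s ^ 2 * S.B) + n * S.err s n l) := by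
  have hB := S.B0; have hM := S.M0
  have hη := S.η0 s n l hl
  have herr : 0 ≤ S.err s n l := by unfold err; positivity
  set ψ : ℕ → ℂ := fun j => S.φ s j with hψ
  have hw : ‖1 - (s : ℂ) ^ 2 * (S.vq (3 * l) : ℂ)‖ ≤ 1 + s ^ 2 * S.B := by
    refine (norm_sub_le _ _).trans ?_
    rw [norm_one, norm_mul, norm_pow, Complex.norm_real, Real.norm_eq_abs, sq_abs, Complex.norm_real,
      Real.norm_eq_abs]
    have := S.vq_bd hβ (3 * l)
    gcongr
  set t := |s| * S.M + s ^ 2 * S.B with ht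
  have ht0 : 0 ≤ t := by positivity
  have hstep : ∀ j, ‖S.φ s (j + 1) - (1 - (s : ℂ) ^ 2 * (S.vq (3 * l) : ℂ)) * S.φ s j‖ ≤
      (if j < 6 * l then t else 0) + (if j ≤ n then S.err s n l else t) := by
    intro j
    by_cases h1 : j < 6 * l
    · rw [if_pos h1]
      refine (S.triv_bound hβ _ s j).trans ?_
      have : 0 ≤ (if j ≤ n then S.err s n l else t) := by split_ifs <;> assumption
      linarith
    · rw [if_neg h1, zero_add]
      by_cases h2 : j ≤ n
      · rw [if_pos h2]; exact S.step_bound hβ l hl s n j h2 (by omega)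
      · rw [if_neg h2]; exact S.triv_bound hβ _ s j
  have := recur (S.φ s) _ _ _ (by nlinarith [sq_nonneg s, mul_nonneg (sq_nonneg s) hB]) hw (S.φ_zero s)
    (fun j => add_nonneg (by split_ifs <;> simp [ht0]) (by split_ifs <;> assumption)) hstep n
  refine this.trans ?_
  have hexp : (1 + s ^ 2 * S.B) ^ n ≤ Real.exp (n * (s ^ 2 * S.B)) := by
    rw [Real.exp_nat_mul]
    refine pow_le_pow_left₀ (by positivity) ?_ _
    have := Real.add_one_le_exp (s ^ 2 * S.B)
    linarith
  refine mul_le_mul hexp ?_ (Finset.sum_nonneg fun j _ => add_nonneg (by split_ifs <;> simp [ht0]) (by split_ifs <;> assumption)) (Real.exp_pos _).le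
  rw [Finset.sum_add_distrib]
  refine add_le_add ?_ ?_
  · rw [← Finset.sum_filter, Finset.sum_const, nsmul_eq_mul]
    refine mul_le_mul_of_nonneg_right ?_ ht0
    have : (Finset.filter (fun j => j < 6 * l) (Finset.range n)).card ≤ 6 * l := by
      refine (Finset.card_le_card (t := Finset.range (6 * l)) fun x hx => ?_).trans (by simp)
      simp at hx ⊢; exact hx.2
    exact_mod_cast this
  · rw [Finset.sum_congr rfl fun j hj => if_pos (Finset.mem_range.1 hj).le]
    simp

end Setup
end UQuantile


namespace UQuantile
namespace Setup
variable {Ω : Type*} [MeasurableSpace Ω] {P : Measure Ω} (S : Setup P) [IsProbabilityMeasure P]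

lemma e_nn (l : ℕ) : 0 ≤ S.e l := by unfold e; positivity

lemma Fr_small (h2 : Tendsto (fun k : ℕ => (k : ℝ) ^ 2 * S.β k) atTop (𝓝 0)) (ε : ℝ) (hε : 0 < ε) :
    ∀ᶠ n : ℕ in atTop, ∃ l ≥ 1, S.Fr n l < ε := by
  set δ := Real.sqrt (ε / 8) with hδ
  have hδ0 : 0 < δ := Real.sqrt_pos.2 (by linarith)
  have hδ2 : δ ^ 2 = ε / 8 := Real.sq_sqrt (by linarith)
  have hsq : Tendsto (fun n : ℕ => δ * Real.sqrt n) atTop atTop :=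
    (Real.tendsto_sqrt_atTop.comp tendsto_natCast_atTop_atTop).const_mul_atTop hδ0
  have hl : Tendsto (fun n : ℕ => ⌈δ * Real.sqrt n⌉₊) atTop atTop := tendsto_nat_ceil_atTop.comp hsq
  have h3 : Tendsto (fun k : ℕ => ((k : ℝ) ^ 2 * S.β k + (k : ℝ)⁻¹) / δ ^ 2) atTop (𝓝 0) := by
    have := (h2.add (tendsto_inv_atTop_nhds_zero_nat (𝕜 := ℝ))).div_const (δ ^ 2)
    simpa using this
  have h4 := (h3.comp hl).eventually (gt_mem_nhds (show (0 : ℝ) < ε / 2 by linarith))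
  filter_upwards [h4, hsq.eventually_ge_atTop 1, eventually_ge_atTop 1] with n hn h1 hn1
  simp only [Function.comp_apply] at hn
  set l := ⌈δ * Real.sqrt n⌉₊ with hl'
  have hle : δ * Real.sqrt n ≤ l := Nat.le_ceil _
  have hlt : (l : ℝ) ≤ 2 * (δ * Real.sqrt n) := by
    have := Nat.ceil_lt_add_one (show 0 ≤ δ * Real.sqrt n by linarith)
    linarith
  have hl1 : (1 : ℝ) ≤ l := h1.trans hle
  have hn0 : (0 : ℝ) < n := by exact_mod_cast hn1
  have hs2 : Real.sqrt n ^ 2 = n := Real.sq_sqrt hn0.le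
  refine ⟨l, by exact_mod_cast hl1, ?_⟩
  unfold Fr
  have hβ := S.β0 l
  have a1 : (l : ℝ) ^ 2 / n ≤ ε / 2 := by
    rw [div_le_iff₀ hn0]
    calc (l : ℝ) ^ 2 ≤ (2 * (δ * Real.sqrt n)) ^ 2 := by gcongr
      _ = 4 * δ ^ 2 * Real.sqrt n ^ 2 := by ring
      _ = ε / 2 * n := by rw [hδ2, hs2]; ring
  have a2 : (n : ℝ) * (S.β l + S.e l) ≤ ((l : ℝ) ^ 2 * S.β l + (l : ℝ)⁻¹) / δ ^ 2 := by
    rw [le_div_iff₀ (by positivity)]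
    have he : (l : ℝ)⁻¹ = (l : ℝ) ^ 2 * S.e l := by
      unfold e; field_simp
    rw [he, ← mul_add]
    have : (n : ℝ) * δ ^ 2 ≤ (l : ℝ) ^ 2 := by
      calc (n : ℝ) * δ ^ 2 = (δ * Real.sqrt n) ^ 2 := by rw [mul_pow, hs2]; ring
        _ ≤ _ := by gcongr
    have he0 := S.e_nn l
    calc (n : ℝ) * (S.β l + S.e l) * δ ^ 2 = (n : ℝ) * δ ^ 2 * (S.β l + S.e l) := by ring
      _ ≤ _ := by gcongr
  linarith

lemma exists_l (h2 : Tendsto (fun k : ℕ => (k : ℝ) ^ 2 * S.β k) atTop (𝓝 0)) :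
    ∃ l : ℕ → ℕ, (∀ n, 1 ≤ l n) ∧ Tendsto (fun n => S.Fr n (l n)) atTop (𝓝 0) ∧
      Tendsto l atTop atTop := by
  have hex : ∀ n : ℕ, ∃ l ≥ 1, ∀ l' ≥ 1, S.Fr n l ≤ S.Fr n l' + 1 / ((n : ℝ) + 1) := by
    intro n
    by_contra! hc
    have hb : BddBelow (Set.range fun k : ℕ => S.Fr n (k + 1)) :=
      ⟨0, by rintro _ ⟨k, rfl⟩; exact S.Fr_nonneg _ _⟩
    have hp : 0 < 1 / ((n : ℝ) + 1) := by positivity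
    obtain ⟨k, hk⟩ := exists_lt_of_ciInf_lt
      (show (⨅ k : ℕ, S.Fr n (k + 1)) < (⨅ k : ℕ, S.Fr n (k + 1)) + 1 / ((n : ℝ) + 1) by linarith)
    obtain ⟨l', hl', h⟩ := hc (k + 1) (by omega)
    have := ciInf_le hb (l' - 1)
    simp only [Nat.sub_add_cancel hl'] at this
    linarith
  choose l hl1 hl using hex
  have hF : Tendsto (fun n => S.Fr n (l n)) atTop (𝓝 0) := by
    rw [tendsto_order]
    refine ⟨fun a ha => Eventually.of_forall fun n => ha.trans_le (S.Fr_nonneg _ _), fun ε hε => ?_⟩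
    have h1 : ∀ᶠ n : ℕ in atTop, 1 / ((n : ℝ) + 1) < ε / 2 :=
      tendsto_one_div_add_atTop_nhds_zero_nat.eventually (gt_mem_nhds (by linarith))
    filter_upwards [S.Fr_small h2 (ε / 2) (by linarith), h1] with n ⟨l', hl', h⟩ hn
    have := hl n l' hl'
    linarith
  refine ⟨l, hl1, hF, tendsto_atTop.2 fun b => ?_⟩
  filter_upwards [hF.eventually (gt_mem_nhds (zero_lt_one)), eventually_ge_atTop (b ^ 3)] with n hn hb
  by_contra! hlt
  have hl0 : (0 : ℝ) < l n := by exact_mod_cast hl1 n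
  have h3 : (n : ℝ) * S.e (l n) < 1 := by
    refine lt_of_le_of_lt ?_ hn
    unfold Fr
    have := S.β0 (l n)
    have : 0 ≤ ((l n : ℕ) : ℝ) ^ 2 / n := by positivity
    nlinarith [mul_nonneg (Nat.cast_nonneg (α := ℝ) n) (S.β0 (l n))]
  unfold e at h3
  rw [inv_pow, ← div_eq_mul_inv, div_lt_one (by positivity)] at h3
  have h4 : n < (l n) ^ 3 := by exact_mod_cast h3
  have h5 : (l n) ^ 3 ≤ b ^ 3 := Nat.pow_le_pow_left hlt.le 3
  omega

lemma vq_lim (hβ : Summable S.β) : Tendsto S.vq atTop (𝓝 ((∑' r, S.cz r) / 2)) := by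
  have h1 := (S.cz_summable hβ).hasSum.nat_add_neg
  have h2 := (h1.tendsto_sum_nat.comp (tendsto_add_atTop_nat 1)).sub_const (S.cz 0) |>.div_const 2
  refine (h2.congr fun q => ?_).trans (by simp)
  simp only [Function.comp_apply, S.cz_neg]
  rw [Finset.sum_range_succ']
  unfold vq
  push_cast
  rw [Finset.sum_add_distrib]
  ring

lemma φ_lim (hβ : Summable S.β) (l : ℕ → ℕ) (hl1 : ∀ n, 1 ≤ l n)
    (hF : Tendsto (fun n => S.Fr n (l n)) atTop (𝓝 0)) (hl : Tendsto l atTop atTop) (t : ℝ) :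
    Tendsto (fun n : ℕ => S.φ (2 * t / Real.sqrt n) n) atTop
      (𝓝 (Complex.exp ((-(2 * t ^ 2 * ∑' r, S.cz r) : ℝ) : ℂ))) := by
  have hi : Tendsto (fun n : ℕ => (Real.sqrt n)⁻¹) atTop (𝓝 0) :=
    (Real.tendsto_sqrt_atTop.comp tendsto_natCast_atTop_atTop).inv_tendsto_atTop
  have hsF : Tendsto (fun n => Real.sqrt (S.Fr n (l n))) atTop (𝓝 0) := by
    have := (Real.continuous_sqrt.tendsto 0).comp hF
    rw [Real.sqrt_zero] at this
    exact this
  have he0 := S.e_nn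
  have hβ0 := S.β0
  have hFs : ∀ n : ℕ, S.Fr n (l n) = (l n : ℝ) ^ 2 / n + (n * S.β (l n) + n * S.e (l n)) := fun n => by
    unfold Fr; ring
  have hn1 : ∀ᶠ n : ℕ in atTop, 1 ≤ n := eventually_ge_atTop 1
  have hsn : ∀ n : ℕ, 1 ≤ n → Real.sqrt n ≤ n := fun n hn => by
    rw [Real.sqrt_le_left (by positivity)]
    have : (1 : ℝ) ≤ n := by exact_mod_cast hn
    nlinarith
  have hA : Tendsto (fun n : ℕ => (l n : ℝ) * (Real.sqrt n)⁻¹) atTop (𝓝 0) := by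
    refine squeeze_zero (fun n => by positivity) (fun n => ?_) hsF
    refine Real.le_sqrt_of_sq_le ?_
    rw [hFs, mul_pow, inv_pow, Real.sq_sqrt (by positivity), ← div_eq_mul_inv]
    have := mul_nonneg (Nat.cast_nonneg (α := ℝ) n) (hβ0 (l n))
    have := mul_nonneg (Nat.cast_nonneg (α := ℝ) n) (he0 (l n))
    linarith
  have hc : Tendsto (fun n : ℕ => (n : ℝ) * S.e (l n)) atTop (𝓝 0) := by
    refine squeeze_zero (fun n => mul_nonneg (by positivity) (he0 _)) (fun n => ?_) hF
    rw [hFs]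
    have := mul_nonneg (Nat.cast_nonneg (α := ℝ) n) (hβ0 (l n))
    have : 0 ≤ ((l n : ℕ) : ℝ) ^ 2 / n := by positivity
    linarith
  have hb' : Tendsto (fun n : ℕ => (n : ℝ) * S.β (l n)) atTop (𝓝 0) := by
    refine squeeze_zero (fun n => mul_nonneg (by positivity) (hβ0 _)) (fun n => ?_) hF
    rw [hFs]
    have := mul_nonneg (Nat.cast_nonneg (α := ℝ) n) (he0 (l n))
    have : 0 ≤ ((l n : ℕ) : ℝ) ^ 2 / n := by positivity
    linarith
  have hd : Tendsto (fun n : ℕ => Real.sqrt n * S.e (l n)) atTop (𝓝 0) := by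
    refine squeeze_zero' (Eventually.of_forall fun n => mul_nonneg (by positivity) (he0 _)) ?_ hc
    filter_upwards [hn1] with n hn
    exact mul_le_mul_of_nonneg_right (hsn n hn) (he0 _)
  have hb : Tendsto (fun n : ℕ => Real.sqrt n * S.β (l n)) atTop (𝓝 0) := by
    refine squeeze_zero' (Eventually.of_forall fun n => mul_nonneg (by positivity) (hβ0 _)) ?_ hb'
    filter_upwards [hn1] with n hn
    exact mul_le_mul_of_nonneg_right (hsn n hn) (hβ0 _)
  -- the product
  have hpow : Tendsto (fun n : ℕ => (1 - ((2 * t / Real.sqrt n : ℝ) : ℂ) ^ 2 * (S.vq (3 * l n) : ℂ)) ^ n)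
      atTop (𝓝 (Complex.exp ((-(2 * t ^ 2 * ∑' r, S.cz r) : ℝ) : ℂ))) := by
    have hv : Tendsto (fun n : ℕ => S.vq (3 * l n)) atTop (𝓝 ((∑' r, S.cz r) / 2)) :=
      (S.vq_lim hβ).comp (tendsto_atTop_mono (fun n => by show l n ≤ 3 * l n; omega) hl)
    have hg : Tendsto (fun n : ℕ => (n : ℂ) *
        (-(((2 * t / Real.sqrt n : ℝ) : ℂ) ^ 2 * (S.vq (3 * l n) : ℂ)))) atTop
        (𝓝 ((-(2 * t ^ 2 * ∑' r, S.cz r) : ℝ) : ℂ)) := by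
      have h1 : Tendsto (fun n : ℕ => -(4 * t ^ 2) * S.vq (3 * l n)) atTop
          (𝓝 (-(2 * t ^ 2 * ∑' r, S.cz r))) := by
        have := hv.const_mul (-(4 * t ^ 2))
        refine this.trans (le_of_eq ?_)
        congr 1; ring
      refine (((Complex.continuous_ofReal.tendsto _).comp h1)).congr' ?_
      filter_upwards [hn1] with n hn
      have hn0 : (0 : ℝ) < n := by exact_mod_cast hn
      have : (n : ℝ) * (-((2 * t / Real.sqrt n) ^ 2 * S.vq (3 * l n))) = -(4 * t ^ 2) * S.vq (3 * l n) := by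
        rw [div_pow, Real.sq_sqrt hn0.le]; field_simp; ring
      simp only [Function.comp_apply]
      rw [← this]; push_cast; ring
    refine (Complex.tendsto_one_add_pow_exp_of_tendsto hg).congr fun n => ?_
    rw [← sub_eq_add_neg]
  have hdiff : Tendsto (fun n : ℕ => S.φ (2 * t / Real.sqrt n) n -
      (1 - ((2 * t / Real.sqrt n : ℝ) : ℂ) ^ 2 * (S.vq (3 * l n) : ℂ)) ^ n) atTop (𝓝 0) := by
    have hbd : Tendsto (fun n : ℕ => Real.exp (4 * t ^ 2 * S.B) *
        ((12 * |t| * S.M * ((l n : ℝ) * (Real.sqrt n)⁻¹) +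
          24 * t ^ 2 * S.B * (((l n : ℝ) * (Real.sqrt n)⁻¹) * (Real.sqrt n)⁻¹)) +
        (8 * |t| ^ 3 * (8 * S.M ^ 3 + S.B) * ((Real.sqrt n)⁻¹ + 6 * S.B * ((l n : ℝ) * (Real.sqrt n)⁻¹)) +
          (2 * |t| + 4 * t ^ 2 * (3 * ((l n : ℝ) * (Real.sqrt n)⁻¹) + (Real.sqrt n)⁻¹)) *
          (16 * S.M ^ 2 * (Real.sqrt n * S.β (l n)) + 8 * S.M ^ 2 * S.K * (2 * |t| * (n * S.e (l n))) +
            8 * S.M * S.K * (Real.sqrt n * S.e (l n)))))) atTop (𝓝 0) := by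
      have k1 := (hA.const_mul (12 * |t| * S.M)).add ((hA.mul hi).const_mul (24 * t ^ 2 * S.B))
      have k2 := (hi.add (hA.const_mul (6 * S.B))).const_mul (8 * |t| ^ 3 * (8 * S.M ^ 3 + S.B))
      have k3 := (((hA.const_mul 3).add hi).const_mul (4 * t ^ 2)).const_add (2 * |t|)
      have k4 := ((hb.const_mul (16 * S.M ^ 2)).add ((hc.const_mul (2 * |t|)).const_mul
        (8 * S.M ^ 2 * S.K))).add (hd.const_mul (8 * S.M * S.K))
      have k5 := (k1.add (k2.add (k3.mul k4))).const_mul (Real.exp (4 * t ^ 2 * S.B))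
      refine k5.trans (le_of_eq ?_)
      congr 1; ring
    refine squeeze_zero_norm' ?_ hbd
    filter_upwards [hn1] with n hn
    refine (S.main_bound hβ (l n) (hl1 n) _ n).trans (le_of_eq ?_)
    have hn0 : (0 : ℝ) < n := by exact_mod_cast hn
    have hx : 0 < Real.sqrt n := Real.sqrt_pos.2 hn0
    have hxn : (n : ℝ) = Real.sqrt n ^ 2 := (Real.sq_sqrt hn0.le).symm
    have habs : |2 * t / Real.sqrt n| = 2 * |t| / Real.sqrt n := by
      rw [abs_div, abs_mul, abs_two, abs_of_pos hx]
    unfold err η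
    rw [habs]
    generalize Real.sqrt n = x at *
    rw [hxn]
    have e1 : x ^ 2 * ((2 * t / x) ^ 2 * S.B) = 4 * t ^ 2 * S.B := by field_simp; ring
    rw [e1]
    congr 1
    generalize |t| = a
    field_simp
    ring
  have := hdiff.add hpow
  simpa using this

end Setup
end UQuantile


namespace UQuantile

lemma icc_succ (n : ℕ) : Finset.Icc (1 : ℤ) ((n + 1 : ℕ) : ℤ) =
    insert ((n : ℤ) + 1) (Finset.Icc (1 : ℤ) (n : ℤ)) := by
  ext x; simp only [Finset.mem_Icc, Finset.mem_insert]; omega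

lemma sum_icc (a : ℤ → ℝ) (n : ℕ) :
    ∑ i ∈ Finset.Icc (1 : ℤ) (n : ℤ), a i = ∑ i ∈ Finset.range n, a ((i : ℤ) + 1) := by
  induction n with
  | zero => simp
  | succ n ih =>
    rw [icc_succ, Finset.sum_insert (by simp), ih, Finset.sum_range_succ]; ring

lemma sum_pairs (a : ℤ → ℝ) (n : ℕ) :
    ∑ i ∈ Finset.Icc (1 : ℤ) (n : ℤ), ∑ j ∈ Finset.Ioc i (n : ℤ), (a i + a j) =
      ((n : ℝ) - 1) * ∑ i ∈ Finset.range n, a ((i : ℤ) + 1) := by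
  induction n with
  | zero => simp
  | succ n ih =>
    rw [icc_succ, Finset.sum_insert (by simp)]
    have h0 : Finset.Ioc ((n : ℤ) + 1) ((n + 1 : ℕ) : ℤ) = ∅ := by
      ext x; simp only [Finset.mem_Ioc, Finset.notMem_empty, iff_false]; omega
    rw [h0, Finset.sum_empty, zero_add]
    have h1 : ∀ i ∈ Finset.Icc (1 : ℤ) (n : ℤ),
        ∑ j ∈ Finset.Ioc i ((n + 1 : ℕ) : ℤ), (a i + a j) =
          (a i + a ((n : ℤ) + 1)) + ∑ j ∈ Finset.Ioc i (n : ℤ), (a i + a j) := by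
      intro i hi
      have hi' := Finset.mem_Icc.1 hi
      have : Finset.Ioc i ((n + 1 : ℕ) : ℤ) = insert ((n : ℤ) + 1) (Finset.Ioc i (n : ℤ)) := by
        ext x; simp only [Finset.mem_Ioc, Finset.mem_insert]; omega
      rw [this, Finset.sum_insert (by simp)]
    rw [Finset.sum_congr rfl h1, Finset.sum_add_distrib, ih, Finset.sum_add_distrib, sum_icc,
      Finset.sum_const, Int.card_Icc, Finset.sum_range_succ]
    simp only [nsmul_eq_mul]
    push_cast
    have : (((n : ℤ) + 1 - 1).toNat : ℝ) = n := by simp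
    rw [this]
    ring

namespace Setup
variable {Ω : Type*} [MeasurableSpace Ω] {P : Measure Ω} (S : Setup P) [IsProbabilityMeasure P]

/-- the normalised U-statistic -/
def V (n : ℕ) (ω : Ω) : ℝ := Real.sqrt n * ((2 / ((n : ℝ) * ((n : ℝ) - 1))) *
  ∑ i ∈ Finset.Icc (1 : ℤ) (n : ℤ), ∑ j ∈ Finset.Ioc i (n : ℤ), S.H (S.X i ω) (S.X j ω) - S.θ)

/-- the degenerate remainder -/
def R (n : ℕ) (ω : Ω) : ℝ := Real.sqrt n * ((2 / ((n : ℝ) * ((n : ℝ) - 1))) *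
  ∑ i ∈ Finset.Icc (1 : ℤ) (n : ℤ), ∑ j ∈ Finset.Ioc i (n : ℤ), S.g2 (S.X i ω) (S.X j ω))

lemma V_m (n : ℕ) : Measurable (S.V n) := by
  have h : ∀ i j : ℤ, Measurable fun ω => S.H (S.X i ω) (S.X j ω) := fun i j =>
    S.Hm.comp ((S.hX i).prodMk (S.hX j))
  have h2 : Measurable fun ω => ∑ i ∈ Finset.Icc (1 : ℤ) (n : ℤ), ∑ j ∈ Finset.Ioc i (n : ℤ),
      S.H (S.X i ω) (S.X j ω) :=
    Finset.measurable_fun_sum _ fun i _ => Finset.measurable_fun_sum _ fun j _ => h i j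
  exact ((h2.const_mul _).sub_const _).const_mul _

lemma R_m (n : ℕ) : Measurable (S.R n) := by
  have h : ∀ i j : ℤ, Measurable fun ω => S.g2 (S.X i ω) (S.X j ω) := fun i j =>
    S.g2_m.comp ((S.hX i).prodMk (S.hX j))
  have h2 : Measurable fun ω => ∑ i ∈ Finset.Icc (1 : ℤ) (n : ℤ), ∑ j ∈ Finset.Ioc i (n : ℤ),
      S.g2 (S.X i ω) (S.X j ω) :=
    Finset.measurable_fun_sum _ fun i _ => Finset.measurable_fun_sum _ fun j _ => h i j
  exact (h2.const_mul _).const_mul _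

lemma R_int (n : ℕ) : Integrable (S.R n) P := by
  have h : ∀ i j : ℤ, Integrable (fun ω => S.g2 (S.X i ω) (S.X j ω)) P := fun i j =>
    intb (S.g2_m.comp ((S.hX i).prodMk (S.hX j))) (4 * S.M) fun ω => S.g2_bd _ _
  have h2 : Integrable (fun ω => ∑ i ∈ Finset.Icc (1 : ℤ) (n : ℤ), ∑ j ∈ Finset.Ioc i (n : ℤ),
      S.g2 (S.X i ω) (S.X j ω)) P :=
    integrable_finset_sum _ fun i _ => integrable_finset_sum _ fun j _ => h i j
  exact (h2.const_mul _).const_mul _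

lemma hoeffding (n : ℕ) (hn : 2 ≤ n) (ω : Ω) :
    S.V n ω = 2 / Real.sqrt n * S.T n ω + S.R n ω := by
  have h := sum_pairs (fun i => S.g1 (S.X i ω) + S.θ / 2) n
  have hH : ∑ i ∈ Finset.Icc (1 : ℤ) (n : ℤ), ∑ j ∈ Finset.Ioc i (n : ℤ), S.H (S.X i ω) (S.X j ω) =
      ∑ i ∈ Finset.Icc (1 : ℤ) (n : ℤ), ∑ j ∈ Finset.Ioc i (n : ℤ), S.g2 (S.X i ω) (S.X j ω) +
      ((n : ℝ) - 1) * (S.T n ω + n * (S.θ / 2)) := by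
    have e : ∑ i ∈ Finset.range n, (S.g1 (S.X ((i : ℤ) + 1) ω) + S.θ / 2) = S.T n ω + n * (S.θ / 2) := by
      rw [Finset.sum_add_distrib]; simp [T, W]
    rw [← e, ← h, ← Finset.sum_add_distrib]
    refine Finset.sum_congr rfl fun i _ => ?_
    rw [← Finset.sum_add_distrib]
    refine Finset.sum_congr rfl fun j _ => ?_
    unfold g2; ring
  unfold V R
  rw [hH]
  generalize ∑ i ∈ Finset.Icc (1 : ℤ) (n : ℤ), ∑ j ∈ Finset.Ioc i (n : ℤ),
    S.g2 (S.X i ω) (S.X j ω) = G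
  have hn2 : (2 : ℝ) ≤ n := by exact_mod_cast hn
  have hn0 : (0 : ℝ) < n := by linarith
  have hn1 : (n : ℝ) - 1 ≠ 0 := by linarith
  have hx : 0 < Real.sqrt n := Real.sqrt_pos.2 hn0
  have hxn : (n : ℝ) = Real.sqrt n ^ 2 := (Real.sq_sqrt hn0.le).symm
  generalize Real.sqrt n = x at *
  rw [hxn] at hn1 ⊢
  field_simp
  ring

lemma V_char (hβ : Summable S.β) (h2 : Tendsto (fun k : ℕ => (k : ℝ) ^ 2 * S.β k) atTop (𝓝 0)) (t : ℝ) :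
    Tendsto (fun n : ℕ => ∫ ω, ex (t * S.V n ω) ∂P) atTop
      (𝓝 (Complex.exp ((-(2 * t ^ 2 * ∑' r, S.cz r) : ℝ) : ℂ))) := by
  obtain ⟨l, hl1, hF, hl⟩ := S.exists_l h2
  have hφ := S.φ_lim hβ l hl1 hF hl t
  obtain ⟨C, hC0, hC⟩ := S.deg_bound
  have hd : Tendsto (fun n : ℕ => ∫ ω, ex (t * S.V n ω) ∂P - S.φ (2 * t / Real.sqrt n) n) atTop (𝓝 0) := by
    have hsF : Tendsto (fun n => Real.sqrt (S.Fr n (l n))) atTop (𝓝 0) := by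
      have := (Real.continuous_sqrt.tendsto 0).comp hF
      rw [Real.sqrt_zero] at this
      exact this
    have hb : Tendsto (fun n : ℕ => |t| * (C * (S.Fr n (l n) + Real.sqrt (S.Fr n (l n))))) atTop (𝓝 0) := by
      have := ((hF.add hsF).const_mul C).const_mul |t|
      simpa using this
    refine squeeze_zero_norm' ?_ hb
    filter_upwards [eventually_ge_atTop 2] with n hn
    have iV : Integrable (fun ω => ex (t * S.V n ω)) P :=
      intc (ex_m.comp ((S.V_m n).const_mul t)) 1 fun ω => (ex_norm _).le
    unfold φ
    rw [← integral_sub iV (S.ex_int _ _)]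
    calc _ ≤ ∫ ω, |t| * |S.R n ω| ∂P := by
          refine norm_integral_le_of_norm_le ((S.R_int n).abs.const_mul _) (ae_of_all _ fun ω => ?_)
          have h := ex_sub (2 * t / Real.sqrt n * S.T n ω) (t * S.R n ω)
          have e : 2 * t / Real.sqrt n * S.T n ω + t * S.R n ω = t * S.V n ω := by
            rw [S.hoeffding n hn]; ring
          rw [e, abs_mul] at h
          exact h
      _ = |t| * ∫ ω, |S.R n ω| ∂P := integral_const_mul _ _
      _ ≤ _ := mul_le_mul_of_nonneg_left (hC n (l n) hn (hl1 n)) (abs_nonneg _)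
  have := hd.add hφ
  simpa using this

lemma clt (hβ : Summable S.β) (h2 : Tendsto (fun k : ℕ => (k : ℝ) ^ 2 * S.β k) atTop (𝓝 0))
    (f : BoundedContinuousFunction ℝ ℝ) :
    Tendsto (fun n : ℕ => ∫ ω, f (S.V n ω) ∂P) atTop
      (𝓝 (∫ x, f x ∂(ProbabilityTheory.gaussianReal 0 (Real.toNNReal (4 * ∑' r, S.cz r))))) := by
  have hnn : 0 ≤ ∑' r, S.cz r := by
    have h := (S.V_char hβ h2 1).norm
    have : ‖Complex.exp ((-(2 * 1 ^ 2 * ∑' r, S.cz r) : ℝ) : ℂ)‖ ≤ 1 := by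
      refine le_of_tendsto h (Eventually.of_forall fun n => ?_)
      have := norm_integral_le_of_norm_le_const (μ := P) (f := fun ω => ex (1 * S.V n ω)) (C := 1)
        (ae_of_all _ fun ω => (ex_norm _).le)
      simpa using this
    rw [Complex.norm_exp_ofReal, Real.exp_le_one_iff] at this
    linarith
  have hpm : ∀ n, IsProbabilityMeasure (P.map (S.V n)) := fun n =>
    Measure.isProbabilityMeasure_map (S.V_m n).aemeasurable
  set ν : ℕ → ProbabilityMeasure ℝ := fun n => ⟨P.map (S.V n), hpm n⟩ with hν
  set γ : ProbabilityMeasure ℝ := ⟨ProbabilityTheory.gaussianReal 0 (Real.toNNReal (4 * ∑' r, S.cz r)),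
    inferInstance⟩ with hγ
  have hT : Tendsto ν atTop (𝓝 γ) := by
    refine ProbabilityMeasure.tendsto_iff_tendsto_charFun.2 fun t => ?_
    have e1 : charFun (γ : Measure ℝ) t = Complex.exp ((-(2 * t ^ 2 * ∑' r, S.cz r) : ℝ) : ℂ) := by
      show charFun (ProbabilityTheory.gaussianReal 0 _) t = _
      rw [ProbabilityTheory.charFun_gaussianReal]
      congr 1
      have : ((Real.toNNReal (4 * ∑' r, S.cz r) : ℝ) : ℂ) = ((4 * ∑' r, S.cz r : ℝ) : ℂ) := by
        rw [Real.coe_toNNReal _ (by linarith)]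
      rw [this]
      push_cast; ring
    rw [e1]
    refine (S.V_char hβ h2 t).congr fun n => ?_
    show _ = charFun (P.map (S.V n)) t
    rw [charFun_apply_real, integral_map (S.V_m n).aemeasurable (by fun_prop)]
    refine integral_congr_ae (ae_of_all _ fun ω => ?_)
    simp only [ex]; push_cast; rfl
  have := (ProbabilityMeasure.tendsto_iff_forall_integral_tendsto.1 hT) f
  refine this.congr fun n => ?_
  show ∫ x, f x ∂(P.map (S.V n)) = _
  rw [integral_map (S.V_m n).aemeasurable f.continuous.aestronglyMeasurable]

end Setup
end UQuantile


namespace UQuantile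

/-- running minimum -/
def bmin (β : ℕ → ℝ) (k : ℕ) : ℝ := (Finset.range (k + 1)).inf' ⟨0, by simp⟩ β

lemma bmin_le (β : ℕ → ℝ) (k : ℕ) : bmin β k ≤ β k := Finset.inf'_le _ (by simp)

lemma bmin_nonneg (β : ℕ → ℝ) (h : ∀ k, 0 ≤ β k) (k : ℕ) : 0 ≤ bmin β k :=
  Finset.le_inf' _ _ fun i _ => h i

lemma bmin_anti (β : ℕ → ℝ) : Antitone (bmin β) := fun i j hij =>
  Finset.le_inf' _ _ fun r hr => Finset.inf'_le _ (by
    simp only [Finset.mem_range] at hr ⊢; omega)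

lemma bmin_bound {Ω : Type*} [MeasurableSpace Ω] (P : Measure Ω) (Z : ℤ → Ω → ℝ) (β : ℕ → ℝ)
    (h : IsBetaBound P Z β) : IsBetaBound P Z (bmin β) := by
  intro k m m' A B hA hB dA dB uA uB
  refine Finset.le_inf' _ _ fun r hr => ?_
  refine h r m m' A B hA (fun j => ?_) dA dB uA uB
  have hle : futureSigma Z k ≤ futureSigma Z r := by
    refine iSup_le fun i => ?_
    have := Finset.mem_range.1 hr
    exact le_iSup (fun i : {i : ℤ // (r : ℤ) ≤ i} => MeasurableSpace.comap (Z i) Real.measurableSpace)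
      ⟨i.1, by have := i.2; omega⟩
  exact hle _ (hB j)

lemma anti_rate (β : ℕ → ℝ) (h0 : ∀ k, 0 ≤ β k) (ha : Antitone β)
    (hs : Summable fun k : ℕ => (k : ℝ) * β k) :
    Summable β ∧ Tendsto (fun k : ℕ => (k : ℝ) ^ 2 * β k) atTop (𝓝 0) := by
  constructor
  · refine Summable.of_norm_bounded_eventually_nat hs ?_
    filter_upwards [eventually_ge_atTop 1] with k hk
    rw [Real.norm_eq_abs, abs_of_nonneg (h0 k)]
    have : (1 : ℝ) ≤ k := by exact_mod_cast hk
    nlinarith [h0 k]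
  · set Sm : ℕ → ℝ := fun n => ∑ i ∈ Finset.range n, (i : ℝ) * β i with hSm
    have hS := hs.hasSum.tendsto_sum_nat
    have m1 : Tendsto (fun k : ℕ => k / 2) atTop atTop :=
      Nat.tendsto_div_const_atTop (by norm_num)
    have m2 : Tendsto (fun k : ℕ => k / 2 + k / 2) atTop atTop :=
      tendsto_atTop_mono (fun k => Nat.le_add_right _ _) m1
    have hd : Tendsto (fun k : ℕ => 9 * (Sm (k / 2 + k / 2) - Sm (k / 2))) atTop (𝓝 0) := by
      have := ((hS.comp m2).sub (hS.comp m1)).const_mul 9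
      rw [sub_self, mul_zero] at this
      exact this
    refine squeeze_zero' (Eventually.of_forall fun k => mul_nonneg (by positivity) (h0 k)) ?_ hd
    filter_upwards [eventually_ge_atTop 2] with k hk
    have h1 : Sm (k / 2 + k / 2) - Sm (k / 2) =
        ∑ r ∈ Finset.range (k / 2), ((k / 2 + r : ℕ) : ℝ) * β (k / 2 + r) := by
      simp only [hSm]; rw [Finset.sum_range_add]; ring
    have h2 : ∑ r ∈ Finset.range (k / 2), ((k / 2 : ℕ) : ℝ) * β k ≤
        ∑ r ∈ Finset.range (k / 2), ((k / 2 + r : ℕ) : ℝ) * β (k / 2 + r) := by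
      refine Finset.sum_le_sum fun r hr => ?_
      have := Finset.mem_range.1 hr
      refine mul_le_mul ?_ (ha (by omega)) (h0 _) (by positivity)
      exact_mod_cast Nat.le_add_right _ _
    rw [h1]
    simp only [Finset.sum_const, Finset.card_range, nsmul_eq_mul] at h2
    have h3 : (k : ℝ) ≤ 3 * ((k / 2 : ℕ) : ℝ) := by
      have : k ≤ 3 * (k / 2) := by omega
      exact_mod_cast this
    calc (k : ℝ) ^ 2 * β k ≤ (3 * ((k / 2 : ℕ) : ℝ)) ^ 2 * β k :=
          mul_le_mul_of_nonneg_right (pow_le_pow_left₀ (by positivity) h3 2) (h0 k)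
      _ = 9 * (((k / 2 : ℕ) : ℝ) * (((k / 2 : ℕ) : ℝ) * β k)) := by ring
      _ ≤ _ := by linarith

lemma exists_Ca {Ω : Type*} [MeasurableSpace Ω] (P : Measure Ω) [IsProbabilityMeasure P]
    (A : ℕ → Set Ω) (a : ℕ → ℝ) (φ : ℝ → ℝ)
    (h : ∀ l : ℕ, 1 ≤ l → P.real (A l) ≤ a l * φ ((l : ℝ) ^ (-6 : ℤ)))
    (hO : (fun l : ℕ => a l * φ ((l : ℝ) ^ (-6 : ℤ))) =O[atTop] fun l : ℕ => (l : ℝ) ^ (-6 : ℤ)) :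
    ∃ C : ℝ, 0 ≤ C ∧ ∀ l : ℕ, 1 ≤ l → P.real (A l) ≤ C * ((l : ℝ)⁻¹) ^ 6 := by
  obtain ⟨c, hc, hb⟩ := hO.exists_pos
  obtain ⟨N, hN⟩ := eventually_atTop.1 hb.bound
  have hz : ∀ l : ℕ, (l : ℝ) ^ (-6 : ℤ) = ((l : ℝ)⁻¹) ^ 6 := fun l => by
    rw [zpow_neg, inv_pow]; norm_cast
  refine ⟨c + (N : ℝ) ^ 6, by positivity, fun l hl => ?_⟩
  have hl0 : (0 : ℝ) < l := by exact_mod_cast hl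
  rw [add_mul]
  rcases le_total N l with h1 | h1
  · have h2 := hN l h1
    rw [hz, Real.norm_eq_abs, Real.norm_eq_abs, abs_of_nonneg (show 0 ≤ ((l : ℝ)⁻¹) ^ 6 by positivity)] at h2
    have h3 := h l hl
    rw [hz] at h3
    have h4 := le_abs_self (a l * φ ((l : ℝ)⁻¹ ^ 6))
    have : 0 ≤ (N : ℝ) ^ 6 * ((l : ℝ)⁻¹) ^ 6 := by positivity
    linarith
  · have h2 : P.real (A l) ≤ 1 := measureReal_le_one
    have h3 : 1 ≤ (N : ℝ) ^ 6 * ((l : ℝ)⁻¹) ^ 6 := by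
      rw [← mul_pow, ← div_eq_mul_inv]
      refine one_le_pow₀ ?_
      rw [one_le_div hl0]; exact_mod_cast h1
    have : 0 ≤ c * ((l : ℝ)⁻¹) ^ 6 := by positivity
    linarith

/-- Under Assumptions 1, 2 and 3, `√n (U_n(U⁻¹(p)) - p)` converges in
distribution to the centered normal law with variance
`σ² = 4 Σ_{r ∈ ℤ} Cov(h₁(X_0, U⁻¹(p)), h₁(X_r, U⁻¹(p)))`. -/
theorem ustatistic_clt
    {Ω : Type*} [MeasurableSpace Ω] (P : Measure Ω) [IsProbabilityMeasure P]
    (X Z : ℤ → Ω → ℝ) (hX : ∀ i, Measurable (X i)) (hZ : ∀ i, Measurable (Z i))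
    (p : ℝ) (hp : p ∈ Set.Ioo (0 : ℝ) 1)
    (h : ℝ → ℝ → ℝ → ℝ) (hker : IsUQKernel h) (u : ℝ → ℝ)
    (hA1 : Assumption1 P X Z)
    (hA2 : Assumption2 (P.map (X 0)) h p)
    (hA3 : Assumption3 (P.map (X 0)) h p u) :
    ∀ f : BoundedContinuousFunction ℝ ℝ,
      Tendsto
        (fun n : ℕ =>
          ∫ ω, f (Real.sqrt n * (Ustat X h n (Uinv (P.map (X 0)) h p) ω - p)) ∂P)
        atTop
        (𝓝 (∫ x, f x ∂(ProbabilityTheory.gaussianReal 0 (Real.toNNReal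
          (4 * ∑' r : ℤ,
            covShift P X (fun x => h1 (P.map (X 0)) h x (Uinv (P.map (X 0)) h p)) r))))) := by
  intro f
  obtain ⟨a, φ, -, -, -, ⟨g, hg, hga⟩, hO⟩ := hA1.pned
  obtain ⟨β, hβ0, hβb, hβs⟩ := hA1.mixing
  obtain ⟨L, δ, hδ, hL⟩ := hA2
  obtain ⟨M, hM⟩ := hker.bounded
  have hUp : Udist (P.map (X 0)) h (Uinv (P.map (X 0)) h p) = p := by
    have h1 := (hA3.2.2.def (zero_lt_one)).self_of_nhds
    simp only [sub_self, mul_zero, sub_zero, abs_zero] at h1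
    rw [Real.zero_rpow (by norm_num), norm_zero, mul_zero, norm_le_zero_iff] at h1
    linarith
  set t0 := Uinv (P.map (X 0)) h p with ht0
  have hvar := hL t0 (by simpa using hδ)
  obtain ⟨Ca, hCa0, hCa⟩ := exists_Ca P (fun l : ℕ => {ω | ((l : ℝ)⁻¹) ^ 6 <
      |X 0 ω - g l fun i => Z (((i : ℕ) : ℤ) - (l : ℤ)) ω|}) a φ (fun l hl => by
    have hl0 : (0 : ℝ) < l := by exact_mod_cast hl
    have hz : (l : ℝ) ^ (-6 : ℤ) = ((l : ℝ)⁻¹) ^ 6 := by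
      rw [zpow_neg, inv_pow]; norm_cast
    rw [hz]
    exact hga l _ (by positivity)) hO
  obtain ⟨hs1, hs2⟩ := anti_rate (bmin β) (bmin_nonneg β hβ0) (bmin_anti β)
    (Summable.of_nonneg_of_le (fun k => mul_nonneg (by positivity) (bmin_nonneg β hβ0 k))
      (fun k => mul_le_mul_of_nonneg_left (bmin_le β k) (by positivity)) hβs)
  let S : Setup P :=
    { X := X, Z := Z, hX := hX, hZ := hZ, hst := hA1.stationary, β := bmin β
      β0 := bmin_nonneg β hβ0, hβ := bmin_bound P Z β hβb, f := g, hf := hg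
      Ca := Ca, Ca0 := hCa0, approx := hCa
      H := fun x y => h x y t0, M := max M 1, M1 := le_max_right _ _
      H0 := fun x y => hker.nonneg x y t0
      HM := fun x y => (hM x y t0).trans (le_max_left _ _)
      Hm := hker.measurable.comp (measurable_fst.prodMk (measurable_snd.prodMk measurable_const))
      Hs := fun x y => hker.symm x y t0
      L := max L 0, L0 := le_max_right _ _
      var := fun ε hε => (hvar ε hε).trans
        (ENNReal.ofReal_le_ofReal (mul_le_mul_of_nonneg_right (le_max_left _ _) hε.le)) }
  have hcov : ∀ r : ℤ, covShift P X (fun x => h1 (P.map (X 0)) h x t0) r = S.cz r := by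
    intro r
    have h1 : ∫ ω, (fun x => h1 (P.map (X 0)) h x t0) (X 0 ω) ∂P = 0 := S.g1_meanX 0
    unfold covShift
    rw [h1, zero_mul, sub_zero]
    rfl
  have hmain := S.clt hs1 hs2 f
  simp_rw [hcov]
  refine hmain.congr fun n => ?_
  refine integral_congr_ae (ae_of_all _ fun ω => ?_)
  show f (S.V n ω) = _
  congr 1
  have hθ : S.θ = p := hUp
  unfold Setup.V Ustat
  rw [hθ]

end UQuantile
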